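/- Let Γ be a finitely generated free group and j, ρ : Γ → PSL(2,ℝ) homomorphisms. Assume there exist: (a) a collection 𝒜 of geodesic lines of ℍ with j(γ)·α ∈ 𝒜 for all γ ∈ Γ and α ∈ 𝒜, such that any two distinct members of 𝒜 are disjoint and share no endpoint, every compact subset of ℍ meets only finitely many members of 𝒜, and j(Γ) acts freely and transitively on the set of connected components of ℍ ∖ ⋃_{α∈𝒜} α; (b) a family (g_α)_{α∈𝒜} of elements of PSL(2,ℝ) with g_{j(γ)·α} = ρ(γ) g_α j(γ)⁻¹ for all γ ∈ Γ and α ∈ 𝒜; (c) a constant K > 0 such that d(g_α·x, g_{α'}·x') ≤ d(x, x') − K for all distinct α, α' ∈ 𝒜 and all x ∈ α, x' ∈ α'. Then the action γ·x = ρ(γ) x j(γ)⁻¹ of Γ on PSL(2,ℝ) is properly discontinuous, the right AdS crooked planes g_α·C*(α), α ∈ 𝒜, are pairwise disjoint, and the closure of some connected component of PSL(2,ℝ) ∖ ⋃_{α∈𝒜} g_α·C*(α) is a fundamental domain for this action. -/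

import Mathlib

noncomputable section

open Filter Topology Pointwise
open scoped UpperHalfPlane

/-- `SL(2,ℝ)`. -/
abbrev SL2 := Matrix.SpecialLinearGroup (Fin 2) ℝ

instance : TopologicalSpace SL2 :=
  TopologicalSpace.induced (fun A : SL2 => (A : Matrix (Fin 2) (Fin 2) ℝ)) inferInstance

/-- `PSL(2,ℝ) = SL(2,ℝ)/{±I}`. -/
abbrev PSL2 := SL2 ⧸ Subgroup.center SL2

/-- The Möbius action of an element of `PSL(2,ℝ)` on the upper half-plane,
computed via an (arbitrary) lift to `SL(2,ℝ)`; this is well defined since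
`-I` acts trivially. -/
def pslSMul (g : PSL2) (z : ℍ) : ℍ := (Quotient.out g) • z

/-- Image of a subset of `ℍ` under the Möbius action of `g ∈ PSL(2,ℝ)`. -/
def pslImg (g : PSL2) (s : Set ℍ) : Set ℍ := pslSMul g '' s

/-- A geodesic line of `ℍ`: the image of an isometric embedding of `ℝ` into `ℍ`. -/
def IsGeodesicLine (l : Set ℍ) : Prop := ∃ γ : ℝ → ℍ, Isometry γ ∧ Set.range γ = l

/-- The embedding of `ℍ` into the one-point compactification of `ℂ`. -/
def embH (z : ℍ) : OnePoint ℂ := ((z : ℂ) : OnePoint ℂ)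

/-- The embedding of `∂∞ℍ = ℝ ∪ {∞}` into the one-point compactification of `ℂ`. -/
def toC : OnePoint ℝ → OnePoint ℂ := OnePoint.map Complex.ofReal

/-- The vector `v(ξ) ∈ ℝ²` associated with a boundary point `ξ ∈ ℝ ∪ {∞}`:
`v(ξ) = (ξ, 1)` for `ξ ∈ ℝ` and `v(∞) = (1, 0)`. -/
def bvec (ξ : OnePoint ℝ) : Fin 2 → ℝ := Option.elim ξ ![1, 0] (fun r => ![r, 1])

/-- The extended Möbius action of `PSL(2,ℝ)` on `∂∞ℍ = ℝ ∪ {∞}`. -/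
def bdSMul (g : PSL2) (ξ : OnePoint ℝ) : OnePoint ℝ :=
  let w := ((Quotient.out g : SL2) : Matrix (Fin 2) (Fin 2) ℝ).mulVec (bvec ξ)
  if w 1 = 0 then OnePoint.infty else ((w 0 / w 1 : ℝ) : OnePoint ℝ)

/-- `ξ ∈ ℝ ∪ {∞}` is an endpoint of the geodesic line `l`: some isometric
parametrization of `l` tends to `ξ` (in the one-point compactification of `ℂ`). -/
def IsEndpoint (l : Set ℍ) (ξ : OnePoint ℝ) : Prop :=
  ∃ γ : ℝ → ℍ, Isometry γ ∧ Set.range γ = l ∧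
    Tendsto (fun t => embH (γ t)) atTop (𝓝 (toC ξ))

/-- `h ∈ PSL(2,ℝ)` has a nonattracting fixed point at `ξ ∈ ℝ ∪ {∞}`. -/
def HasNonattracting (h : PSL2) (ξ : OnePoint ℝ) : Prop :=
  ∃ A : SL2, (QuotientGroup.mk A : PSL2) = h ∧
    ∃ μ : ℝ, |μ| ≤ 1 ∧ (A : Matrix (Fin 2) (Fin 2) ℝ).mulVec (bvec ξ) = μ • bvec ξ

/-- `h ∈ PSL(2,ℝ)` has a nonrepelling fixed point at `ξ ∈ ℝ ∪ {∞}`. -/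
def HasNonrepelling (h : PSL2) (ξ : OnePoint ℝ) : Prop :=
  ∃ A : SL2, (QuotientGroup.mk A : PSL2) = h ∧
    ∃ μ : ℝ, 1 ≤ |μ| ∧ (A : Matrix (Fin 2) (Fin 2) ℝ).mulVec (bvec ξ) = μ • bvec ξ

/-- The right AdS crooked plane `C*(l)` centered at the identity. -/
def rightCrooked (l : Set ℍ) : Set PSL2 :=
  {h | (∃ x ∈ l, pslSMul h x = x) ∨ ∃ ξ, IsEndpoint l ξ ∧ HasNonattracting h ξ}

/-- The left AdS crooked plane `C(l)` centered at the identity. -/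
def leftCrooked (l : Set ℍ) : Set PSL2 :=
  {h | (∃ x ∈ l, pslSMul h x = x) ∨ ∃ ξ, IsEndpoint l ξ ∧ HasNonrepelling h ξ}

/-- A general right AdS crooked plane: a set of the form `g·C*(l)`. -/
def IsRightCrookedPlane (S : Set PSL2) : Prop :=
  ∃ (g : PSL2) (l : Set ℍ), IsGeodesicLine l ∧ S = (g * ·) '' rightCrooked l

/-- A general left AdS crooked plane: a set of the form `C(l)·g`. -/
def IsLeftCrookedPlane (S : Set PSL2) : Prop :=
  ∃ (g : PSL2) (l : Set ℍ), IsGeodesicLine l ∧ S = (· * g) '' leftCrooked l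

variable {Γ : Type*} [Group Γ]

/-- The action `γ·x = ρ(γ) x j(γ)⁻¹` of `Γ` on `PSL(2,ℝ)`, applied to a set. -/
def actImg (j ρ : Γ →* PSL2) (γ : Γ) (S : Set PSL2) : Set PSL2 :=
  (fun x => ρ γ * x * (j γ)⁻¹) '' S

/-- The action `γ·x = ρ(γ) x j(γ)⁻¹` is properly discontinuous. -/
def ProperlyDisc (j ρ : Γ →* PSL2) : Prop :=
  ∀ K : Set PSL2, IsCompact K → {γ : Γ | (actImg j ρ γ K ∩ K).Nonempty}.Finite

/-- `R` is a fundamental domain for the action `γ·x = ρ(γ) x j(γ)⁻¹`: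
`R` is closed, its translates cover `PSL(2,ℝ)`, and the interiors of the
translates are pairwise disjoint. -/
def IsFundDom (j ρ : Γ →* PSL2) (R : Set PSL2) : Prop :=
  IsClosed R ∧ (⋃ γ : Γ, actImg j ρ γ R) = Set.univ ∧
    Pairwise fun γ₁ γ₂ : Γ =>
      Disjoint (interior (actImg j ρ γ₁ R)) (interior (actImg j ρ γ₂ R))

/-- The action admits a fundamental domain bounded by pairwise disjoint
right AdS crooked planes. -/
def AdmitsRightCrookedFD (j ρ : Γ →* PSL2) : Prop :=
  ∃ (m : ℕ) (D : Fin m → Set PSL2), (∀ i, IsRightCrookedPlane (D i)) ∧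
    (∀ (γ γ' : Γ) (i i' : Fin m),
      actImg j ρ γ (D i) = actImg j ρ γ' (D i') ∨
      Disjoint (actImg j ρ γ (D i)) (actImg j ρ γ' (D i'))) ∧
    ∃ x ∈ (⋃ (γ : Γ) (i : Fin m), actImg j ρ γ (D i))ᶜ,
      IsFundDom j ρ
        (closure (connectedComponentIn (⋃ (γ : Γ) (i : Fin m), actImg j ρ γ (D i))ᶜ x))

/-- The action admits a fundamental domain bounded by pairwise disjoint
left AdS crooked planes. -/
def AdmitsLeftCrookedFD (j ρ : Γ →* PSL2) : Prop :=
  ∃ (m : ℕ) (D : Fin m → Set PSL2), (∀ i, IsLeftCrookedPlane (D i)) ∧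
    (∀ (γ γ' : Γ) (i i' : Fin m),
      actImg j ρ γ (D i) = actImg j ρ γ' (D i') ∨
      Disjoint (actImg j ρ γ (D i)) (actImg j ρ γ' (D i'))) ∧
    ∃ x ∈ (⋃ (γ : Γ) (i : Fin m), actImg j ρ γ (D i))ᶜ,
      IsFundDom j ρ
        (closure (connectedComponentIn (⋃ (γ : Γ) (i : Fin m), actImg j ρ γ (D i))ᶜ x))

/-- The translation length `λ(g) = inf_{p ∈ ℍ} d(p, g·p)`. -/
def transLength (g : PSL2) : ℝ := ⨅ p : ℍ, dist p (pslSMul g p)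

/-- `U` is a connected component of `S`. -/
def IsCC (S U : Set ℍ) : Prop := ∃ x ∈ S, connectedComponentIn S x = U

/-- `ξ ∈ ℝ ∪ {∞}` is an ideal point of `U ⊆ ℍ`: a limit of a sequence of points
of `U` in the one-point compactification of `ℂ`. -/
def IsIdealPoint (U : Set ℍ) (ξ : OnePoint ℝ) : Prop :=
  ∃ u : ℕ → ℍ, (∀ n, u n ∈ U) ∧ Tendsto (fun n => embH (u n)) atTop (𝓝 (toC ξ))

/-- The closed right crooked half-space `H̄*₊(l, U)`. -/
def closedRHS (l U : Set ℍ) : Set PSL2 :=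
  {h | (∃ x ∈ l ∪ U, pslSMul h x = x) ∨ ∃ ξ, IsIdealPoint U ξ ∧ HasNonattracting h ξ}

/-- The open right crooked half-space `H*₊(l, U)`. -/
def openRHS (l U : Set ℍ) : Set PSL2 :=
  {h | h ≠ 1 ∧ ((∃ x ∈ U, pslSMul h x = x) ∨
    ∃ ξ, IsIdealPoint U ξ ∧ ¬ IsEndpoint l ξ ∧ HasNonattracting h ξ)}

/-- The circle of (Euclidean) radius `c` in `ℍ` centered at `0`; for suitable `c`
this is a geodesic line of `ℍ`. -/
def circ (c : ℝ) : Set ℍ := {z : ℍ | ‖(z : ℂ)‖ = c}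

/-- The stem quadrant `SQ(ℓ)` for `ℓ = {|z| = 1/R}` transversely oriented towards `0`. -/
def SQell (R : ℝ) : Set PSL2 :=
  {h | ∃ (A : SL2) (α β v : ℝ), (QuotientGroup.mk A : PSL2) = h ∧
    (A : Matrix (Fin 2) (Fin 2) ℝ) = !![α, -v/R; v*R, β] ∧
    |α| < |β| ∧ 2*|v| < |α - β|}

/-- The inverse stem quadrant `SQ(ℓ')⁻¹` for `ℓ' = {|z| = R}` transversely
oriented towards `∞`. -/
def SQell'inv (R : ℝ) : Set PSL2 :=
  {h | ∃ (A : SL2) (α β v : ℝ), (QuotientGroup.mk A : PSL2) = h ∧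
    (A : Matrix (Fin 2) (Fin 2) ℝ) = !![α, v*R; -v/R, β] ∧
    |α| < |β| ∧ 2*|v| < |α - β|}

/-- The stem quadrant `SQ(ℓ')`. -/
def SQell' (R : ℝ) : Set PSL2 := {h | h⁻¹ ∈ SQell'inv R}

section

instance instTopGroupSL2 : IsTopologicalGroup SL2 :=
  @Matrix.SpecialLinearGroup.topologicalGroup (Fin 2) ℝ _ _ _ _ _

instance instContSMulSL2 : ContinuousSMul SL2 ℍ :=
  @UpperHalfPlane.instContinuousSMulSL2R

theorem continuous_entry (i k : Fin 2) : Continuous fun A : SL2 => A i k := by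
  have : Continuous fun A : SL2 => (A : Matrix (Fin 2) (Fin 2) ℝ) := continuous_induced_dom
  exact this.matrix_elem i k

theorem sl_det (A : SL2) : A 0 0 * A 1 1 - A 0 1 * A 1 0 = 1 := by
  have := A.det_coe
  rwa [Matrix.det_fin_two] at this

theorem mk_eq_iff (A B : SL2) : (QuotientGroup.mk A : PSL2) = QuotientGroup.mk B ↔ B = A ∨ B = -A := by
  rw [QuotientGroup.eq, Matrix.SpecialLinearGroup.mem_center_iff]
  constructor
  · rintro ⟨r, hr, h⟩
    have hr2 : r = 1 ∨ r = -1 := by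
      have : r ^ 2 = 1 := by simpa using hr
      exact mul_self_eq_one_iff.mp (by nlinarith)
    have hB : B = A * (A⁻¹ * B) := by group
    rcases hr2 with rfl | rfl
    · left
      have : A⁻¹ * B = 1 := by ext i k; rw [← h]; simp
      rw [hB, this, mul_one]
    · right
      have : A⁻¹ * B = -1 := by
        ext i k; rw [← h]; fin_cases i <;> fin_cases k <;> simp
      rw [hB, this, mul_neg, mul_one]
  · rintro (rfl | rfl)
    · exact ⟨1, by simp, by simp⟩
    · refine ⟨-1, by simp, ?_⟩
      have : A⁻¹ * -A = -1 := by rw [mul_neg, inv_mul_cancel]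
      rw [this]; ext i k; fin_cases i <;> fin_cases k <;> simp

theorem mk_neg (A : SL2) : (QuotientGroup.mk (-A) : PSL2) = QuotientGroup.mk A := by
  rw [mk_eq_iff]; right; simp

theorem coe_smul' (A : SL2) (z : ℍ) :
    ((A • z : ℍ) : ℂ) = ((A 0 0 : ℂ) * z + A 0 1) / ((A 1 0 : ℂ) * z + A 1 1) := by
  simpa using UpperHalfPlane.coe_specialLinearGroup_apply A z

theorem denom_ne (A : SL2) (z : ℍ) : ((A 1 0 : ℂ) * z + A 1 1) ≠ 0 := by
  have := UpperHalfPlane.denom_ne_zero (A : GL (Fin 2) ℝ) z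
  simpa [UpperHalfPlane.denom] using this

theorem im_smul' (A : SL2) (z : ℍ) :
    (A • z).im = z.im / ‖((A 1 0 : ℂ) * z + A 1 1)‖ ^ 2 := by
  have h := UpperHalfPlane.im_smul_eq_div_normSq (A : GL (Fin 2) ℝ) z
  rw [← Complex.normSq_eq_norm_sq]
  have h2 : (A • z) = ((A : GL (Fin 2) ℝ)) • z := rfl
  rw [h2, h]
  simp [UpperHalfPlane.denom]

theorem neg_smul' (A : SL2) (z : ℍ) : (-A) • z = A • z := by
  apply UpperHalfPlane.ext
  rw [coe_smul', coe_smul']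
  have : ∀ i k, (-A) i k = - A i k := fun i k => by simp
  simp only [this, Complex.ofReal_neg]
  rw [← neg_div_neg_eq]; congr 1 <;> ring

theorem pslSMul_mk (A : SL2) (z : ℍ) : pslSMul (QuotientGroup.mk A) z = A • z := by
  unfold pslSMul
  have h : (QuotientGroup.mk (Quotient.out (QuotientGroup.mk A : PSL2)) : PSL2) = QuotientGroup.mk A :=
    Quotient.out_eq _
  rw [mk_eq_iff] at h
  rcases h with h | h
  · rw [← h]
  · conv_rhs => rw [h]
    rw [neg_smul']

theorem exists_lift (g : PSL2) : ∃ A : SL2, (QuotientGroup.mk A : PSL2) = g :=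
  QuotientGroup.mk_surjective g

theorem pslSMul_mul (g h : PSL2) (z : ℍ) : pslSMul (g * h) z = pslSMul g (pslSMul h z) := by
  obtain ⟨A, rfl⟩ := exists_lift g
  obtain ⟨B, rfl⟩ := exists_lift h
  rw [← QuotientGroup.mk_mul, pslSMul_mk, pslSMul_mk, pslSMul_mk, mul_smul]

theorem pslSMul_one (z : ℍ) : pslSMul 1 z = z := by
  have := pslSMul_mk 1 z
  rwa [one_smul] at this

theorem pslSMul_inv (g : PSL2) (z : ℍ) : pslSMul g⁻¹ (pslSMul g z) = z := by
  rw [← pslSMul_mul, inv_mul_cancel, pslSMul_one]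

theorem pslSMul_inv' (g : PSL2) (z : ℍ) : pslSMul g (pslSMul g⁻¹ z) = z := by
  rw [← pslSMul_mul, mul_inv_cancel, pslSMul_one]

theorem pslSMul_dist (g : PSL2) (z w : ℍ) : dist (pslSMul g z) (pslSMul g w) = dist z w := by
  obtain ⟨A, rfl⟩ := exists_lift g
  rw [pslSMul_mk, pslSMul_mk, dist_smul]

theorem pslSMul_continuous (g : PSL2) : Continuous (pslSMul g) :=
  (Isometry.of_dist_eq (pslSMul_dist g)).continuous

/-- the action of an element as a homeomorphism -/
def pslHomeo (g : PSL2) : ℍ ≃ₜ ℍ where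
  toFun := pslSMul g
  invFun := pslSMul g⁻¹
  left_inv := pslSMul_inv g
  right_inv := pslSMul_inv' g
  continuous_toFun := pslSMul_continuous g
  continuous_invFun := pslSMul_continuous g⁻¹

theorem pslImg_eq (g : PSL2) (s : Set ℍ) : pslImg g s = pslHomeo g '' s := rfl

theorem mem_pslImg (g : PSL2) (s : Set ℍ) (z : ℍ) : z ∈ pslImg g s ↔ pslSMul g⁻¹ z ∈ s := by
  constructor
  · rintro ⟨y, hy, rfl⟩; rwa [pslSMul_inv]
  · intro h; exact ⟨_, h, pslSMul_inv' g z⟩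

theorem pslImg_mul (g h : PSL2) (s : Set ℍ) : pslImg (g * h) s = pslImg g (pslImg h s) := by
  ext z; simp only [mem_pslImg]; rw [mul_inv_rev, pslSMul_mul]

theorem pslImg_one (s : Set ℍ) : pslImg 1 s = s := by
  ext z; simp only [mem_pslImg]; rw [inv_one, pslSMul_one]

theorem continuous_orbit (o : ℍ) : Continuous fun g : PSL2 => pslSMul g o := by
  have hq : IsQuotientMap (QuotientGroup.mk : SL2 → PSL2) := isQuotientMap_quot_mk
  rw [hq.continuous_iff]
  have : ((fun g : PSL2 => pslSMul g o) ∘ (QuotientGroup.mk : SL2 → PSL2)) = fun A : SL2 => A • o := by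
    funext A; exact pslSMul_mk A o
  rw [this]
  exact continuous_id.smul continuous_const

/-! complex vectors -/

/-- linear action on `ℂ²` -/
def cact (A : SL2) (w : ℂ × ℂ) : ℂ × ℂ :=
  ((A 0 0 : ℂ) * w.1 + A 0 1 * w.2, (A 1 0 : ℂ) * w.1 + A 1 1 * w.2)

theorem cact_mul (A B : SL2) (w : ℂ × ℂ) : cact (A * B) w = cact A (cact B w) := by
  have h : ∀ i k, (A * B) i k = A i 0 * B 0 k + A i 1 * B 1 k := by
    intro i k
    simp [Matrix.SpecialLinearGroup.coe_mul, Matrix.mul_apply, Fin.sum_univ_two]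
  ext <;> simp only [cact, h] <;> push_cast <;> ring

theorem cact_one (w : ℂ × ℂ) : cact 1 w = w := by
  ext <;> simp [cact]

theorem cact_inv (A : SL2) (w : ℂ × ℂ) : cact A⁻¹ (cact A w) = w := by
  rw [← cact_mul, inv_mul_cancel, cact_one]

theorem cact_inv' (A : SL2) (w : ℂ × ℂ) : cact A (cact A⁻¹ w) = w := by
  rw [← cact_mul, mul_inv_cancel, cact_one]

theorem cact_smul (A : SL2) (c : ℂ) (w : ℂ × ℂ) : cact A (c • w) = c • cact A w := by
  ext <;> simp [cact] <;> ring

theorem cact_neg (A : SL2) (w : ℂ × ℂ) : cact (-A) w = - cact A w := by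
  ext <;> simp [cact] <;> ring

theorem cact_zero (A : SL2) : cact A 0 = 0 := by
  ext <;> simp [cact]

theorem cact_ne_zero (A : SL2) {w : ℂ × ℂ} (h : w ≠ 0) : cact A w ≠ 0 := by
  intro h2
  apply h
  rw [← cact_inv A w, h2, cact_zero]

theorem continuous_cact (A : SL2) : Continuous (cact A) := by
  unfold cact; fun_prop

theorem continuous_cact' : Continuous fun p : SL2 × (ℂ × ℂ) => cact p.1 p.2 := by
  unfold cact
  have h := fun i k => (Complex.continuous_ofReal.comp (continuous_entry i k)).comp
    (continuous_fst (X := SL2) (Y := ℂ × ℂ))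
  simp only [Function.comp_def] at h
  have h00 := h 0 0
  have h01 := h 0 1
  have h10 := h 1 0
  have h11 := h 1 1
  fun_prop

/-- the hermitian-type bracket -/
def br (w w' : ℂ × ℂ) : ℂ := w.1 * (starRingEnd ℂ) w'.2 - w.2 * (starRingEnd ℂ) w'.1

theorem br_act (A : SL2) (w w' : ℂ × ℂ) : br (cact A w) (cact A w') = br w w' := by
  have h : (A 0 0 : ℂ) * A 1 1 - A 0 1 * A 1 0 = 1 := by exact_mod_cast sl_det A
  simp only [br, cact, map_add, map_mul, Complex.conj_ofReal]
  linear_combination (w.1 * (starRingEnd ℂ) w'.2 - w.2 * (starRingEnd ℂ) w'.1) * h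

theorem br_smul (c c' : ℂ) (w w' : ℂ × ℂ) :
    br (c • w) (c' • w') = c * (starRingEnd ℂ) c' * br w w' := by
  simp only [br, Prod.smul_fst, Prod.smul_snd, smul_eq_mul, map_mul]; ring

theorem continuous_br : Continuous fun p : (ℂ × ℂ) × (ℂ × ℂ) => br p.1 p.2 := by
  unfold br
  have := Complex.continuous_conj
  fun_prop

/-- lift of a point -/
def vec (z : ℍ) : ℂ × ℂ := (z, 1)

theorem cact_vec (A : SL2) (z : ℍ) :
    cact A (vec z) = ((A 1 0 : ℂ) * z + A 1 1) • vec (A • z) := by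
  have := denom_ne A z
  ext
  · simp only [cact, vec, Prod.smul_fst, smul_eq_mul, coe_smul']; rw [mul_div_cancel₀ _ this]; simp
  · simp [cact, vec]

theorem norm_br_vec (z w : ℍ) :
    ‖br (vec z) (vec w)‖ = 2 * √(z.im * w.im) * Real.cosh (dist z w / 2) := by
  have h : 0 < √(z.im * w.im) := Real.sqrt_pos.mpr (mul_pos z.im_pos w.im_pos)
  rw [UpperHalfPlane.cosh_half_dist, Complex.dist_eq]
  simp only [br, vec, map_one]
  field_simp

theorem norm_br_act_vec (A B : SL2) (z w : ℍ) :
    ‖br (cact A (vec z)) (cact B (vec w))‖ =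
      2 * √(z.im * w.im) * Real.cosh (dist (A • z) (B • w) / 2) := by
  rw [cact_vec, cact_vec, br_smul, norm_mul, norm_mul, norm_br_vec, im_smul', im_smul', RCLike.norm_conj]
  have h1 : 0 < ‖((A 1 0 : ℂ) * z + A 1 1)‖ := norm_pos_iff.mpr (denom_ne A z)
  have h2 : 0 < ‖((B 1 0 : ℂ) * w + B 1 1)‖ := norm_pos_iff.mpr (denom_ne B w)
  set a := ‖((A 1 0 : ℂ) * z + A 1 1)‖
  set b := ‖((B 1 0 : ℂ) * w + B 1 1)‖
  have : √(z.im / a ^ 2 * (w.im / b ^ 2)) = √(z.im * w.im) / (a * b) := by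
    rw [show z.im / a ^ 2 * (w.im / b ^ 2) = (z.im * w.im) / (a * b) ^ 2 by field_simp]
    rw [Real.sqrt_div' _ (by positivity), Real.sqrt_sq (by positivity)]
  rw [this]
  field_simp

theorem cosh_contract {a b k : ℝ} (ha : 0 ≤ a) (hk : 0 ≤ k) (h : a ≤ b - k) :
    Real.cosh (a / 2) * Real.cosh (k / 2) ≤ Real.cosh (b / 2) := by
  have h1 : Real.cosh ((a + k) / 2) ≤ Real.cosh (b / 2) := by
    rw [Real.cosh_le_cosh, abs_of_nonneg (by linarith), abs_of_nonneg (by linarith)]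
    linarith
  have h2 : Real.cosh ((a + k) / 2) = Real.cosh (a / 2) * Real.cosh (k / 2)
      + Real.sinh (a / 2) * Real.sinh (k / 2) := by
    rw [← Real.cosh_add]; ring_nf
  have h3 : 0 ≤ Real.sinh (a / 2) := Real.sinh_nonneg_iff.mpr (by linarith)
  have h4 : 0 ≤ Real.sinh (k / 2) := Real.sinh_nonneg_iff.mpr (by linarith)
  nlinarith [mul_nonneg h3 h4]

/-- closed cone over a subset of the hyperbolic plane -/
def coneOf (P : Set ℍ) : Set (ℂ × ℂ) := closure {w | ∃ z ∈ P, ∃ c : ℂ, w = c • vec z}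

theorem coneOf_act (A : SL2) (P : Set ℍ) {w : ℂ × ℂ} (hw : w ∈ coneOf P) :
    cact A w ∈ coneOf ((A • ·) '' P) := by
  refine map_mem_closure (continuous_cact A) hw ?_
  rintro _ ⟨z, hz, c, rfl⟩
  refine ⟨A • z, ⟨z, hz, rfl⟩, c * ((A 1 0 : ℂ) * z + A 1 1), ?_⟩
  rw [cact_smul, cact_vec, smul_smul]

/-- generalized crooked half-space -/
def Dset (g : PSL2) (P : Set ℍ) : Set PSL2 :=
  {x | ∃ X G : SL2, (QuotientGroup.mk X : PSL2) = x ∧ (QuotientGroup.mk G : PSL2) = g ∧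
    ∃ w ∈ coneOf P, w ≠ 0 ∧ ∃ μ : ℂ, ‖μ‖ ≤ 1 ∧ cact X w = μ • cact G w}

theorem mem_Dset_mk (X G : SL2) (P : Set ℍ) : (QuotientGroup.mk X : PSL2) ∈ Dset (QuotientGroup.mk G) P ↔
    ∃ w ∈ coneOf P, w ≠ 0 ∧ ∃ μ : ℂ, ‖μ‖ ≤ 1 ∧ cact X w = μ • cact G w := by
  constructor
  · rintro ⟨X', G', hX, hG, w, hw, hw0, μ, hμ, h⟩
    rw [mk_eq_iff] at hX hG
    rcases hX with rfl | rfl <;> rcases hG with rfl | rfl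
    · exact ⟨w, hw, hw0, μ, hμ, h⟩
    · exact ⟨w, hw, hw0, -μ, by simpa using hμ, by rw [cact_neg, h]; simp⟩
    · exact ⟨w, hw, hw0, -μ, by simpa using hμ, by rw [cact_neg, h]; simp⟩
    · exact ⟨w, hw, hw0, μ, hμ, by rw [cact_neg, cact_neg, h]; simp⟩
  · rintro ⟨w, hw, hw0, μ, hμ, h⟩
    exact ⟨X, G, rfl, rfl, w, hw, hw0, μ, hμ, h⟩

theorem Dset_act_aux (a b g x : PSL2) (P : Set ℍ) (h : x ∈ Dset g P) :
    a * x * b⁻¹ ∈ Dset (a * g * b⁻¹) (pslImg b P) := by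
  obtain ⟨A, rfl⟩ := exists_lift a
  obtain ⟨B, rfl⟩ := exists_lift b
  obtain ⟨X, rfl⟩ := exists_lift x
  obtain ⟨G, rfl⟩ := exists_lift g
  rw [mem_Dset_mk] at h
  obtain ⟨w, hw, hw0, μ, hμ, h⟩ := h
  rw [← QuotientGroup.mk_inv, ← QuotientGroup.mk_mul, ← QuotientGroup.mk_mul, ← QuotientGroup.mk_mul,
    ← QuotientGroup.mk_mul, mem_Dset_mk]
  refine ⟨cact B w, ?_, cact_ne_zero B hw0, μ, hμ, ?_⟩
  · have : pslImg (QuotientGroup.mk B) P = (B • ·) '' P := by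
      unfold pslImg; congr 1; funext z; exact pslSMul_mk B z
    rw [this]; exact coneOf_act B P hw
  · rw [cact_mul, cact_mul, cact_inv, cact_mul, cact_mul, cact_inv, h, cact_smul]

theorem Dset_act (a b g x : PSL2) (P : Set ℍ) :
    a * x * b⁻¹ ∈ Dset (a * g * b⁻¹) (pslImg b P) ↔ x ∈ Dset g P := by
  refine ⟨fun h => ?_, Dset_act_aux a b g x P⟩
  have := Dset_act_aux a⁻¹ b⁻¹ _ _ _ h
  rw [← pslImg_mul, inv_mul_cancel, pslImg_one] at this
  convert this using 1
  · group
  · group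

theorem Dset_key_closed (G G' : SL2) (k : ℝ) : IsClosed {p : (ℂ × ℂ) × (ℂ × ℂ) |
        ‖br (cact G p.1) (cact G' p.2)‖ * Real.cosh (k / 2) ≤ ‖br p.1 p.2‖} := by
  have h1 : Continuous fun p : (ℂ × ℂ) × (ℂ × ℂ) => (cact G p.1, cact G' p.2) :=
    ((continuous_cact G).comp continuous_fst).prodMk ((continuous_cact G').comp continuous_snd)
  have h2 : Continuous fun p : (ℂ × ℂ) × (ℂ × ℂ) => ‖br (cact G p.1) (cact G' p.2)‖ :=
    (continuous_br.comp h1).norm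
  exact isClosed_le (h2.mul continuous_const) continuous_br.norm

theorem Dset_key {G G' : SL2} {P P' : Set ℍ} {k : ℝ} (hk : 0 < k)
    (h : ∀ p ∈ P, ∀ p' ∈ P', dist (pslSMul (QuotientGroup.mk G) p) (pslSMul (QuotientGroup.mk G') p')
      ≤ dist p p' - k) : ∀ w ∈ coneOf P, ∀ w' ∈ coneOf P',
      ‖br (cact G w) (cact G' w')‖ * Real.cosh (k / 2) ≤ ‖br w w'‖ := by
  intro w hw w' hw'
  have hc : (w, w') ∈ closure ({w | ∃ z ∈ P, ∃ c : ℂ, w = c • vec z} ×ˢ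
      {w | ∃ z ∈ P', ∃ c : ℂ, w = c • vec z}) := by
    rw [closure_prod_eq]; exact ⟨hw, hw'⟩
  have hsub : ({w | ∃ z ∈ P, ∃ c : ℂ, w = c • vec z} ×ˢ
      {w | ∃ z ∈ P', ∃ c : ℂ, w = c • vec z}) ⊆ {p : (ℂ × ℂ) × (ℂ × ℂ) |
        ‖br (cact G p.1) (cact G' p.2)‖ * Real.cosh (k / 2) ≤ ‖br p.1 p.2‖} := by
    rintro ⟨_, _⟩ ⟨⟨z, hz, c, rfl⟩, ⟨z', hz', c', rfl⟩⟩
    change ‖br (cact G (c • vec z)) (cact G' (c' • vec z'))‖ * Real.cosh (k / 2) ≤ ‖br (c • vec z) (c' • vec z')‖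
    rw [cact_smul, cact_smul, br_smul, br_smul, norm_mul _ (br _ _), norm_mul _ (br _ _), norm_br_act_vec, norm_br_vec]
    have h1 := h z hz z' hz'
    rw [pslSMul_mk, pslSMul_mk] at h1
    have h2 := cosh_contract dist_nonneg hk.le h1
    have h3 : 0 ≤ ‖c * (starRingEnd ℂ) c'‖ * (2 * √(z.im * z'.im)) := by positivity
    have h4 := mul_le_mul_of_nonneg_left h2 h3
    calc _ = ‖c * (starRingEnd ℂ) c'‖ * (2 * √(z.im * z'.im)) *
          (Real.cosh (dist (G • z) (G' • z') / 2) * Real.cosh (k / 2)) := by ring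
      _ ≤ _ := h4
      _ = _ := by ring
  have := (Dset_key_closed G G' k).closure_subset_iff.mpr hsub hc
  exact this

/-- a contraction inequality on two sets separates the half-spaces -/
theorem Dset_disjoint {g g' : PSL2} {P P' : Set ℍ} {k : ℝ} (hk : 0 < k)
    (h : ∀ p ∈ P, ∀ p' ∈ P', dist (pslSMul g p) (pslSMul g' p') ≤ dist p p' - k)
    (hne : ∀ w ∈ coneOf P, ∀ w' ∈ coneOf P', w ≠ 0 → w' ≠ 0 → br w w' ≠ 0)
    {x : PSL2} (hx : x ∈ Dset g P) (hx' : x ∈ Dset g' P') : False := by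
  obtain ⟨X, rfl⟩ := exists_lift x
  obtain ⟨G, rfl⟩ := exists_lift g
  obtain ⟨G', rfl⟩ := exists_lift g'
  rw [mem_Dset_mk] at hx hx'
  obtain ⟨w, hw, hw0, μ, hμ, e⟩ := hx
  obtain ⟨w', hw', hw0', μ', hμ', e'⟩ := hx'
  have key := @Dset_key G G' P P' k hk h
  have h1 := key w hw w' hw'
  have h2 : br w w' = μ * (starRingEnd ℂ) μ' * br (cact G w) (cact G' w') := by
    rw [← br_act X, e, e', br_smul]
  have h3 : 0 < ‖br w w'‖ := norm_pos_iff.mpr (hne w hw w' hw' hw0 hw0')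
  have h4 : ‖br w w'‖ ≤ ‖br (cact G w) (cact G' w')‖ := by
    rw [h2, norm_mul, norm_mul, RCLike.norm_conj]
    have : ‖μ‖ * ‖μ'‖ ≤ 1 := mul_le_one₀ hμ (norm_nonneg _) hμ'
    exact mul_le_of_le_one_left (norm_nonneg _) this
  have h5 : 1 < Real.cosh (k / 2) := Real.one_lt_cosh.mpr (by positivity)
  nlinarith

end

section

/-- squared modulus of the denominator -/
def den (A : SL2) (z : ℍ) : ℝ := (A 1 0 * z.re + A 1 1) ^ 2 + (A 1 0 * z.im) ^ 2

theorem den_eq (A : SL2) (z : ℍ) : den A z = Complex.normSq ((A 1 0 : ℂ) * z + A 1 1) := by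
  simp [den, Complex.normSq_apply]; ring

theorem den_pos (A : SL2) (z : ℍ) : 0 < den A z := by
  rw [den_eq]; exact Complex.normSq_pos.mpr (denom_ne A z)

theorem re_smul (A : SL2) (z : ℍ) : (A • z).re =
    ((A 0 0 * z.re + A 0 1) * (A 1 0 * z.re + A 1 1) + A 0 0 * A 1 0 * z.im ^ 2) / den A z := by
  rw [← UpperHalfPlane.coe_re, coe_smul', Complex.div_re, ← den_eq, ← add_div]
  congr 1
  simp; ring

theorem im_smul2 (A : SL2) (z : ℍ) : (A • z).im = z.im / den A z := by
  rw [im_smul', den_eq, Complex.normSq_eq_norm_sq]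

/-- the vertical unit speed geodesic -/
def gz (t : ℝ) : ℍ := ⟨⟨0, Real.exp t⟩, Real.exp_pos t⟩

@[simp] theorem gz_re (t : ℝ) : (gz t).re = 0 := rfl
@[simp] theorem gz_im (t : ℝ) : (gz t).im = Real.exp t := rfl

theorem gz_isom : Isometry gz := UpperHalfPlane.isometry_vertical_line 0

theorem gz_of_re {z : ℍ} (h : z.re = 0) : gz (Real.log z.im) = z := by
  apply UpperHalfPlane.ext_re_im
  · rw [gz_re, h]
  · rw [gz_im, Real.exp_log z.im_pos]

/-- rotation about `i` -/
def rot (θ : ℝ) : SL2 := ⟨!![Real.cos θ, Real.sin θ; -Real.sin θ, Real.cos θ], by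
  rw [Matrix.det_fin_two]; simp; nlinarith [Real.sin_sq_add_cos_sq θ]⟩

theorem rot_gz_zero (θ : ℝ) : rot θ • gz 0 = gz 0 := by
  have hd : den (rot θ) (gz 0) = 1 := by
    simp [den, rot]
  apply UpperHalfPlane.ext_re_im
  · rw [re_smul, hd]; simp [rot]; ring
  · rw [im_smul2, hd]; simp

/-- order two rotation -/
def Jm : SL2 := ⟨!![0, 1; -1, 0], by rw [Matrix.det_fin_two]; simp⟩

theorem den_J (z : ℍ) : den Jm z = z.re ^ 2 + z.im ^ 2 := by simp [den, Jm]

theorem J_re (z : ℍ) : (Jm • z).re = - z.re / (z.re ^ 2 + z.im ^ 2) := by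
  rw [re_smul, den_J]; simp [Jm]

theorem J_gz (t : ℝ) : Jm • gz t = gz (-t) := by
  apply UpperHalfPlane.ext_re_im
  · rw [J_re]; simp
  · rw [im_smul2, den_J]; simp [Real.exp_neg]; field_simp

theorem exists_rot (z : ℍ) : ∃ R : SL2, R • gz 0 = gz 0 ∧ (R • z).re = 0 := by
  have hc : Continuous fun θ : ℝ => (Real.cos θ * z.re + Real.sin θ) * (-Real.sin θ * z.re + Real.cos θ)
      + Real.cos θ * (-Real.sin θ) * z.im ^ 2 := by fun_prop
  have h0 : (0:ℝ) ∈ Set.uIcc ((Real.cos 0 * z.re + Real.sin 0) * (-Real.sin 0 * z.re + Real.cos 0)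
      + Real.cos 0 * (-Real.sin 0) * z.im ^ 2)
      ((Real.cos (Real.pi/2) * z.re + Real.sin (Real.pi/2)) * (-Real.sin (Real.pi/2) * z.re + Real.cos (Real.pi/2))
      + Real.cos (Real.pi/2) * (-Real.sin (Real.pi/2)) * z.im ^ 2) := by
    simp [Set.mem_uIcc]
    exact le_total _ _
  obtain ⟨θ, _, hθ⟩ := intermediate_value_uIcc hc.continuousOn h0
  refine ⟨rot θ, rot_gz_zero θ, ?_⟩
  rw [re_smul, div_eq_zero_iff]; left
  simpa [rot] using hθ

theorem exists_move (p q : ℍ) : ∃ B : SL2, B • gz 0 = p ∧ B • gz (dist p q) = q := by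
  obtain ⟨T, hT⟩ : ∃ T : SL2, T • gz 0 = p := MulAction.exists_smul_eq SL2 (gz 0) p
  obtain ⟨R, hR, hR2⟩ := exists_rot (T⁻¹ • q)
  have h1 := gz_of_re hR2
  set s := Real.log (R • T⁻¹ • q).im
  have hB : (T * R⁻¹) • gz 0 = p := by
    rw [mul_smul, inv_smul_eq_iff.mpr hR.symm, hT]
  have hq : (T * R⁻¹) • gz s = q := by
    rw [h1, mul_smul, inv_smul_smul, smul_inv_smul]
  have hd : dist p q = |s| := by
    rw [← hB]; conv_lhs => rw [← hq]
    rw [dist_smul, gz_isom.dist_eq, Real.dist_eq]; simp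
  rcases le_total 0 s with h | h
  · refine ⟨T * R⁻¹, hB, ?_⟩
    rw [hd, abs_of_nonneg h, hq]
  · refine ⟨T * R⁻¹ * Jm, ?_, ?_⟩
    · rw [mul_smul, J_gz, neg_zero, hB]
    · rw [hd, abs_of_nonpos h, mul_smul, J_gz, neg_neg, hq]

theorem isom_unique {z : ℍ} {t : ℝ} (h0 : dist z (gz 0) = |t|) (h1 : dist z (gz 1) = |t - 1|) : z = gz t := by
  have e0 := UpperHalfPlane.cosh_dist' z (gz 0)
  have e1 := UpperHalfPlane.cosh_dist' z (gz 1)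
  rw [h0, Real.cosh_abs] at e0
  rw [h1, Real.cosh_abs] at e1
  simp only [gz_re, gz_im, sub_zero, Real.exp_zero] at e0 e1
  have hy := z.im_pos
  set x := z.re
  set y := z.im
  have hE : 0 < Real.exp t := Real.exp_pos t
  have he : 1 < Real.exp 1 := Real.one_lt_exp_iff.mpr one_pos
  rw [Real.cosh_eq] at e0 e1
  rw [show -(t-1) = 1 - t by ring, Real.exp_sub, Real.exp_sub] at e1
  rw [Real.exp_neg] at e0
  set E := Real.exp t
  set e := Real.exp 1
  field_simp at e0 e1
  have hyE : y = E := by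
    have h3 : (e ^ 2 - 1) * (y - E) = 0 := by nlinarith
    rcases mul_eq_zero.mp h3 with h | h
    · nlinarith
    · linarith
  have hx : x ^ 2 = 0 := by
    rw [hyE] at e0; nlinarith
  apply UpperHalfPlane.ext_re_im
  · exact pow_eq_zero_iff (two_ne_zero) |>.mp hx
  · exact hyE

theorem isom_form {γ : ℝ → ℍ} (h : Isometry γ) : ∃ B : SL2, ∀ t, γ t = B • gz t := by
  obtain ⟨B, h0, h1⟩ := exists_move (γ 0) (γ 1)
  rw [h.dist_eq, show dist (0:ℝ) 1 = 1 by simp] at h1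
  refine ⟨B, fun t => ?_⟩
  rw [← inv_smul_eq_iff]
  apply isom_unique
  · rw [← dist_smul B, smul_inv_smul, h0, h.dist_eq, Real.dist_eq, sub_zero]
  · rw [← dist_smul B, smul_inv_smul, h1, h.dist_eq, Real.dist_eq]

/-- the line with frame `B` -/
def lineOf (B : SL2) : Set ℍ := {z | (B⁻¹ • z).re = 0}

theorem mem_lineOf {B : SL2} {z : ℍ} : z ∈ lineOf B ↔ (B⁻¹ • z).re = 0 := Iff.rfl

theorem range_gz (B : SL2) : Set.range (fun t => B • gz t) = lineOf B := by
  ext z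
  constructor
  · rintro ⟨t, rfl⟩
    simp [lineOf]
  · intro h
    exact ⟨Real.log (B⁻¹ • z).im, by simp only [gz_of_re h, smul_inv_smul]⟩

theorem line_form {l : Set ℍ} (h : IsGeodesicLine l) : ∃ B : SL2, l = lineOf B := by
  obtain ⟨γ, hγ, rfl⟩ := h
  obtain ⟨B, hB⟩ := isom_form hγ
  exact ⟨B, by rw [← range_gz]; congr 1; funext t; exact hB t⟩

theorem isom_smul_gz (B : SL2) : Isometry fun t => B • gz t :=
  (isometry_smul ℍ B).comp gz_isom

theorem line_isGeo (B : SL2) : IsGeodesicLine (lineOf B) :=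
  ⟨_, isom_smul_gz B, range_gz B⟩

theorem lineOf_mul (A B : SL2) : lineOf (A * B) = pslImg (QuotientGroup.mk A) (lineOf B) := by
  ext z
  rw [mem_pslImg, ← QuotientGroup.mk_inv, pslSMul_mk, mem_lineOf, mem_lineOf, mul_inv_rev, mul_smul]

theorem lineOf_J (B : SL2) : lineOf (B * Jm) = lineOf B := by
  ext z
  have h : Jm⁻¹ = -Jm := by
    ext i k
    rw [Matrix.SpecialLinearGroup.coe_inv, Matrix.SpecialLinearGroup.coe_neg]
    fin_cases i <;> fin_cases k <;> simp [Jm, Matrix.adjugate_fin_two]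
  rw [mem_lineOf, mem_lineOf, mul_inv_rev, mul_smul, h, neg_smul', J_re, div_eq_zero_iff]
  constructor
  · rintro (h | h)
    · linarith
    · have := (B⁻¹ • z).im_pos; nlinarith [sq_nonneg (B⁻¹ • z).re]
  · intro h; left; rw [h, neg_zero]

/-- stabilizer of the vertical line -/
theorem stab_line {A : SL2} (h : ∀ t, (A • gz t).re = 0) :
    (A 0 1 = 0 ∧ A 1 0 = 0) ∨ (A 0 0 = 0 ∧ A 1 1 = 0) := by
  have h' : ∀ t, A 0 1 * A 1 1 + A 0 0 * A 1 0 * Real.exp t ^ 2 = 0 := by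
    intro t
    have := h t
    rw [re_smul, div_eq_zero_iff] at this
    rcases this with h | h
    · simpa using h
    · exact absurd h (den_pos A _).ne'
  have h0 := h' 0
  have h1 := h' (Real.log 2)
  rw [Real.exp_log (by norm_num)] at h1
  rw [Real.exp_zero] at h0
  have e1 : A 0 0 * A 1 0 = 0 := by linarith
  have e2 : A 0 1 * A 1 1 = 0 := by linarith
  have hd := sl_det A
  rcases mul_eq_zero.mp e1 with h | h
  · right; refine ⟨h, ?_⟩
    rcases mul_eq_zero.mp e2 with h2 | h2
    · rw [h, h2] at hd; simp at hd
    · exact h2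
  · left; refine ⟨?_, h⟩
    rcases mul_eq_zero.mp e2 with h2 | h2
    · exact h2
    · rw [h, h2] at hd; simp at hd

theorem frame_rel {B B' : SL2} (h : lineOf B = lineOf B') :
    ((B⁻¹ * B') 0 1 = 0 ∧ (B⁻¹ * B') 1 0 = 0) ∨ ((B⁻¹ * B') 0 0 = 0 ∧ (B⁻¹ * B') 1 1 = 0) := by
  apply stab_line
  intro t
  have : B' • gz t ∈ lineOf B := by rw [h, ← range_gz]; exact ⟨t, rfl⟩
  rw [mul_smul]; exact this

/-- two frames of one line define the same sides up to a swap -/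
theorem frame_sign {B B' : SL2} (h : lineOf B = lineOf B') :
    ∃ ε : ℝ, ε ^ 2 = 1 ∧ ∀ z : ℍ, ∃ k : ℝ, 0 < k ∧ (B⁻¹ • z).re = ε * k * (B'⁻¹ • z).re := by
  have hz : ∀ z : ℍ, B⁻¹ • z = (B⁻¹ * B') • (B'⁻¹ • z) := fun z => by
    rw [mul_smul, smul_inv_smul]
  set A := B⁻¹ * B'
  have hd := sl_det A
  rcases frame_rel h with ⟨h1, h2⟩ | ⟨h1, h2⟩
  · refine ⟨1, by norm_num, fun z => ⟨1 / den A (B'⁻¹ • z), by have := den_pos A (B'⁻¹ • z); positivity, ?_⟩⟩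
    rw [hz, re_smul, h1, h2]
    rw [h1, h2] at hd
    have : A 0 0 * A 1 1 = 1 := by linarith
    rw [show (A 0 0 * (B'⁻¹ • z).re + 0) * (0 * (B'⁻¹ • z).re + A 1 1) + A 0 0 * 0 * (B'⁻¹ • z).im ^ 2 =
      (A 0 0 * A 1 1) * (B'⁻¹ • z).re by ring, this]
    ring
  · refine ⟨-1, by norm_num, fun z => ⟨1 / den A (B'⁻¹ • z), by have := den_pos A (B'⁻¹ • z); positivity, ?_⟩⟩
    rw [hz, re_smul, h1, h2]
    rw [h1, h2] at hd
    have : A 0 1 * A 1 0 = -1 := by linarith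
    rw [show (0 * (B'⁻¹ • z).re + A 0 1) * (A 1 0 * (B'⁻¹ • z).re + 0) + 0 * A 1 0 * (B'⁻¹ • z).im ^ 2 =
      (A 0 1 * A 1 0) * (B'⁻¹ • z).re by ring, this]
    ring

theorem sg_along (B B' : SL2) : ∃ a c : ℝ, ∀ t, ∃ k : ℝ, 0 < k ∧
    (B⁻¹ • B' • gz t).re = k * (a * Real.exp (2 * t) + c) := by
  refine ⟨(B⁻¹ * B') 0 0 * (B⁻¹ * B') 1 0, (B⁻¹ * B') 0 1 * (B⁻¹ * B') 1 1, fun t =>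
    ⟨1 / den (B⁻¹ * B') (gz t), by have := den_pos (B⁻¹ * B') (gz t); positivity, ?_⟩⟩
  rw [← mul_smul, re_smul]
  rw [show 2 * t = t + t by ring, Real.exp_add]
  simp; ring

end

section

theorem bvec_infty : bvec OnePoint.infty = ![1, 0] := rfl
theorem bvec_coe (r : ℝ) : bvec (r : OnePoint ℝ) = ![r, 1] := rfl

theorem toC_inj : Function.Injective toC := by
  intro a b h
  induction a using OnePoint.rec with
  | infty =>
    induction b using OnePoint.rec with
    | infty => rfl
    | coe b => simp [toC] at h
  | coe a =>
    induction b using OnePoint.rec with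
    | infty => simp [toC] at h
    | coe b => simpa [toC] using h

theorem exists_bvec (v : Fin 2 → ℝ) (hv : v ≠ 0) : ∃ ξ, ∃ k : ℝ, k ≠ 0 ∧ bvec ξ = k • v := by
  by_cases h : v 1 = 0
  · have h0 : v 0 ≠ 0 := fun h0 => hv (by ext i; fin_cases i <;> simp [h, h0])
    refine ⟨OnePoint.infty, (v 0)⁻¹, inv_ne_zero h0, ?_⟩
    rw [bvec_infty]; ext i; fin_cases i <;> simp [h, h0]
  · refine ⟨((v 0 / v 1 : ℝ) : OnePoint ℝ), (v 1)⁻¹, inv_ne_zero h, ?_⟩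
    rw [bvec_coe]; ext i; fin_cases i
    · simp; field_simp
    · simp [h]

theorem tendsto_end (B : SL2) (ξ : OnePoint ℝ) (k : ℝ) (hk : k ≠ 0)
    (h : bvec ξ = k • ![B 0 0, B 1 0]) :
    Tendsto (fun t => embH (B • gz t)) atTop (𝓝 (toC ξ)) := by
  have hd := sl_det B
  have hgz : ∀ t, ((gz t : ℍ) : ℂ) = Complex.I * (Real.exp t : ℝ) := by
    intro t; apply Complex.ext <;> simp [gz, Complex.exp_ofReal_re]
  have hexp : Tendsto (fun t => ((Real.exp t : ℝ) : ℂ)⁻¹) atTop (𝓝 0) := by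
    have h1 : Tendsto (fun t => (Real.exp t)⁻¹) atTop (𝓝 0) :=
      Real.tendsto_exp_atTop.inv_tendsto_atTop
    have := (Complex.continuous_ofReal.tendsto 0).comp h1
    simpa [Function.comp_def] using this
  induction ξ using OnePoint.rec with
  | infty =>
    have h0 := congrFun h 0
    have h1 := congrFun h 1
    simp [bvec_infty, hk] at h0 h1
    have hc : ∀ i j, ((B : SL2) i j : ℝ) = B.1 i j := fun i j => rfl
    change Tendsto (fun t => ((B • gz t : ℍ) : OnePoint ℂ)) atTop (𝓝 (OnePoint.infty))
    refine OnePoint.tendsto_coe_infty.comp ?_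
    rw [coclosedCompact_eq_cocompact, ← Metric.cobounded_eq_cocompact, ← tendsto_norm_atTop_iff_cobounded]
    have ha : B 0 0 * B 1 1 = 1 := by rw [h1] at hd; linarith
    refine tendsto_atTop_mono (f := fun t => Real.exp t / (B 1 1) ^ 2) ?_ ?_
    · intro t
      have : ((B • gz t : ℍ) : ℂ).im ≤ ‖((B • gz t : ℍ) : ℂ)‖ := (le_abs_self _).trans (Complex.abs_im_le_norm _)
      refine le_trans (le_of_eq ?_) this
      rw [UpperHalfPlane.coe_im, im_smul2]
      simp [den, h1]
    · have : 0 < (B 1 1) ^ 2 := by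
        have : B 1 1 ≠ 0 := fun h => by rw [h] at ha; simp at ha
        positivity
      exact Real.tendsto_exp_atTop.atTop_div_const this
  | coe r =>
    have h0 := congrFun h 0
    have h1 := congrFun h 1
    simp [bvec_coe] at h0 h1
    have hc : B 1 0 ≠ 0 := fun hc => by rw [hc] at h1; simp at h1
    have hr : r = B 0 0 / B 1 0 := by
      rw [eq_div_iff hc, h0]; linear_combination (-B 0 0) * h1
    change Tendsto (fun t => ((B • gz t : ℍ) : OnePoint ℂ)) atTop (𝓝 (((r : ℂ)) : OnePoint ℂ))
    refine (OnePoint.continuous_coe.tendsto _).comp ?_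
    have e : ∀ t, ((B • gz t : ℍ) : ℂ) =
        ((B 0 0 : ℂ) * Complex.I + B 0 1 * ((Real.exp t : ℝ) : ℂ)⁻¹) /
        ((B 1 0 : ℂ) * Complex.I + B 1 1 * ((Real.exp t : ℝ) : ℂ)⁻¹) := by
      intro t
      have hE : ((Real.exp t : ℝ) : ℂ) ≠ 0 := by exact_mod_cast (Real.exp_pos t).ne'
      rw [coe_smul', hgz]
      rw [← mul_div_mul_right _ _ (inv_ne_zero hE)]
      congr 1 <;> field_simp
    simp only [e]
    have hcI : (B 1 0 : ℂ) * Complex.I ≠ 0 := mul_ne_zero (by exact_mod_cast hc) Complex.I_ne_zero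
    have hcC : (B 1 0 : ℂ) ≠ 0 := by exact_mod_cast hc
    have h3 : Tendsto (fun t => ((B 0 0 : ℂ) * Complex.I + B 0 1 * ((Real.exp t : ℝ) : ℂ)⁻¹) /
        ((B 1 0 : ℂ) * Complex.I + B 1 1 * ((Real.exp t : ℝ) : ℂ)⁻¹)) atTop
        (𝓝 (((B 0 0 : ℂ) * Complex.I + B 0 1 * 0) / ((B 1 0 : ℂ) * Complex.I + B 1 1 * 0))) := by
      refine Tendsto.div ?_ ?_ (by simpa using hc)
      · exact tendsto_const_nhds.add (tendsto_const_nhds.mul hexp)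
      · exact tendsto_const_nhds.add (tendsto_const_nhds.mul hexp)
    convert h3 using 2
    rw [hr]; push_cast
    simp only [mul_zero, add_zero]
    rw [mul_div_mul_right _ _ Complex.I_ne_zero]

theorem col_ne (B : SL2) : ![B 0 0, B 1 0] ≠ 0 := by
  intro h
  have h0 := congrFun h 0
  have h1 := congrFun h 1
  simp at h0 h1
  have hd := sl_det B
  rw [h0, h1] at hd; simp at hd

theorem sl_mul_apply (A B : SL2) (i k : Fin 2) : (A * B) i k = A i 0 * B 0 k + A i 1 * B 1 k := by
  simp [Matrix.SpecialLinearGroup.coe_mul, Matrix.mul_apply, Fin.sum_univ_two]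

theorem isEndpoint_iff (B : SL2) (ξ : OnePoint ℝ) : IsEndpoint (lineOf B) ξ ↔
    (∃ k : ℝ, k ≠ 0 ∧ bvec ξ = k • ![B 0 0, B 1 0]) ∨ (∃ k : ℝ, k ≠ 0 ∧ bvec ξ = k • ![B 0 1, B 1 1]) := by
  constructor
  · rintro ⟨γ, hγ, hr, hl⟩
    obtain ⟨B', hB'⟩ := isom_form hγ
    have hγ' : γ = fun t => B' • gz t := funext hB'
    subst hγ'
    rw [range_gz] at hr
    obtain ⟨ξ', k, hk, hξ'⟩ := exists_bvec _ (col_ne B')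
    have := tendsto_nhds_unique hl (tendsto_end B' ξ' k hk hξ')
    have := toC_inj this
    subst this
    have hB : B' = B * (B⁻¹ * B') := by group
    have e : ∀ i k, B' i k = B i 0 * (B⁻¹ * B') 0 k + B i 1 * (B⁻¹ * B') 1 k := by
      intro i k
      conv_lhs => rw [hB]
      rw [sl_mul_apply]
    have hd := sl_det (B⁻¹ * B')
    rcases frame_rel hr.symm with ⟨h1, h2⟩ | ⟨h1, h2⟩
    · left
      refine ⟨k * (B⁻¹ * B') 0 0, mul_ne_zero hk (fun h => by rw [h, h1] at hd; simp at hd), ?_⟩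
      rw [hξ', e 0 0, e 1 0, h2]
      ext i; fin_cases i <;> simp <;> ring
    · right
      refine ⟨k * (B⁻¹ * B') 1 0, mul_ne_zero hk (fun h => by rw [h, h1] at hd; simp at hd), ?_⟩
      rw [hξ', e 0 0, e 1 0, h1]
      ext i; fin_cases i <;> simp <;> ring
  · rintro (⟨k, hk, h⟩ | ⟨k, hk, h⟩)
    · exact ⟨_, isom_smul_gz B, range_gz B, tendsto_end B ξ k hk h⟩
    · refine ⟨_, isom_smul_gz (B * Jm), (range_gz _).trans (lineOf_J B), tendsto_end (B * Jm) ξ (-k) (neg_ne_zero.mpr hk) ?_⟩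
      rw [h, sl_mul_apply, sl_mul_apply]
      ext i; fin_cases i <;> simp [Jm]

/-- the model crooked plane -/
def C0 (X : SL2) : Prop :=
  (∃ t, X • gz t = gz t) ∨ (X 1 0 = 0 ∧ |X 0 0| ≤ 1) ∨ (X 0 1 = 0 ∧ |X 1 1| ≤ 1)

theorem mulVec_conj (B X : SL2) (v : Fin 2 → ℝ) (μ k : ℝ) (hk : k ≠ 0) :
    ((B * X * B⁻¹ : SL2) : Matrix (Fin 2) (Fin 2) ℝ).mulVec (k • (B : Matrix (Fin 2) (Fin 2) ℝ).mulVec v) =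
      μ • (k • (B : Matrix (Fin 2) (Fin 2) ℝ).mulVec v) ↔
    (X : Matrix (Fin 2) (Fin 2) ℝ).mulVec v = μ • v := by
  have hinj : ∀ u w : Fin 2 → ℝ, (B : Matrix (Fin 2) (Fin 2) ℝ).mulVec u =
      (B : Matrix (Fin 2) (Fin 2) ℝ).mulVec w → u = w := by
    intro u w h
    have := congrArg ((B⁻¹ : SL2) : Matrix (Fin 2) (Fin 2) ℝ).mulVec h
    rw [Matrix.mulVec_mulVec, Matrix.mulVec_mulVec, ← Matrix.SpecialLinearGroup.coe_mul, inv_mul_cancel] at this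
    simpa using this
  have e : ((B * X * B⁻¹ : SL2) : Matrix (Fin 2) (Fin 2) ℝ).mulVec
      (k • (B : Matrix (Fin 2) (Fin 2) ℝ).mulVec v) =
      (B : Matrix (Fin 2) (Fin 2) ℝ).mulVec (k • (X : Matrix (Fin 2) (Fin 2) ℝ).mulVec v) := by
    rw [Matrix.mulVec_smul, Matrix.mulVec_smul, Matrix.mulVec_mulVec, ← Matrix.SpecialLinearGroup.coe_mul,
      inv_mul_cancel_right, Matrix.SpecialLinearGroup.coe_mul, Matrix.mulVec_mulVec]
  have e2 : μ • (k • (B : Matrix (Fin 2) (Fin 2) ℝ).mulVec v) =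
      (B : Matrix (Fin 2) (Fin 2) ℝ).mulVec (k • (μ • v)) := by
    rw [Matrix.mulVec_smul, Matrix.mulVec_smul, smul_comm]
  rw [e, e2]
  constructor
  · intro h
    have := hinj _ _ h
    exact smul_right_injective _ hk this
  · intro h
    rw [h]

theorem nonattr_iff (B X : SL2) (v : Fin 2 → ℝ) (ξ : OnePoint ℝ) (k : ℝ) (hk : k ≠ 0)
    (h : bvec ξ = k • (B : Matrix (Fin 2) (Fin 2) ℝ).mulVec v) :
    HasNonattracting (QuotientGroup.mk (B * X * B⁻¹)) ξ ↔
      ∃ μ : ℝ, |μ| ≤ 1 ∧ (X : Matrix (Fin 2) (Fin 2) ℝ).mulVec v = μ • v := by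
  constructor
  · rintro ⟨A, hA, μ, hμ, e⟩
    rw [mk_eq_iff] at hA
    rw [h] at e
    rcases hA with hA | hA
    · rw [← hA, mulVec_conj B X v μ k hk] at e
      exact ⟨μ, hμ, e⟩
    · refine ⟨-μ, by simpa using hμ, ?_⟩
      rw [← mulVec_conj B X v _ k hk, hA, Matrix.SpecialLinearGroup.coe_neg, Matrix.neg_mulVec, e, neg_smul]
  · rintro ⟨μ, hμ, e⟩
    refine ⟨_, rfl, μ, hμ, ?_⟩
    rw [h, mulVec_conj B X v μ k hk]
    exact e

theorem rightCrooked_line (B X : SL2) :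
    (QuotientGroup.mk (B * X * B⁻¹) : PSL2) ∈ rightCrooked (lineOf B) ↔ C0 X := by
  have c1 : ![B 0 0, B 1 0] = (B : Matrix (Fin 2) (Fin 2) ℝ).mulVec ![1, 0] := by
    ext i; fin_cases i <;> simp [Matrix.mulVec, dotProduct]
  have c2 : ![B 0 1, B 1 1] = (B : Matrix (Fin 2) (Fin 2) ℝ).mulVec ![0, 1] := by
    ext i; fin_cases i <;> simp [Matrix.mulVec, dotProduct]
  have x1 : (∃ μ : ℝ, |μ| ≤ 1 ∧ (X : Matrix (Fin 2) (Fin 2) ℝ).mulVec ![1, 0] = μ • ![1, 0]) ↔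
      (X 1 0 = 0 ∧ |X 0 0| ≤ 1) := by
    constructor
    · rintro ⟨μ, hμ, e⟩
      have h0 := congrFun e 0
      have h1 := congrFun e 1
      simp [Matrix.mulVec, dotProduct] at h0 h1
      exact ⟨h1, h0 ▸ hμ⟩
    · rintro ⟨h, h'⟩
      refine ⟨X 0 0, h', ?_⟩
      ext i; fin_cases i <;> simp [Matrix.mulVec, dotProduct, h]
  have x2 : (∃ μ : ℝ, |μ| ≤ 1 ∧ (X : Matrix (Fin 2) (Fin 2) ℝ).mulVec ![0, 1] = μ • ![0, 1]) ↔
      (X 0 1 = 0 ∧ |X 1 1| ≤ 1) := by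
    constructor
    · rintro ⟨μ, hμ, e⟩
      have h0 := congrFun e 0
      have h1 := congrFun e 1
      simp [Matrix.mulVec, dotProduct] at h0 h1
      exact ⟨h0, h1 ▸ hμ⟩
    · rintro ⟨h, h'⟩
      refine ⟨X 1 1, h', ?_⟩
      ext i; fin_cases i <;> simp [Matrix.mulVec, dotProduct, h]
  unfold C0 rightCrooked
  rw [← x1, ← x2]
  apply or_congr
  · constructor
    · rintro ⟨x, hx, e⟩
      rw [← range_gz] at hx
      obtain ⟨t, rfl⟩ := hx
      refine ⟨t, ?_⟩
      dsimp only at e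
      rw [pslSMul_mk, ← mul_smul, inv_mul_cancel_right, mul_smul] at e
      exact smul_left_cancel _ e
    · rintro ⟨t, e⟩
      refine ⟨B • gz t, by rw [← range_gz]; exact ⟨t, rfl⟩, ?_⟩
      rw [pslSMul_mk, ← mul_smul, inv_mul_cancel_right, mul_smul, e]
  · constructor
    · rintro ⟨ξ, hξ, hn⟩
      rw [isEndpoint_iff] at hξ
      rcases hξ with ⟨k, hk, h⟩ | ⟨k, hk, h⟩
      · left; rw [c1] at h; exact (nonattr_iff B X _ ξ k hk h).mp hn
      · right; rw [c2] at h; exact (nonattr_iff B X _ ξ k hk h).mp hn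
    · rintro (h | h)
      · obtain ⟨ξ, k, hk, hξ⟩ := exists_bvec _ (col_ne B)
        refine ⟨ξ, (isEndpoint_iff B ξ).mpr (Or.inl ⟨k, hk, hξ⟩), ?_⟩
        rw [c1] at hξ
        exact (nonattr_iff B X _ ξ k hk hξ).mpr h
      · have hne : ![B 0 1, B 1 1] ≠ 0 := by
          intro h
          have h0 := congrFun h 0
          have h1 := congrFun h 1
          simp at h0 h1
          have hd := sl_det B
          rw [h0, h1] at hd; simp at hd
        obtain ⟨ξ, k, hk, hξ⟩ := exists_bvec _ hne
        refine ⟨ξ, (isEndpoint_iff B ξ).mpr (Or.inr ⟨k, hk, hξ⟩), ?_⟩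
        rw [c2] at hξ
        exact (nonattr_iff B X _ ξ k hk hξ).mpr h

end

section

/-- model half plane -/
def Hs (ε : ℝ) : Set ℍ := {z | 0 ≤ ε * z.re}

/-- product of the first coordinate with the conjugate of the second -/
def pr (w : ℂ × ℂ) : ℂ := w.1 * (starRingEnd ℂ) w.2

theorem continuous_pr : Continuous pr := by
  unfold pr
  have := Complex.continuous_conj
  fun_prop

theorem pr_smul (c : ℂ) (w : ℂ × ℂ) : pr (c • w) = (Complex.normSq c : ℂ) * pr w := by
  simp only [pr, Prod.smul_fst, Prod.smul_snd, smul_eq_mul, map_mul, Complex.normSq_eq_conj_mul_self]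
  ring

theorem pr_smul_re (c : ℂ) (w : ℂ × ℂ) : (pr (c • w)).re = Complex.normSq c * (pr w).re := by
  rw [pr_smul, Complex.re_ofReal_mul]
theorem pr_smul_im (c : ℂ) (w : ℂ × ℂ) : (pr (c • w)).im = Complex.normSq c * (pr w).im := by
  rw [pr_smul, Complex.im_ofReal_mul]

theorem pr_vec (z : ℍ) : pr (vec z) = z := by simp [pr, vec]

/-- model cone -/
def cone (ε : ℝ) : Set (ℂ × ℂ) := {w | 0 ≤ (pr w).im ∧ 0 ≤ ε * (pr w).re}

theorem cone_closed (ε : ℝ) : IsClosed (cone ε) := by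
  have h1 : IsClosed {w : ℂ × ℂ | 0 ≤ (pr w).im} :=
    isClosed_le continuous_const (Complex.continuous_im.comp continuous_pr)
  have h2 : IsClosed {w : ℂ × ℂ | 0 ≤ ε * (pr w).re} :=
    isClosed_le continuous_const (continuous_const.mul (Complex.continuous_re.comp continuous_pr))
  exact h1.inter h2

theorem cone_smul (ε : ℝ) (c : ℂ) {w : ℂ × ℂ} (h : w ∈ cone ε) : c • w ∈ cone ε := by
  refine ⟨?_, ?_⟩
  · rw [pr_smul_im]; exact mul_nonneg (Complex.normSq_nonneg _) h.1
  · rw [pr_smul_re]; have := mul_nonneg (Complex.normSq_nonneg c) h.2; linarith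

/-- a vector with positive form is a multiple of a point -/
theorem exists_vec {w : ℂ × ℂ} (h : 0 < (pr w).im) : ∃ z : ℍ, w = w.2 • vec z ∧
    z.re = (pr w).re / Complex.normSq w.2 := by
  have h2 : w.2 ≠ 0 := by
    intro h2; simp [pr, h2] at h
  have hz : pr w / (Complex.normSq w.2 : ℂ) = w.1 / w.2 := by
    rw [pr, Complex.normSq_eq_conj_mul_self]
    have : (starRingEnd ℂ) w.2 ≠ 0 := by simpa using h2
    field_simp
  have him : 0 < (w.1 / w.2).im := by
    rw [← hz, Complex.div_ofReal_im]
    exact div_pos h (Complex.normSq_pos.mpr h2)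
  refine ⟨⟨w.1 / w.2, him⟩, ?_, ?_⟩
  · ext <;> simp [vec]; field_simp
  · rw [UpperHalfPlane.mk_re, ← hz, Complex.div_ofReal_re]

theorem coneOf_Hs (ε : ℝ) : coneOf (Hs ε) = cone ε := by
  apply Set.Subset.antisymm
  · apply closure_minimal _ (cone_closed ε)
    rintro _ ⟨z, hz, c, rfl⟩
    apply cone_smul
    refine ⟨?_, ?_⟩
    · rw [pr_vec]; exact z.im_pos.le
    · rw [pr_vec]; exact hz
  · intro w hw
    by_cases h0 : w = 0
    · refine subset_closure ⟨gz 0, by simp [Hs], 0, by simp [h0]⟩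
    let f : ℝ → ℂ × ℂ := fun s => (w.1 + Complex.I * s * w.2, w.2 - Complex.I * s * w.1)
    have hf : Continuous f := by fun_prop
    have hf0 : f 0 = w := by ext <;> simp [f]
    have hpim : ∀ s : ℝ, (pr (f s)).im = (pr w).im * (1 + s ^ 2) + s * (Complex.normSq w.1 + Complex.normSq w.2) := by
      intro s; simp [pr, f, Complex.normSq_apply]; ring
    have hpre : ∀ s : ℝ, (pr (f s)).re = (pr w).re * (1 - s ^ 2) := by
      intro s; simp [pr, f]; ring
    have hpos : 0 < Complex.normSq w.1 + Complex.normSq w.2 := by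
      have h1 := Complex.normSq_nonneg w.1
      have h2 := Complex.normSq_nonneg w.2
      rcases h1.eq_or_lt with h | h
      · rcases h2.eq_or_lt with h' | h'
        · exact absurd (Prod.ext (Complex.normSq_eq_zero.mp h.symm) (Complex.normSq_eq_zero.mp h'.symm)) h0
        · linarith
      · linarith
    have ht : Tendsto f (𝓝[>] 0) (𝓝 w) := by
      have := hf.tendsto 0
      rw [hf0] at this
      exact this.mono_left nhdsWithin_le_nhds
    refine mem_closure_of_tendsto ht ?_
    have : Set.Ioo (0:ℝ) 1 ∈ 𝓝[>] (0:ℝ) := Ioo_mem_nhdsGT one_pos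
    filter_upwards [this] with s hs
    have hi : 0 < (pr (f s)).im := by
      rw [hpim]
      have := mul_pos hs.1 hpos
      have := mul_nonneg hw.1 (by positivity : 0 ≤ 1 + s ^ 2)
      linarith
    obtain ⟨z, hz, hzre⟩ := exists_vec hi
    refine ⟨z, ?_, (f s).2, hz⟩
    change 0 ≤ ε * z.re
    rw [hzre, hpre, ← mul_div_assoc, ← mul_assoc]
    apply div_nonneg _ (Complex.normSq_nonneg _)
    apply mul_nonneg hw.2
    nlinarith [hs.1, hs.2]

/-- model half space -/
def DD (ε : ℝ) : Set PSL2 := Dset 1 (Hs ε)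

theorem mem_DD (X : SL2) (ε : ℝ) : (QuotientGroup.mk X : PSL2) ∈ DD ε ↔
    ∃ w ∈ cone ε, w ≠ 0 ∧ ∃ μ : ℂ, ‖μ‖ ≤ 1 ∧ cact X w = μ • w := by
  unfold DD
  rw [← QuotientGroup.mk_one, mem_Dset_mk, coneOf_Hs]
  simp only [cact_one]

theorem cact_conj (X : SL2) (w : ℂ × ℂ) :
    cact X ((starRingEnd ℂ) w.1, (starRingEnd ℂ) w.2) = ((starRingEnd ℂ) (cact X w).1, (starRingEnd ℂ) (cact X w).2) := by
  simp [cact]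

theorem exists_eig (X : SL2) : ∃ w : ℂ × ℂ, w ≠ 0 ∧ 0 ≤ (pr w).im ∧ ∃ μ : ℂ, ‖μ‖ ≤ 1 ∧ cact X w = μ • w := by
  have hd : (X 0 0 : ℂ) * X 1 1 - X 0 1 * X 1 0 = 1 := by exact_mod_cast sl_det X
  obtain ⟨μ, hμ1, hμ⟩ : ∃ μ : ℂ, ‖μ‖ ≤ 1 ∧ μ ^ 2 - (X 0 0 + X 1 1) * μ + 1 = 0 := by
    obtain ⟨s, hs⟩ := IsAlgClosed.exists_pow_nat_eq (((X 0 0 : ℂ) + X 1 1) ^ 2 - 4) (n := 2) (by norm_num)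
    set μ : ℂ := ((X 0 0 + X 1 1) + s) / 2 with hμ
    set ν : ℂ := ((X 0 0 + X 1 1) - s) / 2 with hν
    have hp : μ * ν = 1 := by rw [hμ, hν]; linear_combination (-1/4) * hs
    have hn : ‖μ‖ * ‖ν‖ = 1 := by rw [← norm_mul, hp, norm_one]
    by_cases h : ‖μ‖ ≤ 1
    · exact ⟨μ, h, by rw [hμ]; linear_combination (1/4) * hs⟩
    · refine ⟨ν, ?_, by rw [hν]; linear_combination (1/4) * hs⟩
      push Not at h
      by_contra h'
      push Not at h'
      nlinarith
  have hv : ∃ w : ℂ × ℂ, w ≠ 0 ∧ cact X w = μ • w := by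
    by_cases h1 : ((μ - X 1 1, (X 1 0 : ℂ)) : ℂ × ℂ) = 0
    · by_cases h2 : (((X 0 1 : ℂ), μ - X 0 0) : ℂ × ℂ) = 0
      · simp only [Prod.mk_eq_zero] at h1 h2
        refine ⟨(1, 0), by simp, ?_⟩
        ext
        · simp [cact]; linear_combination -h2.2
        · simpa [cact] using h1.2
      · refine ⟨_, h2, ?_⟩
        ext
        · simp [cact]; ring
        · simp [cact]; linear_combination -hμ - hd
    · refine ⟨_, h1, ?_⟩
      ext
      · simp [cact]; linear_combination -hμ - hd
      · simp [cact]; ring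
  obtain ⟨w, hw0, hw⟩ := hv
  by_cases h : 0 ≤ (pr w).im
  · exact ⟨w, hw0, h, μ, hμ1, hw⟩
  · refine ⟨((starRingEnd ℂ) w.1, (starRingEnd ℂ) w.2), ?_, ?_, (starRingEnd ℂ) μ, by simpa using hμ1, ?_⟩
    · intro h0; apply hw0
      simp only [Prod.mk_eq_zero, map_eq_zero] at h0
      exact Prod.ext h0.1 h0.2
    · push Not at h
      simp [pr] at h ⊢; linarith
    · rw [cact_conj, hw]; ext <;> simp

theorem DD_union : DD 1 ∪ DD (-1) = Set.univ := by
  rw [Set.eq_univ_iff_forall]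
  intro x
  obtain ⟨X, rfl⟩ := exists_lift x
  obtain ⟨w, h0, him, μ, hμ, e⟩ := exists_eig X
  rcases le_total 0 (pr w).re with h | h
  · left; rw [mem_DD]; exact ⟨w, ⟨him, by linarith⟩, h0, μ, hμ, e⟩
  · right; rw [mem_DD]; exact ⟨w, ⟨him, by linarith⟩, h0, μ, hμ, e⟩

/-- wedge of complex vectors -/
def wd (w w' : ℂ × ℂ) : ℂ := w.1 * w'.2 - w.2 * w'.1

theorem wd_act (A : SL2) (w w' : ℂ × ℂ) : wd (cact A w) (cact A w') = wd w w' := by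
  have h : (A 0 0 : ℂ) * A 1 1 - A 0 1 * A 1 0 = 1 := by exact_mod_cast sl_det A
  simp only [wd, cact]
  linear_combination (w.1 * w'.2 - w.2 * w'.1) * h

theorem wd_par {w w' : ℂ × ℂ} (h : wd w w' = 0) (h' : w' ≠ 0) : ∃ k : ℂ, w = k • w' := by
  by_cases h2 : w'.2 = 0
  · have h1 : w'.1 ≠ 0 := fun h1 => h' (Prod.ext h1 h2)
    refine ⟨w.1 / w'.1, ?_⟩
    ext
    · simp; field_simp
    · simp [wd, h2] at h ⊢
      tauto
  · refine ⟨w.2 / w'.2, ?_⟩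
    ext
    · simp; field_simp; unfold wd at h; linear_combination h
    · simp; field_simp

theorem br_par {w w' : ℂ × ℂ} (h : br w w' = 0) (h' : w' ≠ 0) :
    ∃ k : ℂ, w = k • ((starRingEnd ℂ) w'.1, (starRingEnd ℂ) w'.2) := by
  have h2 : wd w ((starRingEnd ℂ) w'.1, (starRingEnd ℂ) w'.2) = 0 := h
  apply wd_par h2
  intro h0; apply h'
  simp only [Prod.mk_eq_zero, map_eq_zero] at h0
  exact Prod.ext h0.1 h0.2

theorem C0_iff_eig (X : SL2) : C0 X ↔ ∃ y1 y2 : ℝ, (y1 ≠ 0 ∨ y2 ≠ 0) ∧ 0 ≤ y1 * y2 ∧ ∃ μ : ℂ, ‖μ‖ ≤ 1 ∧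
    cact X (Complex.I * y1, y2) = μ • ((Complex.I * y1, (y2 : ℂ)) : ℂ × ℂ) := by
  constructor
  · rintro (⟨t, h⟩ | ⟨h, h'⟩ | ⟨h, h'⟩)
    · refine ⟨Real.exp t, 1, by simp, by positivity, (X 1 0 : ℂ) * gz t + X 1 1, ?_, ?_⟩
      · have := im_smul' X (gz t)
        rw [h] at this
        have hp := (gz t).im_pos
        have hn : 0 < ‖(X 1 0 : ℂ) * gz t + X 1 1‖ := norm_pos_iff.mpr (denom_ne X _)
        rw [eq_div_iff (by positivity)] at this
        have : ‖(X 1 0 : ℂ) * gz t + X 1 1‖ ^ 2 = 1 := by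
          have h3 : (gz t).im * (‖(X 1 0 : ℂ) * gz t + X 1 1‖ ^ 2 - 1) = 0 := by linarith
          rcases mul_eq_zero.mp h3 with h4 | h4
          · linarith
          · linarith
        nlinarith
      · have e := cact_vec X (gz t)
        rw [h] at e
        have : vec (gz t) = (Complex.I * (Real.exp t : ℝ), ((1:ℝ) : ℂ)) := by
          ext
          · apply Complex.ext <;> simp [vec, gz, Complex.exp_ofReal_re]
          · simp [vec]
        rw [this] at e; exact e
    · refine ⟨1, 0, by simp, by simp, X 0 0, by simpa using h', ?_⟩
      ext <;> simp [cact, h]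
    · refine ⟨0, 1, by simp, by simp, X 1 1, by simpa using h', ?_⟩
      ext <;> simp [cact, h]
  · rintro ⟨y1, y2, hy, hyy, μ, hμ, e⟩
    have e1 := congrArg Prod.fst e
    have e2 := congrArg Prod.snd e
    simp only [cact, Prod.smul_fst, Prod.smul_snd, smul_eq_mul] at e1 e2
    by_cases h2 : y2 = 0
    · right; left
      have h1 : y1 ≠ 0 := by tauto
      have h1' : (y1 : ℂ) ≠ 0 := by exact_mod_cast h1
      rw [h2] at e1 e2
      simp only [Complex.ofReal_zero, mul_zero, add_zero] at e1 e2
      have e2 : X 1 0 = 0 := by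
        have := (mul_eq_zero.mp e2).resolve_right (mul_ne_zero Complex.I_ne_zero h1')
        exact_mod_cast this
      have : (X 0 0 : ℂ) = μ := by
        have h3 : ((X 0 0 : ℂ) - μ) * (Complex.I * y1) = 0 := by
          linear_combination e1
        exact sub_eq_zero.mp ((mul_eq_zero.mp h3).resolve_right (mul_ne_zero Complex.I_ne_zero h1'))
      refine ⟨e2, ?_⟩
      rw [← this] at hμ; simpa using hμ
    by_cases h1 : y1 = 0
    · right; right
      have h2' : (y2 : ℂ) ≠ 0 := by exact_mod_cast h2
      rw [h1] at e1 e2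
      simp only [Complex.ofReal_zero, mul_zero, zero_add] at e1 e2
      have e1 : X 0 1 = 0 := by
        have := (mul_eq_zero.mp e1).resolve_right h2'
        exact_mod_cast this
      have : (X 1 1 : ℂ) = μ := mul_right_cancel₀ h2' e2
      refine ⟨e1, ?_⟩
      rw [← this] at hμ; simpa using hμ
    left
    have hpos : 0 < y1 / y2 := by
      rw [← mul_div_mul_right _ _ h2]
      apply div_pos (lt_of_le_of_ne hyy (mul_ne_zero h1 h2).symm)
      exact mul_self_pos.mpr h2
    refine ⟨Real.log (y1 / y2), ?_⟩
    have hg : ((gz (Real.log (y1 / y2)) : ℍ) : ℂ) = Complex.I * y1 / y2 := by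
      have : ((gz (Real.log (y1 / y2)) : ℍ) : ℂ) = Complex.I * ((y1 / y2 : ℝ) : ℂ) := by
        apply Complex.ext <;> simp [gz, Real.exp_log hpos]
      rw [this]; push_cast; ring
    have h2' : (y2 : ℂ) ≠ 0 := by exact_mod_cast h2
    have hden := denom_ne X (gz (Real.log (y1 / y2)))
    apply UpperHalfPlane.ext
    rw [coe_smul', div_eq_iff hden, hg]
    field_simp
    linear_combination (y2 : ℂ) * e1 - Complex.I * y1 * e2

theorem C0_of_pr {X : SL2} {w : ℂ × ℂ} (hw : w ≠ 0) (him : 0 ≤ (pr w).im) (hre : (pr w).re = 0) {μ : ℂ}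
    (hμ : ‖μ‖ ≤ 1) (e : cact X w = μ • w) : C0 X := by
  rw [C0_iff_eig]
  obtain ⟨c, y1, y2, hc, hy⟩ : ∃ (c : ℂ) (y1 y2 : ℝ), c ≠ 0 ∧ c • w = (Complex.I * y1, (y2 : ℂ)) := by
    by_cases h2 : w.2 = 0
    · have h1 : w.1 ≠ 0 := fun h1 => hw (Prod.ext h1 h2)
      refine ⟨Complex.I * w.1⁻¹, 1, 0, mul_ne_zero Complex.I_ne_zero (inv_ne_zero h1), ?_⟩
      ext <;> simp [h1, h2]
    · refine ⟨(starRingEnd ℂ) w.2, (pr w).im, Complex.normSq w.2, by simpa using h2, ?_⟩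
      ext
      · have : pr w = Complex.I * (pr w).im := by apply Complex.ext <;> simp [hre]
        rw [← this]; simp [pr, mul_comm]
      · simp [Complex.normSq_eq_conj_mul_self]
  refine ⟨y1, y2, ?_, ?_, μ, hμ, ?_⟩
  · by_contra h
    push Not at h
    rw [h.1, h.2] at hy
    have h0 : c • w = 0 := by rw [hy]; simp
    exact (smul_eq_zero.mp h0).elim hc hw
  · have := pr_smul_im c w
    rw [hy] at this
    have h3 : (pr (Complex.I * y1, (y2 : ℂ))).im = y1 * y2 := by simp [pr]
    rw [← h3, this]
    exact mul_nonneg (Complex.normSq_nonneg _) him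
  · rw [← hy, cact_smul, e, smul_comm]

theorem C0_one {X : SL2} {s : ℂ} {w w' : ℂ × ℂ} (hs : s ^ 2 = 1) (h : wd w w' ≠ 0) (e : cact X w = s • w)
    (e' : cact X w' = s • w') : C0 X := by
  have a1 := congrArg Prod.fst e
  have a2 := congrArg Prod.snd e
  have b1 := congrArg Prod.fst e'
  have b2 := congrArg Prod.snd e'
  simp only [cact, Prod.smul_fst, Prod.smul_snd, smul_eq_mul] at a1 a2 b1 b2
  unfold wd at h
  have c01 : (X 0 1 : ℂ) = 0 := by
    have : (X 0 1 : ℂ) * (w.1 * w'.2 - w.2 * w'.1) = 0 := by linear_combination w.1 * b1 - w'.1 * a1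
    exact (mul_eq_zero.mp this).resolve_right h
  have c10 : (X 1 0 : ℂ) = 0 := by
    have : (X 1 0 : ℂ) * (w.1 * w'.2 - w.2 * w'.1) = 0 := by linear_combination w'.2 * a2 - w.2 * b2
    exact (mul_eq_zero.mp this).resolve_right h
  have c00 : (X 0 0 : ℂ) = s := by
    have : ((X 0 0 : ℂ) - s) * (w.1 * w'.2 - w.2 * w'.1) = 0 := by
      linear_combination w'.2 * a1 - w.2 * b1
    exact sub_eq_zero.mp ((mul_eq_zero.mp this).resolve_right h)
  right; left
  refine ⟨by exact_mod_cast c10, ?_⟩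
  have : (X 0 0) ^ 2 = 1 := by rw [← c00] at hs; exact_mod_cast hs
  exact (sq_le_one_iff_abs_le_one _).mp this.le

theorem DD_inter (X : SL2) : ((QuotientGroup.mk X : PSL2) ∈ DD 1 ∧ (QuotientGroup.mk X : PSL2) ∈ DD (-1)) ↔ C0 X := by
  rw [mem_DD, mem_DD]
  constructor
  · rintro ⟨⟨w, ⟨hi, hr⟩, h0, μ, hμ, e⟩, ⟨w', ⟨hi', hr'⟩, h0', ν, hν, e'⟩⟩
    by_cases h1 : (pr w).re = 0
    · exact C0_of_pr h0 hi h1 hμ e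
    by_cases h2 : (pr w').re = 0
    · exact C0_of_pr h0' hi' h2 hν e'
    have p1 : 0 < (pr w).re := lt_of_le_of_ne (by linarith) (Ne.symm h1)
    have p2 : (pr w').re < 0 := lt_of_le_of_ne (by linarith) h2
    have hwd : wd w w' ≠ 0 := by
      intro h
      obtain ⟨k, hk⟩ := wd_par h h0'
      have := pr_smul_re k w'
      rw [← hk] at this
      nlinarith [Complex.normSq_nonneg k]
    have hbr : br w w' ≠ 0 := by
      intro h
      obtain ⟨k, hk⟩ := br_par h h0'
      have := pr_smul_re k ((starRingEnd ℂ) w'.1, (starRingEnd ℂ) w'.2)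
      rw [← hk] at this
      have e3 : (pr ((starRingEnd ℂ) w'.1, (starRingEnd ℂ) w'.2)).re = (pr w').re := by simp [pr]
      rw [e3] at this
      nlinarith [Complex.normSq_nonneg k]
    have m1 : μ * ν = 1 := by
      have := wd_act X w w'
      rw [e, e'] at this
      have h3 : (μ * ν - 1) * wd w w' = 0 := by
        simp only [wd, Prod.smul_fst, Prod.smul_snd, smul_eq_mul] at this
        unfold wd; linear_combination this
      exact sub_eq_zero.mp ((mul_eq_zero.mp h3).resolve_right hwd)
    have m2 : μ * (starRingEnd ℂ) ν = 1 := by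
      have := br_act X w w'
      rw [e, e', br_smul] at this
      have h3 : (μ * (starRingEnd ℂ) ν - 1) * br w w' = 0 := by rw [sub_mul, one_mul, this, sub_self]
      exact sub_eq_zero.mp ((mul_eq_zero.mp h3).resolve_right hbr)
    have hn : ‖μ‖ * ‖ν‖ = 1 := by rw [← norm_mul, m1, norm_one]
    have hν1 : ‖ν‖ = 1 := by nlinarith [norm_nonneg μ, norm_nonneg ν]
    have hμ0 : μ ≠ 0 := fun h => by rw [h] at m1; simp at m1
    have hνr : (starRingEnd ℂ) ν = ν := mul_left_cancel₀ hμ0 (m2.trans m1.symm)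
    have hν2 : ν ^ 2 = 1 := by
      have := Complex.mul_conj ν
      rw [hνr, Complex.normSq_eq_norm_sq, hν1] at this
      rw [sq, this]; simp
    have hμν : μ = ν := by
      have hν0 : ν ≠ 0 := fun h => by rw [h] at m1; simp at m1
      apply mul_right_cancel₀ hν0
      rw [m1, ← sq, hν2]
    rw [hμν] at e
    exact C0_one hν2 hwd e e'
  · rw [C0_iff_eig]
    rintro ⟨y1, y2, hy, hyy, μ, hμ, e⟩
    have hne : ((Complex.I * y1, (y2 : ℂ)) : ℂ × ℂ) ≠ 0 := by
      intro h; simp at h; tauto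
    have hc : ∀ ε, ((Complex.I * y1, (y2 : ℂ)) : ℂ × ℂ) ∈ cone ε := by
      intro ε; constructor
      · simpa [pr] using hyy
      · simp [pr]
    exact ⟨⟨_, hc 1, hne, μ, hμ, e⟩, ⟨_, hc (-1), hne, μ, hμ, e⟩⟩

theorem isQuot : IsQuotientMap (QuotientGroup.mk : SL2 → PSL2) := isQuotientMap_quot_mk

theorem DD_closed (ε : ℝ) : IsClosed (DD ε) := by
  rw [← isQuot.isClosed_preimage]
  let K : Set ((ℂ × ℂ) × ℂ) := (Metric.sphere 0 1 ∩ cone ε) ×ˢ Metric.closedBall 0 1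
  have hK : IsCompact K :=
    ((isCompact_sphere _ _).inter_right (cone_closed ε)).prod (isCompact_closedBall _ _)
  have : CompactSpace K := isCompact_iff_compactSpace.mp hK
  let F : Set (SL2 × K) := {p | cact p.1 p.2.1.1 = p.2.1.2 • p.2.1.1}
  have hF : IsClosed F := by
    refine isClosed_eq ?_ ?_
    · exact continuous_cact'.comp (continuous_fst.prodMk
        (continuous_fst.comp (continuous_subtype_val.comp continuous_snd)))
    · have h1 : Continuous fun p : SL2 × K => p.2.1.2 :=
        continuous_snd.comp (continuous_subtype_val.comp continuous_snd)
      have h2 : Continuous fun p : SL2 × K => p.2.1.1 :=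
        continuous_fst.comp (continuous_subtype_val.comp continuous_snd)
      exact h1.smul h2
  have := isClosedMap_fst_of_compactSpace (X := SL2) (Y := K) F hF
  convert this using 1
  ext X
  rw [Set.mem_preimage, mem_DD]
  constructor
  · rintro ⟨w, hw, h0, μ, hμ, e⟩
    have hn : ‖w‖ ≠ 0 := norm_ne_zero_iff.mpr h0
    refine ⟨(X, ⟨(((‖w‖⁻¹ : ℝ) : ℂ) • w, μ), ⟨⟨?_, cone_smul ε _ hw⟩, by simpa using hμ⟩⟩), ?_, rfl⟩
    · simp [norm_smul, hn]
    · change cact X (((‖w‖⁻¹ : ℝ) : ℂ) • w) = μ • (((‖w‖⁻¹ : ℝ) : ℂ) • w)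
      rw [cact_smul, e, smul_comm]
  · rintro ⟨⟨X', ⟨⟨w, μ⟩, ⟨⟨h1, h2⟩, h3⟩⟩⟩, e, rfl⟩
    refine ⟨w, h2, ?_, μ, by simpa using h3, e⟩
    intro h
    simp [h] at h1

end

section

/-- determinant of the straight path to the identity -/
def pdet (A : SL2) (t : ℝ) : ℝ := (1 - t) ^ 2 + t * (1 - t) * (A 0 0 + A 1 1) + t ^ 2

theorem pdet_pos {A : SL2} (h : 0 ≤ A 0 0 + A 1 1) (t : unitInterval) : 0 < pdet A t := by
  have h0 := t.2.1
  have h1 := t.2.2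
  unfold pdet
  have h3 : 0 ≤ (t:ℝ) * (1 - t) * (A 0 0 + A 1 1) := mul_nonneg (mul_nonneg h0 (by linarith)) h
  nlinarith [sq_nonneg ((t:ℝ) - 1/2)]

theorem pmat_det {A : SL2} (h : 0 ≤ A 0 0 + A 1 1) (t : unitInterval) :
    Matrix.det !![((1 - (t:ℝ)) * A 0 0 + t) / √(pdet A t), (1 - (t:ℝ)) * A 0 1 / √(pdet A t);
      (1 - (t:ℝ)) * A 1 0 / √(pdet A t), ((1 - (t:ℝ)) * A 1 1 + t) / √(pdet A t)] = 1 := by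
  have hp := pdet_pos h t
  have hs : √(pdet A t) ≠ 0 := (Real.sqrt_pos.mpr hp).ne'
  have hs2 : √(pdet A t) ^ 2 = pdet A t := Real.sq_sqrt hp.le
  rw [Matrix.det_fin_two]
  simp only [Matrix.of_apply, Matrix.cons_val', Matrix.cons_val_zero, Matrix.cons_val_one, Matrix.cons_val_fin_one]
  have hd := sl_det A
  field_simp
  rw [hs2]; unfold pdet
  linear_combination (1 - (t:ℝ)) ^ 2 * hd

/-- the straight path to the identity -/
def pathSL (A : SL2) (h : 0 ≤ A 0 0 + A 1 1) (t : unitInterval) : SL2 :=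
  ⟨!![((1 - (t:ℝ)) * A 0 0 + t) / √(pdet A t), (1 - (t:ℝ)) * A 0 1 / √(pdet A t);
      (1 - (t:ℝ)) * A 1 0 / √(pdet A t), ((1 - (t:ℝ)) * A 1 1 + t) / √(pdet A t)], pmat_det h t⟩

theorem pathSL_cont (A : SL2) (h : 0 ≤ A 0 0 + A 1 1) : Continuous (pathSL A h) := by
  apply continuous_induced_rng.mpr
  have hp : Continuous fun t : unitInterval => √(pdet A t) := by unfold pdet; fun_prop
  have hne : ∀ t : unitInterval, √(pdet A t) ≠ 0 := fun t => (Real.sqrt_pos.mpr (pdet_pos h t)).ne'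
  apply continuous_matrix
  intro i k
  fin_cases i <;> fin_cases k
  · exact Continuous.div (by fun_prop) hp hne
  · exact Continuous.div (by fun_prop) hp hne
  · exact Continuous.div (by fun_prop) hp hne
  · exact Continuous.div (by fun_prop) hp hne

theorem pathSL_zero (A : SL2) (h : 0 ≤ A 0 0 + A 1 1) : pathSL A h 0 = A := by
  have : pdet A 0 = 1 := by simp [pdet]
  ext i k; fin_cases i <;> fin_cases k <;> simp [pathSL, this]

theorem pathSL_one (A : SL2) (h : 0 ≤ A 0 0 + A 1 1) : pathSL A h 1 = 1 := by
  have : pdet A 1 = 1 := by simp [pdet]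
  ext i k; fin_cases i <;> fin_cases k <;> simp [pathSL, this]

theorem exists_lift_tr (x : PSL2) : ∃ A : SL2, (QuotientGroup.mk A : PSL2) = x ∧ 0 ≤ A 0 0 + A 1 1 := by
  obtain ⟨A, rfl⟩ := exists_lift x
  rcases le_total 0 (A 0 0 + A 1 1) with h | h
  · exact ⟨A, rfl, h⟩
  · refine ⟨-A, mk_neg A, ?_⟩
    simp; linarith

theorem preconn_of_path {S : Set PSL2}
    (h : ∀ (A : SL2) (hA : 0 ≤ A 0 0 + A 1 1), (QuotientGroup.mk A : PSL2) ∈ S → ∀ t,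
      (QuotientGroup.mk (pathSL A hA t) : PSL2) ∈ S) : IsPreconnected S := by
  refine isPreconnected_of_forall (1 : PSL2) fun x hx => ?_
  obtain ⟨A, rfl, hA⟩ := exists_lift_tr x
  refine ⟨Set.range fun t => (QuotientGroup.mk (pathSL A hA t) : PSL2), ?_, ⟨1, ?_⟩, ⟨0, ?_⟩, ?_⟩
  · rintro _ ⟨t, rfl⟩; exact h A hA hx t
  · simp only [pathSL_one]; rfl
  · simp only [pathSL_zero]
  · exact isPreconnected_range (continuous_quot_mk.comp (pathSL_cont A hA))

theorem psl_preconn : IsPreconnected (Set.univ : Set PSL2) :=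
  preconn_of_path fun _ _ _ _ => Set.mem_univ _

theorem C0_neg {A : SL2} (h : C0 A) : C0 (-A) := by
  rcases h with ⟨t, h⟩ | ⟨h, h'⟩ | ⟨h, h'⟩
  · left; exact ⟨t, by rw [neg_smul', h]⟩
  · right; left; simp [h, h']
  · right; right; simp [h, h']

theorem C0_path {A : SL2} (hA : 0 ≤ A 0 0 + A 1 1) (h : C0 A) (t : unitInterval) : C0 (pathSL A hA t) := by
  have hp := pdet_pos hA t
  have hs := Real.sqrt_pos.mpr hp
  have hs2 : √(pdet A t) ^ 2 = pdet A t := Real.sq_sqrt hp.le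
  have hd := sl_det A
  have ht0 := t.2.1
  have ht1 : 0 ≤ 1 - (t:ℝ) := by linarith [t.2.2]
  have diag : ∀ a d : ℝ, a * d = 1 → 0 ≤ a + d → |a| ≤ 1 →
      (1 - (t:ℝ)) ^ 2 + t * (1 - t) * (a + d) + t ^ 2 = pdet A t →
      |((1 - (t:ℝ)) * a + t) / √(pdet A t)| ≤ 1 := by
    intro a d had htr ha hpd
    rw [abs_le] at ha
    have ha0 : 0 < a := by
      by_contra hh
      push Not at hh
      have : a ≠ 0 := fun h => by rw [h] at had; simp at had
      have : a < 0 := lt_of_le_of_ne hh this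
      nlinarith
    have hd1 : 1 ≤ d := by nlinarith
    rw [abs_div, abs_of_pos hs, div_le_one hs, abs_of_nonneg (by positivity)]
    apply Real.le_sqrt_of_sq_le
    rw [← hpd]
    have h5 : (1 - (t:ℝ)) ^ 2 + t * (1 - t) * (a + d) + t ^ 2 = ((1 - (t:ℝ)) * a + t) * ((1 - (t:ℝ)) * d + t) := by
      linear_combination (-(1 - (t:ℝ)) ^ 2) * had
    rw [h5, sq]
    apply mul_le_mul_of_nonneg_left _ (by positivity)
    have := mul_le_mul_of_nonneg_left (ha.2.trans hd1) ht1
    linarith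
  rcases h with ⟨s, h⟩ | ⟨h, h'⟩ | ⟨h, h'⟩
  · left
    refine ⟨s, ?_⟩
    have e : (A 0 0 : ℂ) * gz s + A 0 1 = gz s * ((A 1 0 : ℂ) * gz s + A 1 1) := by
      have := coe_smul' A (gz s)
      rw [h, eq_div_iff (denom_ne A _)] at this
      exact this.symm
    apply UpperHalfPlane.ext
    rw [coe_smul', div_eq_iff (denom_ne _ _)]
    have hsC : ((√(pdet A t) : ℝ) : ℂ) ≠ 0 := by exact_mod_cast hs.ne'
    have e00 : (pathSL A hA t) 0 0 = ((1 - (t:ℝ)) * A 0 0 + t) / √(pdet A t) := rfl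
    have e01 : (pathSL A hA t) 0 1 = (1 - (t:ℝ)) * A 0 1 / √(pdet A t) := rfl
    have e10 : (pathSL A hA t) 1 0 = (1 - (t:ℝ)) * A 1 0 / √(pdet A t) := rfl
    have e11 : (pathSL A hA t) 1 1 = ((1 - (t:ℝ)) * A 1 1 + t) / √(pdet A t) := rfl
    rw [e00, e01, e10, e11]
    push_cast
    field_simp
    linear_combination (1 - (t:ℂ)) * e
  · right; left
    constructor
    · change (1 - (t:ℝ)) * A 1 0 / √(pdet A t) = 0
      rw [h]; simp
    · exact diag (A 0 0) (A 1 1) (by rw [h] at hd; linarith) hA h' rfl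
  · right; right
    constructor
    · change (1 - (t:ℝ)) * A 0 1 / √(pdet A t) = 0
      rw [h]; simp
    · exact diag (A 1 1) (A 0 0) (by rw [h] at hd; linarith) (by linarith) h' (by unfold pdet; ring)

theorem DDi_preconn : IsPreconnected (DD 1 ∩ DD (-1)) := by
  apply preconn_of_path
  intro A hA h t
  exact (DD_inter _).mpr (C0_path hA ((DD_inter A).mp h) t)

theorem one_mem_DDi : (1 : PSL2) ∈ DD 1 ∩ DD (-1) := by
  rw [← QuotientGroup.mk_one]
  exact (DD_inter 1).mpr (Or.inl ⟨0, one_smul _ _⟩)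

/-- hyperbolic pushing flow -/
def tau (t : ℝ) : SL2 := ⟨!![Real.cosh t, Real.sinh t; Real.sinh t, Real.cosh t], by
  rw [Matrix.det_fin_two]; simp; nlinarith [Real.cosh_sq t]⟩

theorem tau_add (s t : ℝ) : tau (s + t) = tau s * tau t := by
  ext i k
  rw [sl_mul_apply]
  fin_cases i <;> fin_cases k <;> simp [tau, Real.cosh_add, Real.sinh_add] <;> ring

theorem tau_zero : tau 0 = 1 := by
  ext i k; fin_cases i <;> fin_cases k <;> simp [tau]

theorem tau_cont : Continuous tau := by
  apply continuous_induced_rng.mpr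
  apply continuous_matrix
  intro i k
  fin_cases i <;> fin_cases k
  · exact Real.continuous_cosh
  · exact Real.continuous_sinh
  · exact Real.continuous_sinh
  · exact Real.continuous_cosh

theorem four_zero {a b c d y : ℝ} (hy : 0 < y) (h : y * (a ^ 2 + b ^ 2 + c ^ 2 + d ^ 2) ≤ 0) :
    a = 0 ∧ b = 0 ∧ c = 0 ∧ d = 0 := by
  have h1 : a ^ 2 + b ^ 2 + c ^ 2 + d ^ 2 ≤ 0 := by
    by_contra hh; push Not at hh
    exact absurd (mul_pos hy hh) (not_lt.mpr h)
  have ha := sq_nonneg a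
  have hb := sq_nonneg b
  have hc := sq_nonneg c
  have hd := sq_nonneg d
  refine ⟨?_, ?_, ?_, ?_⟩ <;> apply pow_eq_zero_iff (two_ne_zero) |>.mp <;> linarith

set_option maxHeartbeats 1000000 in
theorem push {X : SL2} (h : C0 X) {ε t : ℝ} (ht : 0 < ε * Real.sinh t) :
    (QuotientGroup.mk (X * tau t) : PSL2) ∉ DD ε := by
  rw [C0_iff_eig] at h
  obtain ⟨y1, y2, hy, _, μ', hμ', e'⟩ := h
  rw [mem_DD]
  rintro ⟨v, ⟨_, hr⟩, h0, μ, hμ, e⟩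
  rw [cact_mul] at e
  have h1 := br_act X (cact (tau t) v) (Complex.I * y1, (y2 : ℂ))
  rw [e, e', br_smul] at h1
  have h2 : ‖br (cact (tau t) v) (Complex.I * y1, (y2 : ℂ))‖ ≤ ‖br v (Complex.I * y1, (y2 : ℂ))‖ := by
    rw [← h1, norm_mul, norm_mul, RCLike.norm_conj]
    have : ‖μ‖ * ‖μ'‖ ≤ 1 := mul_le_one₀ hμ (norm_nonneg _) hμ'
    exact mul_le_of_le_one_left (norm_nonneg _) this
  have h3 : Complex.normSq (br (cact (tau t) v) (Complex.I * y1, (y2 : ℂ))) ≤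
      Complex.normSq (br v (Complex.I * y1, (y2 : ℂ))) := by
    rw [Complex.normSq_eq_norm_sq, Complex.normSq_eq_norm_sq]
    exact pow_le_pow_left₀ (norm_nonneg _) h2 2
  obtain ⟨⟨a1, a2⟩, ⟨b1, b2⟩⟩ := v
  have hch := Real.cosh_sq t
  have hc1 := Real.one_le_cosh t
  set ch := Real.cosh t
  set sh := Real.sinh t
  have t00 : (tau t) 0 0 = ch := rfl
  have t01 : (tau t) 0 1 = sh := rfl
  have t10 : (tau t) 1 0 = sh := rfl
  have t11 : (tau t) 1 1 = ch := rfl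
  have hsh : sh ≠ 0 := fun h => by rw [h] at ht; simp at ht
  have hr' : 0 ≤ ε * (a1 * b1 + a2 * b2) := by simpa [pr] using hr
  simp only [br, cact, t00, t01, t10, t11] at h3
  simp [Complex.normSq_apply] at h3
  have hS : 0 ≤ sh * (a1 * b1 + a2 * b2) := by
    by_contra hh
    push Not at hh
    have h6 : (ε * sh) * (sh * (a1 * b1 + a2 * b2)) < 0 := mul_neg_of_pos_of_neg ht hh
    nlinarith [mul_nonneg hr' (sq_nonneg sh)]
  have hS2 : 0 ≤ ch * (sh * (a1 * b1 + a2 * b2)) * (y1 ^ 2 + y2 ^ 2) := by positivity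
  have key : sh ^ 2 * (((a1 * y2 - b2 * y1) ^ 2 + (a2 * y2 + b1 * y1) ^ 2) +
      ((b1 * y2 - a2 * y1) ^ 2 + (b2 * y2 + a1 * y1) ^ 2)) ≤ 0 := by
    nlinarith
  have key2 : ((a1 * y2 - b2 * y1) ^ 2 + (a2 * y2 + b1 * y1) ^ 2) +
      ((b1 * y2 - a2 * y1) ^ 2 + (b2 * y2 + a1 * y1) ^ 2) ≤ 0 := by
    have : 0 < sh ^ 2 := by positivity
    by_contra hh
    push Not at hh
    nlinarith
  have key3 : (y1 ^ 2 + y2 ^ 2) * (a1 ^ 2 + a2 ^ 2 + b1 ^ 2 + b2 ^ 2) ≤ 0 := by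
    have e9 : (y1 ^ 2 + y2 ^ 2) * (a1 ^ 2 + a2 ^ 2 + b1 ^ 2 + b2 ^ 2) = ((a1 * y2 - b2 * y1) ^ 2 + (a2 * y2 + b1 * y1) ^ 2) +
      ((b1 * y2 - a2 * y1) ^ 2 + (b2 * y2 + a1 * y1) ^ 2) := by ring
    rw [e9]; exact key2
  have hy' : 0 < y1 ^ 2 + y2 ^ 2 := by
    rcases hy with h | h <;> positivity
  obtain ⟨r1, r2, r3, r4⟩ := four_zero hy' key3
  apply h0
  subst_vars
  rfl

/-- invariant form -/
theorem pr_im_br (w : ℂ × ℂ) : br w w = 2 * Complex.I * (pr w).im := by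
  apply Complex.ext <;> simp [br, pr] <;> ring

theorem pr_im_act (A : SL2) (w : ℂ × ℂ) : (pr (cact A w)).im = (pr w).im := by
  have h := br_act A w w
  rw [pr_im_br, pr_im_br] at h
  have := mul_left_cancel₀ (by simp : (2 * Complex.I) ≠ 0) h
  exact_mod_cast this

theorem pr_im_nonneg {P : Set ℍ} {w : ℂ × ℂ} (hw : w ∈ coneOf P) : 0 ≤ (pr w).im := by
  have h1 : IsClosed {w : ℂ × ℂ | 0 ≤ (pr w).im} :=
    isClosed_le continuous_const (Complex.continuous_im.comp continuous_pr)
  refine h1.closure_subset_iff.mpr ?_ hw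
  rintro _ ⟨z, hz, c, rfl⟩
  change 0 ≤ (pr (c • vec z)).im
  rw [pr_smul_im, pr_vec]
  exact mul_nonneg (Complex.normSq_nonneg _) z.im_pos.le

theorem br_ne_point {P : Set ℍ} {o : ℍ} : ∀ w ∈ coneOf P, ∀ w' ∈ coneOf {o}, w ≠ 0 → w' ≠ 0 → br w w' ≠ 0 := by
  intro w hw w' hw' h0 h0' hb
  have hcl : IsClosed {w : ℂ × ℂ | w.1 = w.2 * (o : ℂ)} := isClosed_eq (by fun_prop) (by fun_prop)
  have hw2 : w'.1 = w'.2 * (o : ℂ) := by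
    refine hcl.closure_subset_iff.mpr ?_ hw'
    rintro _ ⟨z, hz, c, rfl⟩
    rw [Set.mem_singleton_iff] at hz
    subst hz
    simp [vec]
  have e : w' = w'.2 • vec o := by ext <;> simp [vec, hw2]
  have h2 : w'.2 ≠ 0 := fun h => h0' (by rw [e, h, zero_smul])
  have hp : 0 < (pr w').im := by
    rw [e, pr_smul_im, pr_vec]
    exact mul_pos (Complex.normSq_pos.mpr h2) o.im_pos
  obtain ⟨k, hk⟩ := br_par hb h0'
  have hk0 : k ≠ 0 := fun h => h0 (by rw [hk, h, zero_smul])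
  have := pr_smul_im k ((starRingEnd ℂ) w'.1, (starRingEnd ℂ) w'.2)
  rw [← hk] at this
  have e3 : (pr ((starRingEnd ℂ) w'.1, (starRingEnd ℂ) w'.2)).im = -(pr w').im := by simp [pr]; ring
  rw [e3] at this
  have h4 := pr_im_nonneg hw
  nlinarith [mul_pos (Complex.normSq_pos.mpr hk0) hp]

theorem coneOf_smul {P : Set ℍ} {w : ℂ × ℂ} (c : ℂ) (hw : w ∈ coneOf P) : c • w ∈ coneOf P := by
  refine map_mem_closure (f := fun w => c • w) (continuous_const_smul c) hw ?_
  rintro _ ⟨z, hz, c', rfl⟩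
  exact ⟨z, hz, c * c', by
    change c • c' • vec z = (c * c') • vec z
    rw [smul_smul]⟩

theorem cone_dist {P P' : Set ℍ} {k : ℝ} (hk : 0 < k) (h : ∀ p ∈ P, ∀ p' ∈ P', k ≤ dist p p') :
    ∀ w ∈ coneOf P, ∀ w' ∈ coneOf P',
      4 * (pr w).im * (pr w').im * Real.cosh (k / 2) ^ 2 ≤ ‖br w w'‖ ^ 2 := by
  intro w hw w' hw'
  have hc : (w, w') ∈ closure ({w | ∃ z ∈ P, ∃ c : ℂ, w = c • vec z} ×ˢ
      {w | ∃ z ∈ P', ∃ c : ℂ, w = c • vec z}) := by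
    rw [closure_prod_eq]; exact ⟨hw, hw'⟩
  have hcl : IsClosed {p : (ℂ × ℂ) × (ℂ × ℂ) |
      4 * (pr p.1).im * (pr p.2).im * Real.cosh (k / 2) ^ 2 ≤ ‖br p.1 p.2‖ ^ 2} := by
    have h1 : Continuous fun p : (ℂ × ℂ) × (ℂ × ℂ) => (pr p.1).im :=
      Complex.continuous_im.comp (continuous_pr.comp continuous_fst)
    have h2 : Continuous fun p : (ℂ × ℂ) × (ℂ × ℂ) => (pr p.2).im :=
      Complex.continuous_im.comp (continuous_pr.comp continuous_snd)
    exact isClosed_le (((continuous_const.mul h1).mul h2).mul continuous_const) (continuous_br.norm.pow 2)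
  have := hcl.closure_subset_iff.mpr ?_ hc
  · exact this
  rintro ⟨_, _⟩ ⟨⟨z, hz, c, rfl⟩, ⟨z', hz', c', rfl⟩⟩
  change 4 * (pr (c • vec z)).im * (pr (c' • vec z')).im * Real.cosh (k / 2) ^ 2 ≤ ‖br (c • vec z) (c' • vec z')‖ ^ 2
  rw [br_smul, norm_mul _ (br _ _), norm_br_vec, pr_smul_im, pr_smul_im, pr_vec, pr_vec, norm_mul, RCLike.norm_conj,
    Complex.normSq_eq_norm_sq, Complex.normSq_eq_norm_sq, mul_pow, mul_pow (2 * _), mul_pow 2,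
    Real.sq_sqrt (mul_pos z.im_pos z'.im_pos).le, UpperHalfPlane.coe_im, UpperHalfPlane.coe_im]
  have h1 : Real.cosh (k / 2) ^ 2 ≤ Real.cosh (dist z z' / 2) ^ 2 := by
    apply pow_le_pow_left₀ (Real.cosh_pos _).le
    rw [Real.cosh_le_cosh, abs_of_nonneg (by positivity), abs_of_nonneg (by positivity)]
    linarith [h z hz z' hz']
  have h2 : 0 ≤ 4 * (‖c‖ * ‖c'‖) ^ 2 * (z.im * z'.im) := by
    have := z.im_pos; have := z'.im_pos; positivity
  have := mul_le_mul_of_nonneg_left h1 h2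
  calc _ = 4 * (‖c‖ * ‖c'‖) ^ 2 * (z.im * z'.im) * Real.cosh (k / 2) ^ 2 := by ring
    _ ≤ _ := this
    _ = _ := by ring

end

section

theorem pslImg_mk (B : SL2) (P : Set ℍ) : pslImg (QuotientGroup.mk B) P = (B • ·) '' P := by
  unfold pslImg
  congr 1
  ext1 z
  exact pslSMul_mk B z

theorem mem_coneOf_half (B : SL2) (ε : ℝ) (w : ℂ × ℂ) :
    w ∈ coneOf (pslImg (QuotientGroup.mk B) (Hs ε)) ↔ cact B⁻¹ w ∈ cone ε := by
  rw [pslImg_mk, ← coneOf_Hs]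
  constructor
  · intro h
    have := coneOf_act B⁻¹ _ h
    have e : (fun x => B⁻¹ • x) '' ((fun x => B • x) '' Hs ε) = Hs ε := by
      rw [Set.image_image]; simp
    rwa [e] at this
  · intro h
    have := coneOf_act B _ h
    rwa [cact_inv'] at this

theorem half_tangent (B : SL2) (x y : ℝ) (h0 : x ≠ 0 ∨ y ≠ 0)
    (h : ((x : ℂ), (y : ℂ)) ∈ coneOf (pslImg (QuotientGroup.mk B) (Hs 1))) :
    ∃ p q m : ℝ, 0 < m ∧ p * y - x * q = m ∧ ∀ s : ℝ, 0 < s → s < 1 →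
      ((x : ℂ) + Complex.I * s * p, (y : ℂ) + Complex.I * s * q) ∈
        coneOf (pslImg (QuotientGroup.mk B) (Hs 1)) := by
  rw [mem_coneOf_half] at h
  have hd := sl_det B
  obtain ⟨a, b, hx, hy, hc⟩ : ∃ a b : ℝ, x = B 0 0 * a + B 0 1 * b ∧ y = B 1 0 * a + B 1 1 * b ∧
      cact B⁻¹ ((x : ℂ), (y : ℂ)) = ((a : ℂ), (b : ℂ)) := by
    refine ⟨B 1 1 * x - B 0 1 * y, - B 1 0 * x + B 0 0 * y, ?_, ?_, ?_⟩
    · linear_combination -x * hd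
    · linear_combination -y * hd
    · have e : ((x : ℂ), (y : ℂ)) = cact B (((B 1 1 * x - B 0 1 * y : ℝ) : ℂ), ((- B 1 0 * x + B 0 0 * y : ℝ) : ℂ)) := by
        have hd' : (B 0 0 : ℂ) * B 1 1 - B 0 1 * B 1 0 = 1 := by exact_mod_cast hd
        unfold cact
        ext
        · push_cast
          linear_combination -(x : ℂ) * hd'
        · push_cast
          linear_combination -(y : ℂ) * hd'
      rw [e, cact_inv]
  rw [hc] at h
  have hab : 0 ≤ a * b := by
    have := h.2
    simpa [pr] using this
  refine ⟨B 0 0 * b - B 0 1 * a, B 1 0 * b - B 1 1 * a, a ^ 2 + b ^ 2, ?_, ?_, ?_⟩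
  · by_contra hh
    push Not at hh
    have ha : a = 0 := by nlinarith [sq_nonneg a, sq_nonneg b]
    have hb : b = 0 := by nlinarith [sq_nonneg a, sq_nonneg b]
    subst ha hb
    rcases h0 with h0 | h0
    · exact h0 (by rw [hx]; ring)
    · exact h0 (by rw [hy]; ring)
  · rw [hx, hy]
    linear_combination (a ^ 2 + b ^ 2) * hd
  · intro s hs hs1
    rw [mem_coneOf_half]
    have e : ((x : ℂ) + Complex.I * s * ((B 0 0 * b - B 0 1 * a : ℝ) : ℂ), (y : ℂ) + Complex.I * s * ((B 1 0 * b - B 1 1 * a : ℝ) : ℂ))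
        = cact B ((a : ℂ) + Complex.I * s * b, (b : ℂ) - Complex.I * s * a) := by
      unfold cact
      rw [hx, hy]
      ext
      · push_cast; ring
      · push_cast; ring
    rw [e, cact_inv]
    refine ⟨?_, ?_⟩
    · simp [pr]
      nlinarith [mul_nonneg hs.le (sq_nonneg a), mul_nonneg hs.le (sq_nonneg b)]
    · simp [pr]
      have : 0 ≤ (a * b) * (1 - s ^ 2) := mul_nonneg hab (by nlinarith)
      nlinarith

theorem real_of_null {w w' : ℂ × ℂ} (hb : br w w' = 0) (h0 : w ≠ 0) (h0' : w' ≠ 0) (hi : 0 ≤ (pr w).im)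
    (hi' : 0 ≤ (pr w').im) : ∃ (x y : ℝ) (k k' : ℂ), (x ≠ 0 ∨ y ≠ 0) ∧
      k • w = ((x : ℂ), (y : ℂ)) ∧ k' • w' = ((x : ℂ), (y : ℂ)) := by
  obtain ⟨k, hk⟩ := br_par hb h0'
  have hk0 : k ≠ 0 := fun h => h0 (by rw [hk, h, zero_smul])
  have h1 := pr_smul_im k ((starRingEnd ℂ) w'.1, (starRingEnd ℂ) w'.2)
  rw [← hk] at h1
  have e3 : (pr ((starRingEnd ℂ) w'.1, (starRingEnd ℂ) w'.2)).im = -(pr w').im := by simp [pr]; ring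
  rw [e3] at h1
  have hz : (pr w').im = 0 := by nlinarith [Complex.normSq_pos.mpr hk0]
  -- w' is a multiple of a real vector
  by_cases h2 : w'.2 = 0
  · have h3 : w'.1 ≠ 0 := fun h => h0' (Prod.ext h h2)
    have h3' : (starRingEnd ℂ) w'.1 ≠ 0 := by simpa using h3
    refine ⟨1, 0, (k * (starRingEnd ℂ) w'.1)⁻¹, w'.1⁻¹, Or.inl one_ne_zero, ?_, ?_⟩
    · rw [hk]
      ext
      · simp; field_simp
      · simp [h2]
    · ext
      · simp [h3]
      · simp [h2]
  · have h2' : (starRingEnd ℂ) w'.2 ≠ 0 := by simpa using h2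
    have hr : (w'.1 / w'.2).im = 0 := by
      rw [Complex.div_im]
      have : w'.1.im * w'.2.re - w'.1.re * w'.2.im = 0 := by
        have := hz; simp [pr] at this; linarith
      rw [← sub_div, this, zero_div]
    have hr' : ((w'.1 / w'.2).re : ℂ) = w'.1 / w'.2 := by
      apply Complex.ext <;> simp [hr]
    have hr2 : (starRingEnd ℂ) w'.1 / (starRingEnd ℂ) w'.2 = w'.1 / w'.2 := by
      rw [← map_div₀, ← hr', Complex.conj_ofReal]
    refine ⟨(w'.1 / w'.2).re, 1, (k * (starRingEnd ℂ) w'.2)⁻¹, w'.2⁻¹, Or.inr one_ne_zero, ?_, ?_⟩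
    · rw [hk, hr', ← hr2]
      ext
      · simp; field_simp
      · simp; field_simp
    · rw [hr']
      ext
      · simp; field_simp
      · simp [h2]

theorem br_ne_half {B B' : SL2} {k : ℝ} (hk : 0 < k)
    (h : ∀ p ∈ pslImg (QuotientGroup.mk B) (Hs 1), ∀ p' ∈ pslImg (QuotientGroup.mk B') (Hs 1), k ≤ dist p p') :
    ∀ w ∈ coneOf (pslImg (QuotientGroup.mk B) (Hs 1)), ∀ w' ∈ coneOf (pslImg (QuotientGroup.mk B') (Hs 1)),
      w ≠ 0 → w' ≠ 0 → br w w' ≠ 0 := by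
  intro w hw w' hw' h0 h0' hb
  obtain ⟨x, y, c, c', hxy, e, e'⟩ := real_of_null hb h0 h0' (pr_im_nonneg hw) (pr_im_nonneg hw')
  have h1 := coneOf_smul c hw
  have h1' := coneOf_smul c' hw'
  rw [e] at h1
  rw [e'] at h1'
  obtain ⟨p, q, m, hm, em, hs⟩ := half_tangent B x y hxy h1
  obtain ⟨p', q', m', hm', em', hs'⟩ := half_tangent B' x y hxy h1'
  set C := Real.cosh (k / 2) with hC
  have hC1 : 1 < C := Real.one_lt_cosh.mpr (by positivity)
  set n := p * q' - q * p' with hn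
  have hev : ∀ᶠ r : ℝ in 𝓝[>] 0, r ^ 2 * n ^ 2 < 4 * (C ^ 2 - 1) ∧ r * m' < 1 ∧ r * m < 1 := by
    have t1 : Tendsto (fun r : ℝ => r ^ 2 * n ^ 2) (𝓝 0) (𝓝 (0 ^ 2 * n ^ 2)) :=
      Continuous.tendsto (by fun_prop) _
    have t2 : Tendsto (fun r : ℝ => r * m') (𝓝 0) (𝓝 (0 * m')) := Continuous.tendsto (by fun_prop) _
    have t3 : Tendsto (fun r : ℝ => r * m) (𝓝 0) (𝓝 (0 * m)) := Continuous.tendsto (by fun_prop) _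
    refine Filter.Eventually.filter_mono nhdsWithin_le_nhds ?_
    refine (t1.eventually (gt_mem_nhds ?_)).and ((t2.eventually (gt_mem_nhds ?_)).and (t3.eventually (gt_mem_nhds ?_)))
    · nlinarith
    · simp
    · simp
  obtain ⟨r, ⟨hr1, hr2, hr3⟩, hr0⟩ := (hev.and self_mem_nhdsWithin).exists
  have hr0 : 0 < r := hr0
  have key := cone_dist hk h _ (hs (r * m') (by positivity) hr2) _ (hs' (r * m) (by positivity) hr3)
  have f1 : (pr ((x : ℂ) + Complex.I * ((r * m' : ℝ) : ℂ) * p, (y : ℂ) + Complex.I * ((r * m' : ℝ) : ℂ) * q)).im = r * m' * m := by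
    simp [pr]; rw [← em]; ring
  have f2 : (pr ((x : ℂ) + Complex.I * ((r * m : ℝ) : ℂ) * p', (y : ℂ) + Complex.I * ((r * m : ℝ) : ℂ) * q')).im = r * m * m' := by
    simp [pr]; rw [← em']; ring
  have f3 : br ((x : ℂ) + Complex.I * ((r * m' : ℝ) : ℂ) * p, (y : ℂ) + Complex.I * ((r * m' : ℝ) : ℂ) * q)
      ((x : ℂ) + Complex.I * ((r * m : ℝ) : ℂ) * p', (y : ℂ) + Complex.I * ((r * m : ℝ) : ℂ) * q') =
      ⟨r ^ 2 * m * m' * n, 2 * r * m * m'⟩ := by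
    apply Complex.ext
    · simp [br]; rw [hn]; ring
    · simp [br]
      linear_combination r * m' * em + r * m * em'
  rw [f1, f2, f3, ← Complex.normSq_eq_norm_sq, Complex.normSq_apply] at key
  have hpos : 0 < (r * m * m') ^ 2 := by positivity
  have : (r * m * m') ^ 2 * (4 * C ^ 2) ≤ (r * m * m') ^ 2 * (4 + r ^ 2 * n ^ 2) := by
    simp only at key
    nlinarith
  have := le_of_mul_le_mul_left this hpos
  linarith

theorem local_side {X : Type*} [TopologicalSpace X] {φ : ℝ → X → X} (hφ : Continuous fun p : ℝ × X => φ p.1 p.2)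
    (hadd : ∀ s t x, φ s (φ t x) = φ (s + t) x) (h0 : ∀ x, φ 0 x = x) {D D' Y A B : Set X} (hD : IsClosed D)
    (hD' : IsClosed D') (hU : D ∪ D' = Set.univ)
    (hp : ∀ c ∈ D ∩ D', ∀ t, 0 < t → φ t c ∉ D) (hp' : ∀ c ∈ D ∩ D', ∀ t, t < 0 → φ t c ∉ D')
    (hA : IsOpen A) (hB : IsOpen B) (hAB : Disjoint A B) (hc : Y \ D ⊆ A ∪ B) {c : X} (hcC : c ∈ D ∩ D')
    {s0 : ℝ} (hs0 : 0 < s0) {N0 : Set X} (hN0 : N0 ∈ 𝓝 c) (hN0Y : ∀ h ∈ N0, ∀ s, 0 ≤ s → s ≤ s0 → φ s h ∈ Y)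
    (hin : φ s0 c ∈ A) : ∃ N ∈ 𝓝 c, N \ D ⊆ A := by
  have hφs : ∀ s, Continuous (φ s) := fun s => hφ.comp (by fun_prop : Continuous fun x : X => (s, x))
  have hM : N0 ∩ φ s0 ⁻¹' A ∈ 𝓝 c := inter_mem hN0 ((hA.preimage (hφs s0)).mem_nhds hin)
  have hpre : (fun p : ℝ × X => φ p.1 p.2) ⁻¹' (N0 ∩ φ s0 ⁻¹' A) ∈ 𝓝 ((0 : ℝ), c) := by
    apply hφ.continuousAt.preimage_mem_nhds
    simpa [h0] using hM
  rw [nhds_prod_eq, mem_prod_iff] at hpre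
  obtain ⟨I, hI, N1, hN1, hIN⟩ := hpre
  obtain ⟨δ, hδ, hδI⟩ := Metric.mem_nhds_iff.mp hI
  set s1 := min (δ / 2) s0 with hs1
  have hs1p : 0 < s1 := lt_min (by positivity) hs0
  have hN2 : {y | φ (-s1) y ∉ D'} ∈ 𝓝 c :=
    (hD'.isOpen_compl.preimage (hφs (-s1))).mem_nhds (hp' c hcC _ (by linarith))
  refine ⟨N1 ∩ {y | φ (-s1) y ∉ D'}, inter_mem hN1 hN2, ?_⟩
  rintro y ⟨⟨hy1, hy2⟩, hyD⟩
  have hy2 : φ (-s1) y ∉ D' := hy2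
  have hfc : Continuous fun s : ℝ => φ (-s) y := hφ.comp (by fun_prop : Continuous fun s : ℝ => (-s, y))
  have hcov : ∀ x, x ∉ D → x ∈ D' := fun x hx => by
    have : x ∈ D ∪ D' := by rw [hU]; trivial
    exact this.resolve_left hx
  have hcov' : ∀ x, x ∉ D' → x ∈ D := fun x hx => by
    have : x ∈ D ∪ D' := by rw [hU]; trivial
    exact this.resolve_right hx
  obtain ⟨s, ⟨hs, hs'⟩, hsC⟩ : ∃ s ∈ Set.Icc 0 s1, φ (-s) y ∈ D ∩ D' := by
    have := isPreconnected_closed_iff.mp (isPreconnected_Icc (a := (0:ℝ)) (b := s1)) _ _ (hD.preimage hfc) (hD'.preimage hfc)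
      (fun s _ => by
        by_cases h : φ (-s) y ∈ D
        · exact Or.inl h
        · exact Or.inr (hcov _ h))
      ⟨s1, ⟨hs1p.le, le_rfl⟩, hcov' _ hy2⟩ ⟨0, ⟨le_rfl, hs1p.le⟩, by
        change φ (-0) y ∈ D'
        rw [neg_zero, h0]; exact hcov _ hyD⟩
    exact this
  have hsne : s ≠ 0 := fun h => hyD (by rw [h, neg_zero, h0] at hsC; exact hsC.1)
  have hspos : 0 < s := lt_of_le_of_ne hs (Ne.symm hsne)
  have hh : φ (-s) y ∈ N0 ∩ φ s0 ⁻¹' A := by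
    have : ((-s, y) : ℝ × X) ∈ I ×ˢ N1 := by
      refine ⟨hδI ?_, hy1⟩
      rw [Metric.mem_ball, Real.dist_eq, sub_zero, abs_neg, abs_of_pos hspos]
      have := min_le_left (δ / 2) s0
      linarith
    exact hIN this
  set h := φ (-s) y
  have hyh : φ s h = y := by rw [hadd, add_neg_cancel, h0]
  have hpath : IsPreconnected ((fun s' => φ s' h) '' Set.Ioc 0 s0) :=
    isPreconnected_Ioc.image _ (hφ.comp (by fun_prop : Continuous fun s' : ℝ => (s', h))).continuousOn
  have hsub : (fun s' => φ s' h) '' Set.Ioc 0 s0 ⊆ A ∪ B := by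
    rintro _ ⟨s', ⟨h1, h2⟩, rfl⟩
    exact hc ⟨hN0Y h hh.1 s' h1.le h2, hp h hsC s' h1⟩
  have := hpath.subset_left_of_subset_union hA hB hAB hsub ⟨φ s0 h, ⟨s0, ⟨hs0, le_rfl⟩, rfl⟩, hh.2⟩
  exact this ⟨s, ⟨hspos, hs'.trans (min_le_right _ _)⟩, hyh⟩

theorem one_step {X : Type*} [TopologicalSpace X] {φ : ℝ → X → X} (hφ : Continuous fun p : ℝ × X => φ p.1 p.2)
    (hadd : ∀ s t x, φ s (φ t x) = φ (s + t) x) (h0 : ∀ x, φ 0 x = x) {D D' Y : Set X} (hD : IsClosed D)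
    (hD' : IsClosed D') (hU : D ∪ D' = Set.univ) (hCc : IsPreconnected (D ∩ D'))
    (hp : ∀ c ∈ D ∩ D', ∀ t, 0 < t → φ t c ∉ D) (hp' : ∀ c ∈ D ∩ D', ∀ t, t < 0 → φ t c ∉ D')
    (hY : IsOpen Y) (hYc : IsPreconnected Y) (hDY : D ⊆ Y) : IsPreconnected (Y \ D) := by
  rw [isPreconnected_iff_subset_of_disjoint]
  intro u v hu hv hcov hdis
  have hYD : IsOpen (Y \ D) := hY.sdiff hD
  set A := u ∩ (Y \ D) with hAdef
  set B := v ∩ (Y \ D) with hBdef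
  have hA : IsOpen A := hu.inter hYD
  have hB : IsOpen B := hv.inter hYD
  have hAB : Disjoint A B := by
    rw [Set.disjoint_iff]
    rintro x ⟨h1, h2⟩
    have : x ∈ (Y \ D) ∩ (u ∩ v) := ⟨h1.2, h1.1, h2.1⟩
    rw [hdis] at this; exact this
  have hc : Y \ D ⊆ A ∪ B := fun x hx => (hcov hx).imp (fun h => ⟨h, hx⟩) (fun h => ⟨h, hx⟩)
  have hc' : Y \ D ⊆ B ∪ A := fun x hx => (hc hx).symm
  have hlocal : ∀ c ∈ D ∩ D', (∃ N ∈ 𝓝 c, N \ D ⊆ A) ∨ (∃ N ∈ 𝓝 c, N \ D ⊆ B) := by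
    intro c hcC
    have hpre : (fun p : ℝ × X => φ p.1 p.2) ⁻¹' Y ∈ 𝓝 ((0 : ℝ), c) := by
      apply hφ.continuousAt.preimage_mem_nhds
      simpa [h0] using hY.mem_nhds (hDY hcC.1)
    rw [nhds_prod_eq, mem_prod_iff] at hpre
    obtain ⟨I, hI, N0, hN0, hIN⟩ := hpre
    obtain ⟨δ, hδ, hδI⟩ := Metric.mem_nhds_iff.mp hI
    have hN0Y : ∀ h ∈ N0, ∀ s, 0 ≤ s → s ≤ δ / 2 → φ s h ∈ Y := by
      intro h hh s hs hs'
      have : ((s, h) : ℝ × X) ∈ I ×ˢ N0 := by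
        refine ⟨hδI ?_, hh⟩
        rw [Metric.mem_ball, Real.dist_eq, sub_zero, abs_of_nonneg hs]
        linarith
      exact hIN this
    have hs0 : 0 < δ / 2 := by positivity
    rcases hc ⟨hN0Y c (mem_of_mem_nhds hN0) _ hs0.le le_rfl, hp c hcC _ hs0⟩ with h | h
    · exact Or.inl (local_side hφ hadd h0 hD hD' hU hp hp' hA hB hAB hc hcC hs0 hN0 hN0Y h)
    · exact Or.inr (local_side hφ hadd h0 hD hD' hU hp hp' hB hA hAB.symm hc' hcC hs0 hN0 hN0Y h)
  have hnot : ∀ {A B : Set X}, Disjoint A B → B ⊆ Y \ D → ∀ c, (∃ N ∈ 𝓝 c, N \ D ⊆ A) → c ∉ closure B := by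
    intro A B hAB hBY c ⟨N, hN, hNA⟩ hcl
    obtain ⟨y, hyN, hyB⟩ := mem_closure_iff_nhds.mp hcl N hN
    exact Set.disjoint_left.mp hAB (hNA ⟨hyN, (hBY hyB).2⟩) hyB
  have hfin : ∀ {A B : Set X}, IsOpen A → IsOpen B → Disjoint A B → B ⊆ Y \ D → Y \ D ⊆ A ∪ B →
      (∀ c ∈ D ∩ D', c ∉ closure B) → Y ⊆ B ∨ B = ∅ := by
    intro A B hA hB hAB hBY hc hcl
    have hclB : closure B ∩ Y ⊆ B := by
      rintro y ⟨hy, hyY⟩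
      by_cases hyD : y ∈ D
      · exfalso
        have h1 : B ⊆ D' := fun b hb => by
          have : b ∈ D ∪ D' := by rw [hU]; trivial
          exact this.resolve_left (hBY hb).2
        exact hcl y ⟨hyD, hD'.closure_subset_iff.mpr h1 hy⟩ hy
      · rcases hc ⟨hyY, hyD⟩ with h | h
        · exfalso
          obtain ⟨z, hz, hz'⟩ := mem_closure_iff_nhds.mp hy A (hA.mem_nhds h)
          exact Set.disjoint_left.mp hAB hz hz'
        · exact h
    have := isPreconnected_iff_subset_of_disjoint.mp hYc B (closure B)ᶜ hB isClosed_closure.isOpen_compl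
      (fun y hy => by
        by_cases h : y ∈ closure B
        · exact Or.inl (hclB ⟨h, hy⟩)
        · exact Or.inr h)
      (by
        ext y
        simp only [Set.mem_inter_iff, Set.mem_compl_iff, Set.mem_empty_iff_false, iff_false]
        rintro ⟨_, h1, h2⟩
        exact h2 (subset_closure h1))
    refine this.imp id fun h => ?_
    ext y
    simp only [Set.mem_empty_iff_false, iff_false]
    intro hy
    exact h (hBY hy).1 (subset_closure hy)
  by_cases hall : ∀ c ∈ D ∩ D', c ∉ closure B
  · rcases hfin hA hB hAB Set.inter_subset_right hc hall with h | h
    · exact Or.inr fun x hx => (h hx.1).1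
    · left
      intro x hx
      rcases hc hx with h1 | h1
      · exact h1.1
      · rw [h] at h1; exact h1.elim
  · push Not at hall
    obtain ⟨c0, hc0, hc0'⟩ := hall
    have hall' : ∀ c ∈ D ∩ D', c ∉ closure A := by
      by_contra hh
      push Not at hh
      obtain ⟨c1, hc1, hc1'⟩ := hh
      obtain ⟨c, hcC, hcA, hcB⟩ := isPreconnected_closed_iff.mp hCc (closure A) (closure B) isClosed_closure isClosed_closure
        (by
          intro c hcC
          have h1 : c ∈ closure (A ∪ B) := by
            have ht : Tendsto (fun t : ℝ => φ t c) (𝓝[>] 0) (𝓝 c) := by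
              have : Continuous fun t : ℝ => φ t c := hφ.comp (by fun_prop : Continuous fun t : ℝ => (t, c))
              have := this.tendsto 0
              rw [h0] at this
              exact this.mono_left nhdsWithin_le_nhds
            refine mem_closure_of_tendsto ht ?_
            have e1 : ∀ᶠ t : ℝ in 𝓝[>] 0, φ t c ∈ Y := ht.eventually (hY.mem_nhds (hDY hcC.1))
            filter_upwards [e1, self_mem_nhdsWithin] with t ht1 ht2
            exact hc ⟨ht1, hp c hcC t ht2⟩
          rwa [closure_union] at h1)
        ⟨c1, hc1, hc1'⟩ ⟨c0, hc0, hc0'⟩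
      rcases hlocal c hcC with h | h
      · exact hnot hAB Set.inter_subset_right c h hcB
      · exact hnot hAB.symm Set.inter_subset_right c h hcA
    rcases hfin hB hA hAB.symm Set.inter_subset_right hc' hall' with h | h
    · exact Or.inl fun x hx => (h hx.1).1
    · right
      intro x hx
      rcases hc hx with h1 | h1
      · rw [h] at h1; exact h1.elim
      · exact h1.1

end

section

theorem half_eq (B : SL2) (ε : ℝ) : pslImg (QuotientGroup.mk B) (Hs ε) = {z | 0 ≤ ε * (B⁻¹ • z).re} := by
  ext z
  rw [mem_pslImg, ← QuotientGroup.mk_inv, pslSMul_mk]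
  rfl

/-- crooked half-space for a frame -/
def DB (g : PSL2) (B : SL2) (ε : ℝ) : Set PSL2 := Dset g (pslImg (QuotientGroup.mk B) (Hs ε))

/-- normalising map -/
def nrm (g : PSL2) (B : SL2) : PSL2 ≃ₜ PSL2 :=
  (Homeomorph.mulLeft (g * QuotientGroup.mk B)⁻¹).trans (Homeomorph.mulRight (QuotientGroup.mk B))

theorem nrm_apply (g : PSL2) (B : SL2) (y : PSL2) : nrm g B y = (g * QuotientGroup.mk B)⁻¹ * y * QuotientGroup.mk B := rfl

theorem mem_DB (g : PSL2) (B : SL2) (ε : ℝ) (y : PSL2) : y ∈ DB g B ε ↔ nrm g B y ∈ DD ε := by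
  have := Dset_act (g * QuotientGroup.mk B) (QuotientGroup.mk B) 1 (nrm g B y) (Hs ε)
  rw [nrm_apply] at this ⊢
  rw [show DD ε = Dset 1 (Hs ε) from rfl, ← this]
  have e1 : g * QuotientGroup.mk B * ((g * QuotientGroup.mk B)⁻¹ * y * QuotientGroup.mk B) * (QuotientGroup.mk B)⁻¹ = y := by group
  have e2 : g * (QuotientGroup.mk B : PSL2) * 1 * (QuotientGroup.mk B)⁻¹ = g := by group
  rw [e1, e2]
  rfl

theorem DB_eq (g : PSL2) (B : SL2) (ε : ℝ) : DB g B ε = nrm g B ⁻¹' DD ε := by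
  ext y; exact mem_DB g B ε y

theorem DB_closed (g : PSL2) (B : SL2) (ε : ℝ) : IsClosed (DB g B ε) := by
  rw [DB_eq]; exact (DD_closed ε).preimage (nrm g B).continuous

theorem DB_union (g : PSL2) (B : SL2) : DB g B 1 ∪ DB g B (-1) = Set.univ := by
  rw [DB_eq, DB_eq, ← Set.preimage_union, DD_union, Set.preimage_univ]

theorem DB_inter (g : PSL2) (B : SL2) : DB g B 1 ∩ DB g B (-1) = (g * ·) '' rightCrooked (lineOf B) := by
  ext y
  rw [Set.mem_inter_iff, mem_DB, mem_DB]
  obtain ⟨X, hX⟩ := exists_lift (nrm g B y)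
  rw [← hX, DD_inter, ← rightCrooked_line B X]
  have e : (QuotientGroup.mk (B * X * B⁻¹) : PSL2) = g⁻¹ * y := by
    rw [QuotientGroup.mk_mul, QuotientGroup.mk_mul, hX, nrm_apply, QuotientGroup.mk_inv]
    group
  rw [e]
  constructor
  · intro h; exact ⟨_, h, by group⟩
  · rintro ⟨x, hx, rfl⟩
    simpa using hx

theorem DB_inter_preconn (g : PSL2) (B : SL2) : IsPreconnected (DB g B 1 ∩ DB g B (-1)) := by
  rw [DB_eq, DB_eq, ← Set.preimage_inter, ← (nrm g B).image_symm]
  exact DDi_preconn.image _ (nrm g B).symm.continuous.continuousOn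

/-- transverse flow -/
def flo (B : SL2) (t : ℝ) (x : PSL2) : PSL2 := x * QuotientGroup.mk (B * tau t * B⁻¹)

theorem flo_cont (B : SL2) : Continuous fun p : ℝ × PSL2 => flo B p.1 p.2 := by
  unfold flo
  have h1 : Continuous fun t : ℝ => (QuotientGroup.mk (B * tau t * B⁻¹) : PSL2) :=
    continuous_quot_mk.comp ((continuous_const.mul tau_cont).mul continuous_const)
  exact continuous_snd.mul (h1.comp continuous_fst)

theorem flo_add (B : SL2) (s t : ℝ) (x : PSL2) : flo B s (flo B t x) = flo B (s + t) x := by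
  unfold flo
  rw [mul_assoc, ← QuotientGroup.mk_mul, add_comm s t, tau_add]
  congr 2
  group

theorem flo_zero (B : SL2) (x : PSL2) : flo B 0 x = x := by
  unfold flo
  rw [tau_zero, mul_one, mul_inv_cancel, QuotientGroup.mk_one, mul_one]

theorem flo_push {g : PSL2} {B : SL2} {c : PSL2} (hc : c ∈ DB g B 1 ∩ DB g B (-1)) {ε t : ℝ}
    (h : 0 < ε * Real.sinh t) : flo B t c ∉ DB g B ε := by
  obtain ⟨X, hX⟩ := exists_lift (nrm g B c)
  rw [Set.mem_inter_iff, mem_DB, mem_DB, ← hX, DD_inter] at hc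
  rw [mem_DB]
  have e : nrm g B (flo B t c) = QuotientGroup.mk (X * tau t) := by
    rw [QuotientGroup.mk_mul, hX, nrm_apply, nrm_apply, flo, QuotientGroup.mk_mul, QuotientGroup.mk_mul, QuotientGroup.mk_inv]
    group
  rw [e]
  exact push hc h

theorem DB_step (g : PSL2) (B : SL2) {Y : Set PSL2} (hY : IsOpen Y) (hYc : IsPreconnected Y) (h : DB g B 1 ⊆ Y) :
    IsPreconnected (Y \ DB g B 1) := by
  refine one_step (flo_cont B) (flo_add B) (flo_zero B) (DB_closed g B 1) (DB_closed g B (-1)) (DB_union g B)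
    (DB_inter_preconn g B) ?_ ?_ hY hYc h
  · intro c hc t ht
    exact flo_push hc (by rw [one_mul]; exact Real.sinh_pos_iff.mpr ht)
  · intro c hc t ht
    exact flo_push hc (by have := Real.sinh_neg_iff.mpr ht; linarith)

theorem flo_cont2 (B : SL2) (c : PSL2) : Continuous fun t : ℝ => flo B t c := by
  unfold flo
  have h1 : Continuous fun t : ℝ => (QuotientGroup.mk (B * tau t * B⁻¹) : PSL2) :=
    continuous_quot_mk.comp ((continuous_const.mul tau_cont).mul continuous_const)
  exact continuous_const.mul h1

theorem DB_near {g : PSL2} {B : SL2} {c : PSL2} (hc : c ∈ DB g B 1 ∩ DB g B (-1)) {N : Set PSL2} (hN : N ∈ 𝓝 c) :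
    ∃ y ∈ N, y ∉ DB g B 1 := by
  have ht : Tendsto (fun t : ℝ => flo B t c) (𝓝[>] 0) (𝓝 c) := by
    have h5 := flo_cont2 B c
    have h6 := h5.tendsto 0
    rw [flo_zero] at h6
    exact h6.mono_left nhdsWithin_le_nhds
  have h3 : ∀ᶠ t in 𝓝[>] (0 : ℝ), flo B t c ∈ N := ht.eventually hN
  have h4 : ∀ᶠ t in 𝓝[>] (0 : ℝ), t ∈ Set.Ioi (0 : ℝ) := self_mem_nhdsWithin
  obtain ⟨t, h1, h2⟩ := (h3.and h4).exists
  refine ⟨_, h1, flo_push hc ?_⟩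
  rw [one_mul]; exact Real.sinh_pos_iff.mpr h2

/-! lines and sides -/

open Classical in
/-- a chosen frame -/
def frame (α : Set ℍ) : SL2 := if h : ∃ B, α = lineOf B then h.choose else 1

theorem frame_spec {α : Set ℍ} (h : IsGeodesicLine α) : α = lineOf (frame α) := by
  have h' := line_form h
  unfold frame
  rw [dif_pos h']
  exact h'.choose_spec

/-- signed side function -/
def sg (α : Set ℍ) (z : ℍ) : ℝ := ((frame α)⁻¹ • z).re

theorem mem_iff_sg {α : Set ℍ} (h : IsGeodesicLine α) {z : ℍ} : z ∈ α ↔ sg α z = 0 := by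
  conv_lhs => rw [frame_spec h]
  rfl

theorem continuous_sg (α : Set ℍ) : Continuous (sg α) :=
  UpperHalfPlane.continuous_re.comp (continuous_const_smul _)

theorem sg_frame {α : Set ℍ} {B : SL2} (h : α = lineOf B) :
    ∃ ε : ℝ, ε ^ 2 = 1 ∧ ∀ z : ℍ, ∃ k : ℝ, 0 < k ∧ sg α z = ε * k * (B⁻¹ • z).re := by
  have h1 : IsGeodesicLine α := h ▸ line_isGeo B
  have h2 := frame_spec h1
  exact frame_sign (h2.symm.trans h)

theorem sg_prod_frame {α : Set ℍ} {B : SL2} (h : α = lineOf B) (z w : ℍ) :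
    ∃ k : ℝ, 0 < k ∧ sg α z * sg α w = k * ((B⁻¹ • z).re * (B⁻¹ • w).re) := by
  obtain ⟨ε, hε, hh⟩ := sg_frame h
  obtain ⟨k, hk, e⟩ := hh z
  obtain ⟨k', hk', e'⟩ := hh w
  refine ⟨k * k', by positivity, ?_⟩
  rw [e, e']
  linear_combination k * k' * (B⁻¹ • z).re * (B⁻¹ • w).re * hε

theorem geo_img {α : Set ℍ} (h : IsGeodesicLine α) (a : PSL2) : IsGeodesicLine (pslImg a α) := by
  obtain ⟨B, rfl⟩ := line_form h
  obtain ⟨A, rfl⟩ := exists_lift a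
  rw [← lineOf_mul]
  exact line_isGeo _

theorem sg_equiv {α : Set ℍ} (h : IsGeodesicLine α) (a : PSL2) (z w : ℍ) :
    ∃ k : ℝ, 0 < k ∧ sg (pslImg a α) (pslSMul a z) * sg (pslImg a α) (pslSMul a w) = k * (sg α z * sg α w) := by
  obtain ⟨A, rfl⟩ := exists_lift a
  have e : pslImg (QuotientGroup.mk A) α = lineOf (A * frame α) := by
    rw [lineOf_mul, ← frame_spec h]
  obtain ⟨k, hk, e'⟩ := sg_prod_frame e (pslSMul (QuotientGroup.mk A) z) (pslSMul (QuotientGroup.mk A) w)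
  refine ⟨k, hk, ?_⟩
  rw [e', pslSMul_mk, pslSMul_mk, smul_smul, smul_smul]
  have : (A * frame α)⁻¹ * A = (frame α)⁻¹ := by group
  rw [this]
  rfl

/-- the closed far side of `α` seen from `u` -/
def Far (α : Set ℍ) (u : ℍ) : Set ℍ := {z | sg α z * sg α u ≤ 0}

theorem mem_Far {α : Set ℍ} {u z : ℍ} : z ∈ Far α u ↔ sg α z * sg α u ≤ 0 := Iff.rfl

theorem Far_congr {α : Set ℍ} {u v : ℍ} (h : 0 < sg α u * sg α v) : Far α u = Far α v := by
  ext z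
  rw [mem_Far, mem_Far]
  have hs : 0 < sg α v ^ 2 := by
    have : sg α v ≠ 0 := fun h0 => by rw [h0] at h; simp at h
    positivity
  have hs' : 0 < sg α u ^ 2 := by
    have : sg α u ≠ 0 := fun h0 => by rw [h0] at h; simp at h
    positivity
  constructor
  · intro h1
    by_contra h2
    push Not at h2
    nlinarith [mul_pos h h2, mul_nonneg (neg_nonneg.mpr h1) hs.le]
  · intro h1
    by_contra h2
    push Not at h2
    nlinarith [mul_pos h h2, mul_nonneg (neg_nonneg.mpr h1) hs'.le]

theorem Jinv_re (B : SL2) (z : ℍ) : ((B * Jm)⁻¹ • z).re = - (B⁻¹ • z).re / ((B⁻¹ • z).re ^ 2 + (B⁻¹ • z).im ^ 2) := by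
  have h : Jm⁻¹ = -Jm := by
    ext i k
    rw [Matrix.SpecialLinearGroup.coe_inv, Matrix.SpecialLinearGroup.coe_neg]
    fin_cases i <;> fin_cases k <;> simp [Jm, Matrix.adjugate_fin_two]
  rw [mul_inv_rev, mul_smul, h, neg_smul', J_re]

theorem adapt {α : Set ℍ} (h : IsGeodesicLine α) {u : ℍ} (hu : sg α u ≠ 0) :
    ∃ B : SL2, α = lineOf B ∧ (B⁻¹ • u).re < 0 := by
  have hf := frame_spec h
  rcases lt_or_gt_of_ne hu with h1 | h1
  · exact ⟨frame α, hf, h1⟩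
  · refine ⟨frame α * Jm, by rw [lineOf_J]; exact hf, ?_⟩
    rw [Jinv_re]
    have h2 : 0 < ((frame α)⁻¹ • u).re := h1
    apply div_neg_of_neg_of_pos
    · linarith
    · positivity

theorem adapt_far {α : Set ℍ} {B : SL2} (h : α = lineOf B) {u : ℍ} (hu : (B⁻¹ • u).re < 0) :
    Far α u = pslImg (QuotientGroup.mk B) (Hs 1) := by
  rw [half_eq]
  ext z
  rw [mem_Far]
  obtain ⟨k, hk, e⟩ := sg_prod_frame h z u
  rw [e]
  change _ ↔ 0 ≤ 1 * (B⁻¹ • z).re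
  rw [one_mul]
  constructor
  · intro h1
    by_contra h2
    push Not at h2
    nlinarith [mul_pos hk (mul_pos_of_neg_of_neg h2 hu)]
  · intro h1
    exact mul_nonpos_of_nonneg_of_nonpos hk.le (mul_nonpos_of_nonneg_of_nonpos h1 hu.le)

theorem adapt_far' {α : Set ℍ} {B : SL2} (h : α = lineOf B) {u : ℍ} (hu : 0 < (B⁻¹ • u).re) :
    Far α u = pslImg (QuotientGroup.mk B) (Hs (-1)) := by
  rw [half_eq]
  ext z
  rw [mem_Far]
  obtain ⟨k, hk, e⟩ := sg_prod_frame h z u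
  rw [e]
  change _ ↔ 0 ≤ -1 * (B⁻¹ • z).re
  constructor
  · intro h1
    by_contra h2
    push Not at h2
    nlinarith [mul_pos hk (mul_pos (by linarith : 0 < (B⁻¹ • z).re) hu)]
  · intro h1
    exact mul_nonpos_of_nonneg_of_nonpos hk.le (mul_nonpos_of_nonpos_of_nonneg (by linarith) hu.le)

/-- the crooked half-space beyond `α` from `u` -/
def Dh (g : PSL2) (α : Set ℍ) (u : ℍ) : Set PSL2 := Dset g (Far α u)

theorem Dh_congr {g : PSL2} {α : Set ℍ} {u v : ℍ} (h : 0 < sg α u * sg α v) : Dh g α u = Dh g α v := by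
  unfold Dh; rw [Far_congr h]

theorem Dh_pair {α : Set ℍ} (h : IsGeodesicLine α) {u v : ℍ} (huv : sg α u * sg α v < 0) (g : PSL2) :
    ∃ B : SL2, α = lineOf B ∧ Dh g α u = DB g B 1 ∧ Dh g α v = DB g B (-1) := by
  have hu : sg α u ≠ 0 := fun h => by rw [h] at huv; simp at huv
  obtain ⟨B, hB, hB'⟩ := adapt h hu
  obtain ⟨k, hk, e⟩ := sg_prod_frame hB u v
  rw [e] at huv
  refine ⟨B, hB, ?_, ?_⟩
  · unfold Dh; rw [adapt_far hB hB']; rfl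
  · unfold Dh; rw [adapt_far' hB]; · rfl
    by_contra h2
    push Not at h2
    have := mul_nonneg hk.le (mul_nonneg_of_nonpos_of_nonpos hB'.le h2)
    linarith

theorem exists_opp {α : Set ℍ} {u : ℍ} (hu : sg α u ≠ 0) : ∃ v, sg α u * sg α v < 0 := by
  refine ⟨frame α • Jm • (frame α)⁻¹ • u, ?_⟩
  unfold sg at hu ⊢
  rw [inv_smul_smul, J_re, mul_div_assoc']
  apply div_neg_of_neg_of_pos
  · have : 0 < ((frame α)⁻¹ • u).re ^ 2 := by positivity
    nlinarith
  · positivity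

theorem Dh_closed {α : Set ℍ} (h : IsGeodesicLine α) {u : ℍ} (hu : sg α u ≠ 0) (g : PSL2) : IsClosed (Dh g α u) := by
  obtain ⟨v, hv⟩ := exists_opp hu
  obtain ⟨B, _, e, _⟩ := Dh_pair h hv g
  rw [e]; exact DB_closed _ _ _

theorem Dh_union {α : Set ℍ} (h : IsGeodesicLine α) {u v : ℍ} (hv : sg α u * sg α v < 0) (g : PSL2) :
    Dh g α u ∪ Dh g α v = Set.univ := by
  obtain ⟨B, _, e, e'⟩ := Dh_pair h hv g
  rw [e, e']; exact DB_union _ _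

theorem Dh_inter {α : Set ℍ} (h : IsGeodesicLine α) {u v : ℍ} (hv : sg α u * sg α v < 0) (g : PSL2) :
    Dh g α u ∩ Dh g α v = (g * ·) '' rightCrooked α := by
  obtain ⟨B, hB, e, e'⟩ := Dh_pair h hv g
  rw [e, e', DB_inter, ← hB]

theorem Dh_step {α : Set ℍ} (h : IsGeodesicLine α) {u : ℍ} (hu : sg α u ≠ 0) (g : PSL2) {Y : Set PSL2}
    (hY : IsOpen Y) (hYc : IsPreconnected Y) (hs : Dh g α u ⊆ Y) : IsPreconnected (Y \ Dh g α u) := by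
  obtain ⟨v, hv⟩ := exists_opp hu
  obtain ⟨B, _, e, _⟩ := Dh_pair h hv g
  rw [e] at hs ⊢; exact DB_step _ _ hY hYc hs

theorem Dh_near {α : Set ℍ} (h : IsGeodesicLine α) {u : ℍ} (hu : sg α u ≠ 0) (g : PSL2) {c : PSL2}
    (hc : c ∈ (g * ·) '' rightCrooked α) {N : Set PSL2} (hN : N ∈ 𝓝 c) : ∃ y ∈ N, y ∉ Dh g α u := by
  obtain ⟨v, hv⟩ := exists_opp hu
  obtain ⟨B, hB, e, _⟩ := Dh_pair h hv g
  rw [hB, ← DB_inter] at hc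
  rw [e]; exact DB_near hc hN

theorem crook_sub {α : Set ℍ} (h : IsGeodesicLine α) {u : ℍ} (hu : sg α u ≠ 0) (g : PSL2) :
    (g * ·) '' rightCrooked α ⊆ Dh g α u := by
  obtain ⟨v, hv⟩ := exists_opp hu
  rw [← Dh_inter h hv]
  exact Set.inter_subset_left

theorem crook_nonempty {α : Set ℍ} (h : IsGeodesicLine α) (g : PSL2) : g ∈ (g * ·) '' rightCrooked α := by
  refine ⟨1, Or.inl ?_, mul_one g⟩
  obtain ⟨γ, _, rfl⟩ := h
  exact ⟨γ 0, ⟨0, rfl⟩, pslSMul_one _⟩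

theorem Far_equiv {α : Set ℍ} (h : IsGeodesicLine α) (a : PSL2) (u : ℍ) :
    Far (pslImg a α) (pslSMul a u) = pslImg a (Far α u) := by
  ext z
  rw [mem_pslImg, mem_Far, mem_Far]
  obtain ⟨k, hk, e⟩ := sg_equiv h a (pslSMul a⁻¹ z) u
  rw [pslSMul_inv'] at e
  rw [e]
  constructor
  · intro h1; by_contra h2; push Not at h2; nlinarith [mul_pos hk h2]
  · intro h1; exact mul_nonpos_of_nonneg_of_nonpos hk.le h1

theorem Dh_equiv {α : Set ℍ} (h : IsGeodesicLine α) (a b g x : PSL2) (u : ℍ) :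
    b * x * a⁻¹ ∈ Dh (b * g * a⁻¹) (pslImg a α) (pslSMul a u) ↔ x ∈ Dh g α u := by
  unfold Dh
  rw [Far_equiv h, Dset_act]

end

section

theorem pt {a b c : ℝ} (h : 0 < a * b) (h' : 0 < b * c) : 0 < a * c := by
  rcases pos_and_pos_or_neg_and_neg_of_mul_pos h with ⟨h1, h2⟩ | ⟨h1, h2⟩
  · exact mul_pos h1 (pos_of_mul_pos_right h' h2.le)
  · exact mul_pos_of_neg_of_neg h1 (neg_of_mul_pos_right h' h2.le)

theorem nt {a b c : ℝ} (h : a * b < 0) (h' : 0 < b * c) : a * c < 0 := by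
  have := @pt (-a) b c (by linarith) h'
  linarith

theorem tn {a b c : ℝ} (h : 0 < a * b) (h' : b * c < 0) : a * c < 0 := by
  have := @pt a b (-c) h (by linarith)
  linarith

theorem nn {a b c : ℝ} (h : a * b < 0) (h' : b * c < 0) : 0 < a * c := by
  have := @pt (-a) b (-c) (by linarith) (by linarith)
  linarith

theorem psym {a b : ℝ} (h : 0 < a * b) : 0 < b * a := by linarith
theorem nsym {a b : ℝ} (h : a * b < 0) : b * a < 0 := by linarith

theorem pos_of_not {a b : ℝ} (ha : a ≠ 0) (hb : b ≠ 0) (h : ¬ a * b < 0) : 0 < a * b :=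
  lt_of_le_of_ne (not_lt.mp h) (mul_ne_zero ha hb).symm

theorem ne_left {a b : ℝ} (h : 0 < a * b) : a ≠ 0 := fun h0 => by simp [h0] at h
theorem ne_right {a b : ℝ} (h : 0 < a * b) : b ≠ 0 := fun h0 => by simp [h0] at h
theorem ne_left' {a b : ℝ} (h : a * b < 0) : a ≠ 0 := fun h0 => by simp [h0] at h
theorem ne_right' {a b : ℝ} (h : a * b < 0) : b ≠ 0 := fun h0 => by simp [h0] at h

/-- base point on a line -/
def bp (α : Set ℍ) : ℍ := frame α • gz 0

theorem bp_mem {α : Set ℍ} (h : IsGeodesicLine α) : bp α ∈ α := by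
  rw [mem_iff_sg h]
  unfold sg bp
  rw [inv_smul_smul]
  rfl

theorem same_sign {S : Set ℍ} (hS : IsPreconnected S) {f : ℍ → ℝ} (hf : Continuous f) (h : ∀ z ∈ S, f z ≠ 0)
    {p q : ℍ} (hp : p ∈ S) (hq : q ∈ S) : 0 < f p * f q := by
  apply pos_of_not (h p hp) (h q hq)
  intro hn
  have hi := hS.image f hf.continuousOn
  have hor := hi.ordConnected
  have : (0 : ℝ) ∈ f '' S := by
    rcases mul_neg_iff.mp hn with ⟨h1, h2⟩ | ⟨h1, h2⟩
    · exact hor.out ⟨q, hq, rfl⟩ ⟨p, hp, rfl⟩ ⟨h2.le, h1.le⟩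
    · exact hor.out ⟨p, hp, rfl⟩ ⟨q, hq, rfl⟩ ⟨h1.le, h2.le⟩
  obtain ⟨z, hz, hz0⟩ := this
  exact h z hz hz0

/-- a locally finite family of disjoint lines -/
structure Arr (𝒜 : Set (Set ℍ)) : Prop where
  geo : ∀ α ∈ 𝒜, IsGeodesicLine α
  disj : ∀ α ∈ 𝒜, ∀ β ∈ 𝒜, α ≠ β → α ∩ β = ∅
  lf : ∀ K : Set ℍ, IsCompact K → {α ∈ 𝒜 | (α ∩ K).Nonempty}.Finite

theorem line_preconn {α : Set ℍ} (h : IsGeodesicLine α) : IsPreconnected α := by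
  obtain ⟨γ, hγ, rfl⟩ := h
  exact isPreconnected_range hγ.continuous

theorem Arr.ne {𝒜 : Set (Set ℍ)} (H : Arr 𝒜) {α β : Set ℍ} (hα : α ∈ 𝒜) (hβ : β ∈ 𝒜) (h : α ≠ β) {p : ℍ} (hp : p ∈ α) :
    sg β p ≠ 0 := by
  intro h0
  have : p ∈ α ∩ β := ⟨hp, (mem_iff_sg (H.geo β hβ)).mpr h0⟩
  rw [H.disj α hα β hβ h] at this
  exact this

theorem Arr.const {𝒜 : Set (Set ℍ)} (H : Arr 𝒜) {α β : Set ℍ} (hα : α ∈ 𝒜) (hβ : β ∈ 𝒜) (h : α ≠ β) {p q : ℍ} (hp : p ∈ α)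
    (hq : q ∈ α) : 0 < sg β p * sg β q :=
  same_sign (line_preconn (H.geo α hα)) (continuous_sg β) (fun _ hz => H.ne hα hβ h hz) hp hq

/-! behaviour along geodesic segments -/

theorem seg_conv_le (B : SL2) (β : Set ℍ) (s : ℝ) {t0 t1 t2 : ℝ} (h1 : t0 ≤ t1) (h2 : t1 ≤ t2)
    (e0 : s * sg β (B • gz t0) ≤ 0) (e2 : s * sg β (B • gz t2) ≤ 0) : s * sg β (B • gz t1) ≤ 0 := by
  obtain ⟨a, c, h⟩ := sg_along (frame β) B
  obtain ⟨k0, hk0, f0⟩ := h t0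
  obtain ⟨k1, hk1, f1⟩ := h t1
  obtain ⟨k2, hk2, f2⟩ := h t2
  have hx1 : Real.exp (2 * t0) ≤ Real.exp (2 * t1) := Real.exp_le_exp.mpr (by linarith)
  have hx2 : Real.exp (2 * t1) ≤ Real.exp (2 * t2) := Real.exp_le_exp.mpr (by linarith)
  unfold sg at *
  rw [f0] at e0
  rw [f2] at e2
  rw [f1]
  have g0 : s * (a * Real.exp (2 * t0) + c) ≤ 0 := by
    by_contra hh; push Not at hh; nlinarith [mul_pos hk0 hh]
  have g2 : s * (a * Real.exp (2 * t2) + c) ≤ 0 := by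
    by_contra hh; push Not at hh; nlinarith [mul_pos hk2 hh]
  have g1 : s * (a * Real.exp (2 * t1) + c) ≤ 0 := by
    rcases le_total 0 (s * a) with hs | hs
    · nlinarith [mul_nonneg hs (sub_nonneg.mpr hx2)]
    · nlinarith [mul_nonneg (neg_nonneg.mpr hs) (sub_nonneg.mpr hx1)]
  nlinarith [mul_nonneg hk1.le (neg_nonneg.mpr g1)]

theorem seg_conv_lt (B : SL2) (β : Set ℍ) (s : ℝ) {t0 t1 t2 : ℝ} (h1 : t0 ≤ t1) (h2 : t1 ≤ t2)
    (e0 : s * sg β (B • gz t0) < 0) (e2 : s * sg β (B • gz t2) < 0) : s * sg β (B • gz t1) < 0 := by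
  obtain ⟨a, c, h⟩ := sg_along (frame β) B
  obtain ⟨k0, hk0, f0⟩ := h t0
  obtain ⟨k1, hk1, f1⟩ := h t1
  obtain ⟨k2, hk2, f2⟩ := h t2
  have hx1 : Real.exp (2 * t0) ≤ Real.exp (2 * t1) := Real.exp_le_exp.mpr (by linarith)
  have hx2 : Real.exp (2 * t1) ≤ Real.exp (2 * t2) := Real.exp_le_exp.mpr (by linarith)
  unfold sg at *
  rw [f0] at e0
  rw [f2] at e2
  rw [f1]
  have g0 : s * (a * Real.exp (2 * t0) + c) < 0 := by
    by_contra hh; push Not at hh; nlinarith [mul_nonneg hk0.le hh]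
  have g2 : s * (a * Real.exp (2 * t2) + c) < 0 := by
    by_contra hh; push Not at hh; nlinarith [mul_nonneg hk2.le hh]
  have g1 : s * (a * Real.exp (2 * t1) + c) < 0 := by
    rcases le_total 0 (s * a) with hs | hs
    · nlinarith [mul_nonneg hs (sub_nonneg.mpr hx2)]
    · nlinarith [mul_nonneg (neg_nonneg.mpr hs) (sub_nonneg.mpr hx1)]
  nlinarith [mul_pos hk1 (neg_pos.mpr g1)]

theorem gz_cont (B : SL2) : Continuous fun t => B • gz t := (isom_smul_gz B).continuous

theorem gz_dist (B : SL2) (s t : ℝ) : dist (B • gz s) (B • gz t) = |s - t| := by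
  have := (isom_smul_gz B).dist_eq s t
  rw [this, Real.dist_eq]

theorem seg_zero (B : SL2) (β : Set ℍ) {t0 t1 : ℝ} (h : t0 ≤ t1)
    (e : sg β (B • gz t0) * sg β (B • gz t1) ≤ 0) : ∃ t, t0 ≤ t ∧ t ≤ t1 ∧ sg β (B • gz t) = 0 := by
  have hc : ContinuousOn (fun t => sg β (B • gz t)) (Set.uIcc t0 t1) :=
    ((continuous_sg β).comp (gz_cont B)).continuousOn
  have hm : (0 : ℝ) ∈ Set.uIcc (sg β (B • gz t0)) (sg β (B • gz t1)) := by
    rw [Set.mem_uIcc]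
    rcases mul_nonpos_iff.mp e with h | h
    · exact Or.inr ⟨h.2, h.1⟩
    · exact Or.inl h
  obtain ⟨t, ht, h0⟩ := intermediate_value_uIcc hc hm
  rw [Set.uIcc_of_le h] at ht
  exact ⟨t, ht.1, ht.2, h0⟩

/-- lines strictly separating two points -/
def sp (𝒜 : Set (Set ℍ)) (p q : ℍ) : Set (Set ℍ) := {δ | δ ∈ 𝒜 ∧ sg δ p * sg δ q < 0}

theorem mem_sp {𝒜 : Set (Set ℍ)} {p q : ℍ} {δ : Set ℍ} : δ ∈ sp 𝒜 p q ↔ δ ∈ 𝒜 ∧ sg δ p * sg δ q < 0 := Iff.rfl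

theorem sp_comm (𝒜 : Set (Set ℍ)) (p q : ℍ) : sp 𝒜 p q = sp 𝒜 q p := by
  ext δ; rw [mem_sp, mem_sp, mul_comm]

theorem sp_self (𝒜 : Set (Set ℍ)) (p : ℍ) : sp 𝒜 p p = ∅ := by
  ext δ
  rw [mem_sp]
  simp only [Set.mem_empty_iff_false, iff_false, not_and, not_lt]
  intro _; exact mul_self_nonneg _

/-- crossing point on a geodesic segment -/
theorem cross1 {β : Set ℍ} (hβ : IsGeodesicLine β) {p q : ℍ} (e : sg β p * sg β q ≤ 0) :
    ∃ x ∈ β, dist p x + dist x q = dist p q := by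
  obtain ⟨B, h0, h1⟩ := exists_move p q
  obtain ⟨t, ht0, ht1, ht⟩ := seg_zero B β (dist_nonneg : 0 ≤ dist p q) (by rw [h0, h1]; exact e)
  refine ⟨B • gz t, (mem_iff_sg hβ).mpr ht, ?_⟩
  have a1 := gz_dist B 0 t
  have a2 := gz_dist B t (dist p q)
  rw [h0] at a1
  rw [h1] at a2
  rw [a1, a2, abs_of_nonpos (by linarith), abs_of_nonpos (by linarith)]
  ring

theorem sp_finite {𝒜 : Set (Set ℍ)} (H : Arr 𝒜) (p q : ℍ) : (sp 𝒜 p q).Finite := by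
  refine (H.lf (Metric.closedBall p (dist p q)) (isCompact_closedBall _ _)).subset ?_
  rintro δ ⟨hδ, hs⟩
  obtain ⟨x, hx, hd⟩ := cross1 (H.geo δ hδ) hs.le
  refine ⟨hδ, x, hx, ?_⟩
  rw [Metric.mem_closedBall, dist_comm]
  linarith [dist_nonneg (x := x) (y := q)]

theorem far_side {𝒜 : Set (Set ℍ)} (H : Arr 𝒜) {α β : Set ℍ} (hα : α ∈ 𝒜) (hβ : β ∈ 𝒜) (h : α ≠ β) {p : ℍ}
    (hp : sg β p * sg β (bp α) ≤ 0) : 0 < sg α p * sg α (bp β) := by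
  by_contra hn
  push Not at hn
  obtain ⟨B, h0, h1⟩ := exists_move p (bp β)
  obtain ⟨t, ht0, ht1, ht⟩ := seg_zero B α (dist_nonneg : 0 ≤ dist p (bp β)) (by rw [h0, h1]; exact hn)
  have hz : sg β (bp β) = 0 := (mem_iff_sg (H.geo β hβ)).mp (bp_mem (H.geo β hβ))
  have h3 := seg_conv_le B β (sg β (bp α)) ht0 ht1 (by rw [h0, mul_comm]; exact hp) (by rw [h1, hz, mul_zero])
  have h4 := H.const hα hβ h (bp_mem (H.geo α hα)) ((mem_iff_sg (H.geo α hα)).mpr ht)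
  linarith

/-- order of crossings -/
theorem cross2 {𝒜 : Set (Set ℍ)} (H : Arr 𝒜) {α β : Set ℍ} (hα : α ∈ 𝒜) (hβ : β ∈ 𝒜) (h : α ≠ β) {p q : ℍ}
    (hp : sg α p * sg α (bp β) ≤ 0) (hq : sg β q * sg β (bp α) ≤ 0) :
    ∃ x ∈ α, ∃ y ∈ β, dist p x + dist x y + dist y q = dist p q := by
  have h1 := far_side H hα hβ h hq
  have h2 : sg α p * sg α q ≤ 0 := by
    by_contra hn
    push Not at hn
    have := pt hn h1
    linarith
  obtain ⟨x, hx, hd⟩ := cross1 (H.geo α hα) h2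
  have h3 : sg β x * sg β q ≤ 0 := by
    have h4 := H.const hα hβ h hx (bp_mem (H.geo α hα))
    by_contra hn
    push Not at hn
    have := pt (psym hn) h4
    linarith
  obtain ⟨y, hy, hd'⟩ := cross1 (H.geo β hβ) h3
  exact ⟨x, hx, y, hy, by linarith⟩

/-- transitivity of separation -/
theorem sp_trans {𝒜 : Set (Set ℍ)} (H : Arr 𝒜) {η δ : Set ℍ} {u p : ℍ} (h1 : η ∈ sp 𝒜 u (bp δ))
    (h2 : δ ∈ sp 𝒜 u p) : η ∈ sp 𝒜 u p := by
  obtain ⟨hη, e1⟩ := h1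
  obtain ⟨hδ, e2⟩ := h2
  have hne : η ≠ δ := by
    rintro rfl
    rw [(mem_iff_sg (H.geo η hη)).mp (bp_mem (H.geo η hη))] at e1
    simp at e1
  have h3 := far_side H hδ hη hne.symm e1.le
  have h4 : sg δ p * sg δ (bp η) < 0 := nt (nsym e2) h3
  have h5 := far_side H hη hδ hne h4.le
  exact ⟨hη, nt e1 (psym h5)⟩

/-- complement of the lines -/
def Oc (𝒜 : Set (Set ℍ)) : Set ℍ := (⋃ α ∈ 𝒜, α)ᶜ

theorem mem_Oc {𝒜 : Set (Set ℍ)} (H : Arr 𝒜) {u : ℍ} : u ∈ Oc 𝒜 ↔ ∀ α ∈ 𝒜, sg α u ≠ 0 := by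
  unfold Oc
  simp only [Set.mem_compl_iff, Set.mem_iUnion, not_exists]
  constructor
  · intro h α hα h0; exact h α hα ((mem_iff_sg (H.geo α hα)).mpr h0)
  · intro h α hα h0; exact h α hα ((mem_iff_sg (H.geo α hα)).mp h0)

theorem not_sp {𝒜 : Set (Set ℍ)} (H : Arr 𝒜) {u v : ℍ} (hu : u ∈ Oc 𝒜) (hv : v ∈ Oc 𝒜) {δ : Set ℍ} (hδ : δ ∈ 𝒜)
    (h : δ ∉ sp 𝒜 u v) : 0 < sg δ u * sg δ v :=
  pos_of_not ((mem_Oc H).mp hu δ hδ) ((mem_Oc H).mp hv δ hδ) fun hn => h ⟨hδ, hn⟩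

theorem cc_iff {𝒜 : Set (Set ℍ)} (H : Arr 𝒜) {u v : ℍ} (hu : u ∈ Oc 𝒜) (hv : v ∈ Oc 𝒜) :
    connectedComponentIn (Oc 𝒜) u = connectedComponentIn (Oc 𝒜) v ↔ sp 𝒜 u v = ∅ := by
  constructor
  · intro h
    rw [Set.eq_empty_iff_forall_notMem]
    rintro δ ⟨hδ, hn⟩
    have hv' : v ∈ connectedComponentIn (Oc 𝒜) u := by rw [h]; exact mem_connectedComponentIn hv
    have := same_sign (isPreconnected_connectedComponentIn) (continuous_sg δ)
      (fun z hz => (mem_Oc H).mp (connectedComponentIn_subset _ _ hz) δ hδ) (mem_connectedComponentIn hu) hv'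
    linarith
  · intro h
    obtain ⟨B, h0, h1⟩ := exists_move u v
    have hp : IsPreconnected ((fun t => B • gz t) '' Set.Icc 0 (dist u v)) :=
      isPreconnected_Icc.image _ (gz_cont B).continuousOn
    have hsub : (fun t => B • gz t) '' Set.Icc 0 (dist u v) ⊆ Oc 𝒜 := by
      rintro _ ⟨t, ⟨ht0, ht1⟩, rfl⟩
      rw [mem_Oc H]
      intro δ hδ hz
      have hpos := not_sp H hu hv hδ (by rw [h]; exact fun h => h)
      have hu2 : 0 < sg δ u * sg δ u := by
        exact mul_self_pos.mpr (ne_left hpos)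
      have := seg_conv_lt B δ (-sg δ u) ht0 ht1 (by rw [h0]; linarith) (by rw [h1]; linarith)
      simp only at hz
      rw [hz] at this
      simp at this
    have := hp.subset_connectedComponentIn (x := u) ⟨0, ⟨le_rfl, dist_nonneg⟩, h0⟩ hsub
    exact connectedComponentIn_eq (this ⟨dist u v, ⟨dist_nonneg, le_rfl⟩, h1⟩)

/-- point at parameter `s` transverse to the vertical line -/
def tr (s : ℝ) : ℍ := ⟨⟨s, 1⟩, one_pos⟩

theorem tr_cont : Continuous tr := by
  apply UpperHalfPlane.isEmbedding_coe.continuous_iff.mpr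
  have : ((fun z : ℍ => (z : ℂ)) ∘ tr) = fun s : ℝ => (s : ℂ) + Complex.I := by
    funext s
    apply Complex.ext <;> simp [tr]
  change Continuous ((fun z : ℍ => (z : ℂ)) ∘ tr)
  rw [this]
  fun_prop

theorem near_pt {𝒜 : Set (Set ℍ)} (H : Arr 𝒜) {α : Set ℍ} (hα : α ∈ 𝒜) {ε : ℝ} (hε : ε ≠ 0) :
    ∃ u ∈ Oc 𝒜, 0 < ε * sg α u ∧ ∀ δ ∈ 𝒜, δ ≠ α → 0 < sg δ u * sg δ (bp α) := by
  have hfin := H.lf (Metric.closedBall (bp α) 1) (isCompact_closedBall _ _)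
  have hc : Continuous fun s : ℝ => frame α • tr (ε * s) := by
    have := tr_cont
    exact (this.comp (continuous_const.mul continuous_id)).const_smul _
  have hc0 : frame α • tr (ε * 0) = bp α := by
    unfold bp
    congr 1
    apply UpperHalfPlane.ext_re_im <;> simp [tr, UpperHalfPlane.re, UpperHalfPlane.im, gz]
  have hev1 : ∀ᶠ z in 𝓝 (bp α), ∀ δ ∈ {δ ∈ 𝒜 | (δ ∩ Metric.closedBall (bp α) 1).Nonempty}, δ ≠ α →
      0 < sg δ z * sg δ (bp α) := by
    rw [Filter.eventually_all_finite hfin]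
    intro δ hδ
    by_cases h : δ = α
    · exact Filter.Eventually.of_forall fun _ h' => absurd h h'
    · have hne := H.ne hα hδ.1 (Ne.symm h) (bp_mem (H.geo α hα))
      have hcc : Continuous fun z => sg δ z * sg δ (bp α) := (continuous_sg δ).mul continuous_const
      have h0 : 0 < sg δ (bp α) * sg δ (bp α) := mul_self_pos.mpr hne
      filter_upwards [hcc.continuousAt.eventually (lt_mem_nhds h0)] with z hz _ using hz
  have hev2 : ∀ᶠ z in 𝓝 (bp α), z ∈ Metric.closedBall (bp α) 1 := Metric.closedBall_mem_nhds _ one_pos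
  have htend : Tendsto (fun s : ℝ => frame α • tr (ε * s)) (𝓝[>] 0) (𝓝 (bp α)) := by
    have := hc.tendsto 0
    rw [hc0] at this
    exact this.mono_left nhdsWithin_le_nhds
  have h3 := htend.eventually (hev1.and hev2)
  have h4 : ∀ᶠ t in 𝓝[>] (0 : ℝ), t ∈ Set.Ioi (0 : ℝ) := self_mem_nhdsWithin
  obtain ⟨s, ⟨hs1, hs2⟩, hs0⟩ := (h3.and h4).exists
  have hs0 : 0 < s := hs0
  have hall : ∀ δ ∈ 𝒜, δ ≠ α → 0 < sg δ (frame α • tr (ε * s)) * sg δ (bp α) := by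
    intro δ hδ hne
    by_contra hn
    push Not at hn
    have hn2 := hn
    rw [mul_comm] at hn2
    obtain ⟨x, hx, hd⟩ := cross1 (H.geo δ hδ) hn2
    have : δ ∈ {δ ∈ 𝒜 | (δ ∩ Metric.closedBall (bp α) 1).Nonempty} := by
      refine ⟨hδ, x, hx, ?_⟩
      rw [Metric.mem_closedBall] at hs2 ⊢
      rw [dist_comm] at hs2 ⊢
      linarith [dist_nonneg (x := x) (y := frame α • tr (ε * s))]
    have := hs1 δ this hne
    linarith
  have hα2 : sg α (frame α • tr (ε * s)) = ε * s := by
    unfold sg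
    rw [inv_smul_smul]
    rfl
  refine ⟨_, ?_, ?_, hall⟩
  · rw [mem_Oc H]
    intro δ hδ
    by_cases h : δ = α
    · rw [h, hα2]; positivity
    · exact ne_left (hall δ hδ h)
  · rw [hα2]
    have : 0 < ε ^ 2 := by positivity
    nlinarith

/-- lines adjacent to `u` -/
def A0 (𝒜 : Set (Set ℍ)) (u : ℍ) : Set (Set ℍ) := {α | α ∈ 𝒜 ∧ ∀ δ ∈ 𝒜, δ ≠ α → 0 < sg δ u * sg δ (bp α)}

theorem A0_pos {𝒜 : Set (Set ℍ)} (H : Arr 𝒜) {u : ℍ} {α : Set ℍ} (hα : α ∈ A0 𝒜 u) {δ : Set ℍ} (hδ : δ ∈ 𝒜)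
    (hne : δ ≠ α) {p : ℍ} (hp : p ∈ α) : 0 < sg δ u * sg δ p :=
  pt (hα.2 δ hδ hne) (H.const hα.1 hδ hne.symm (bp_mem (H.geo α hα.1)) hp)

theorem A0_iff {𝒜 : Set (Set ℍ)} (H : Arr 𝒜) {u : ℍ} (hu : u ∈ Oc 𝒜) {α : Set ℍ} (hα : α ∈ 𝒜) :
    α ∈ A0 𝒜 u ↔ sp 𝒜 u (bp α) = ∅ := by
  rw [Set.eq_empty_iff_forall_notMem]
  constructor
  · rintro ⟨_, h⟩ δ ⟨hδ, hn⟩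
    by_cases hne : δ = α
    · rw [hne, (mem_iff_sg (H.geo α hα)).mp (bp_mem (H.geo α hα))] at hn; simp at hn
    · have := h δ hδ hne; linarith
  · intro h
    refine ⟨hα, fun δ hδ hne => ?_⟩
    exact pos_of_not ((mem_Oc H).mp hu δ hδ) (H.ne hα hδ hne.symm (bp_mem (H.geo α hα))) fun hn => h δ ⟨hδ, hn⟩

/-- the first line separating `u` from `p` -/
theorem first_line {𝒜 : Set (Set ℍ)} (H : Arr 𝒜) {u p : ℍ} (hu : u ∈ Oc 𝒜) (h : (sp 𝒜 u p).Nonempty) :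
    ∃ β ∈ A0 𝒜 u, β ∈ sp 𝒜 u p := by
  obtain ⟨β, hβ, hmin⟩ := Set.exists_min_image (sp 𝒜 u p) (fun β => (sp 𝒜 u (bp β)).ncard) (sp_finite H u p) h
  refine ⟨β, (A0_iff H hu hβ.1).mpr ?_, hβ⟩
  rw [Set.eq_empty_iff_forall_notMem]
  intro δ hδ
  have h1 := sp_trans H hδ hβ
  have h2 := hmin δ h1
  have h3 : sp 𝒜 u (bp δ) ⊂ sp 𝒜 u (bp β) := by
    refine ⟨fun η hη => sp_trans H hη hδ, fun hs => ?_⟩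
    have h4 := hs hδ
    have := h4.2
    rw [(mem_iff_sg (H.geo δ hδ.1)).mp (bp_mem (H.geo δ hδ.1))] at this
    simp at this
  have := Set.ncard_lt_ncard h3 (sp_finite H _ _)
  omega

/-- crossing an adjacent line -/
theorem crossing {𝒜 : Set (Set ℍ)} (H : Arr 𝒜) {u : ℍ} (hu : u ∈ Oc 𝒜) {β : Set ℍ} (hβ : β ∈ A0 𝒜 u) :
    ∃ v ∈ Oc 𝒜, sg β u * sg β v < 0 ∧ β ∈ A0 𝒜 v ∧ ∀ δ ∈ 𝒜, δ ≠ β → 0 < sg δ u * sg δ v := by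
  have hne := (mem_Oc H).mp hu β hβ.1
  obtain ⟨v, hv, h1, h2⟩ := near_pt H hβ.1 (neg_ne_zero.mpr hne)
  exact ⟨v, hv, by linarith, ⟨hβ.1, h2⟩, fun δ hδ hd => pt (hβ.2 δ hδ hd) (psym (h2 δ hδ hd))⟩

theorem Oc_nonempty {𝒜 : Set (Set ℍ)} (H : Arr 𝒜) : (Oc 𝒜).Nonempty := by
  by_cases h : 𝒜.Nonempty
  · obtain ⟨α, hα⟩ := h
    obtain ⟨u, hu, _⟩ := near_pt H hα one_ne_zero
    exact ⟨u, hu⟩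
  · rw [Set.not_nonempty_iff_eq_empty] at h
    refine ⟨UpperHalfPlane.I, ?_⟩
    rw [mem_Oc H]
    intro α hα
    rw [h] at hα
    exact hα.elim

end

section

/-- the contraction data -/
structure Gd (𝒜 : Set (Set ℍ)) (g : Set ℍ → PSL2) (K : ℝ) : Prop where
  arr : Arr 𝒜
  pos : 0 < K
  contr : ∀ α ∈ 𝒜, ∀ β ∈ 𝒜, α ≠ β → ∀ x ∈ α, ∀ y ∈ β, dist (pslSMul (g α) x) (pslSMul (g β) y) ≤ dist x y - K

variable {𝒜 : Set (Set ℍ)} {g : Set ℍ → PSL2} {K : ℝ}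

theorem Gd.NN (G : Gd 𝒜 g K) {α β : Set ℍ} (hα : α ∈ 𝒜) (hβ : β ∈ 𝒜) (hne : α ≠ β) {x : PSL2}
    (h1 : x ∈ Dh (g α) α (bp β)) (h2 : x ∈ Dh (g β) β (bp α)) : False := by
  have H := G.arr
  have key : ∀ p ∈ Far α (bp β), ∀ q ∈ Far β (bp α),
      dist (pslSMul (g α) p) (pslSMul (g β) q) ≤ dist p q - K := by
    intro p hp q hq
    obtain ⟨a, ha, b, hb, hd⟩ := cross2 H hα hβ hne (mem_Far.mp hp) (mem_Far.mp hq)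
    have e1 := pslSMul_dist (g α) p a
    have e2 := pslSMul_dist (g β) b q
    have e3 := G.contr α hα β hβ hne a ha b hb
    have e4 := dist_triangle4 (pslSMul (g α) p) (pslSMul (g α) a) (pslSMul (g β) b) (pslSMul (g β) q)
    linarith
  have s1 := H.ne hβ hα hne.symm (bp_mem (H.geo β hβ))
  have s2 := H.ne hα hβ hne (bp_mem (H.geo α hα))
  obtain ⟨B, hB, hB'⟩ := adapt (H.geo α hα) s1
  obtain ⟨C, hC, hC'⟩ := adapt (H.geo β hβ) s2
  have f1 := adapt_far hB hB'
  have f2 := adapt_far hC hC'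
  refine Dset_disjoint G.pos key ?_ h1 h2
  rw [f1, f2] at key ⊢
  refine br_ne_half G.pos fun p hp q hq => ?_
  have := key p hp q hq
  linarith [dist_nonneg (x := pslSMul (g α) p) (y := pslSMul (g β) q)]

theorem Gd.crook_disj (G : Gd 𝒜 g K) {α β : Set ℍ} (hα : α ∈ 𝒜) (hβ : β ∈ 𝒜) (hne : α ≠ β) :
    Disjoint ((g α * ·) '' rightCrooked α) ((g β * ·) '' rightCrooked β) := by
  have H := G.arr
  have s1 := H.ne hβ hα hne.symm (bp_mem (H.geo β hβ))
  have s2 := H.ne hα hβ hne (bp_mem (H.geo α hα))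
  rw [Set.disjoint_left]
  intro x h1 h2
  exact G.NN hα hβ hne (crook_sub (H.geo α hα) s1 _ h1) (crook_sub (H.geo β hβ) s2 _ h2)

theorem sg_bp (H : Arr 𝒜) {α : Set ℍ} (hα : α ∈ 𝒜) : sg α (bp α) = 0 :=
  (mem_iff_sg (H.geo α hα)).mp (bp_mem (H.geo α hα))

theorem Gd.N2 (G : Gd 𝒜 g K) {α β : Set ℍ} {u : ℍ} (hα : α ∈ 𝒜) (hβ : β ∈ A0 𝒜 u) (hs : β ∈ sp 𝒜 u (bp α))
    {x : PSL2} (hx : x ∈ Dh (g α) α u) : x ∈ Dh (g β) β u := by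
  have H := G.arr
  have hne : α ≠ β := by
    rintro rfl
    have := hs.2
    rw [sg_bp H hα] at this
    simp at this
  rw [Dh_congr (hβ.2 α hα hne)] at hx
  have := Set.mem_univ x
  rw [← Dh_union (H.geo β hβ.1) hs.2 (g β)] at this
  rcases this with h | h
  · exact h
  · exact (G.NN hα hβ.1 hne hx h).elim

theorem Gd.N3 (G : Gd 𝒜 g K) {α β : Set ℍ} {u : ℍ} (hα : α ∈ A0 𝒜 u) (hβ : β ∈ A0 𝒜 u) (hne : α ≠ β)
    {x : PSL2} (hx : x ∈ Dh (g α) α u) (hy : x ∈ Dh (g β) β u) : False := by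
  rw [Dh_congr (hβ.2 α hα.1 hne)] at hx
  rw [Dh_congr (hα.2 β hβ.1 hne.symm)] at hy
  exact G.NN hα.1 hβ.1 hne hx hy

theorem sp_sub (H : Arr 𝒜) {β δ : Set ℍ} {p q x : ℍ} (hβ : β ∈ 𝒜) (hq : q ∈ β) (hδ : δ ∈ sp 𝒜 q p) (hx : x ∈ δ) :
    sp 𝒜 q x ⊆ sp 𝒜 q p \ {δ} := by
  intro η hη
  have hne : η ≠ δ := by
    rintro rfl
    have := hη.2
    rw [(mem_iff_sg (H.geo η hη.1)).mp hx] at this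
    simp at this
  refine ⟨sp_trans H ⟨hη.1, nt hη.2 ?_⟩ hδ, hne⟩
  exact H.const hδ.1 hη.1 hne.symm hx (bp_mem (H.geo δ hδ.1))

theorem Gd.C6 (G : Gd 𝒜 g K) (n : ℕ) : ∀ {α β : Set ℍ} {p q : ℍ}, α ∈ 𝒜 → β ∈ 𝒜 → α ≠ β → p ∈ α → q ∈ β →
    (sp 𝒜 q p).ncard = n → dist (pslSMul (g α) p) (pslSMul (g β) q) ≤ dist p q - (n + 1) * K := by
  have H := G.arr
  induction n using Nat.strong_induction_on with
  | _ n ih =>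
  intro α β p q hα hβ hne hp hq hn
  have hfin := sp_finite H q p
  rcases Nat.eq_zero_or_pos n with h0 | h0
  · have := G.contr α hα β hβ hne p hp q hq
    rw [h0]; push_cast; linarith
  · obtain ⟨δ, hδ⟩ : (sp 𝒜 q p).Nonempty := by
      rw [← Set.ncard_pos hfin]; omega
    obtain ⟨x, hx, hd⟩ := cross1 (H.geo δ hδ.1) hδ.2.le
    have hδα : δ ≠ α := by
      rintro rfl
      have := hδ.2
      rw [(mem_iff_sg (H.geo δ hα)).mp hp] at this
      simp at this
    have hδβ : δ ≠ β := by
      rintro rfl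
      have := hδ.2
      rw [(mem_iff_sg (H.geo δ hβ)).mp hq] at this
      simp at this
    have s1 := sp_sub H hβ hq hδ hx
    have s2 : sp 𝒜 p x ⊆ sp 𝒜 q p \ {δ} := by
      have := sp_sub H hα hp (sp_comm 𝒜 q p ▸ hδ) hx
      rwa [sp_comm 𝒜 p q] at this
    have hc : (sp 𝒜 q p \ {δ}).ncard = n - 1 := by
      rw [Set.ncard_diff_singleton_of_mem hδ, hn]
    have hfd : (sp 𝒜 q p \ {δ}).Finite := hfin.subset Set.diff_subset
    have l1 := Set.ncard_le_ncard s1 hfd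
    have l2 := Set.ncard_le_ncard s2 hfd
    have l3 : (sp 𝒜 q p \ {δ}).ncard ≤ (sp 𝒜 q x ∪ sp 𝒜 p x).ncard := by
      refine Set.ncard_le_ncard ?_ ((sp_finite H _ _).union (sp_finite H _ _))
      rintro η ⟨hη, hηδ⟩
      have hnz := H.ne hδ.1 hη.1 (Ne.symm hηδ) hx
      by_cases hs : sg η q * sg η x < 0
      · exact Or.inl ⟨hη.1, hs⟩
      · have := pos_of_not (ne_left' hη.2) hnz hs
        exact Or.inr ⟨hη.1, nsym (tn (psym this) hη.2)⟩
    have l4 := Set.ncard_union_le (sp 𝒜 q x) (sp 𝒜 p x)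
    have i1 := ih _ (by omega) hδ.1 hβ hδβ hx hq rfl
    have i2 := ih _ (by omega) hδ.1 hα hδα hx hp rfl
    have t1 := dist_triangle (pslSMul (g α) p) (pslSMul (g δ) x) (pslSMul (g β) q)
    rw [dist_comm (pslSMul (g δ) x) (pslSMul (g α) p)] at i2
    have hsum : n ≤ (sp 𝒜 q x).ncard + (sp 𝒜 p x).ncard + 1 := by omega
    have hsum' : (n : ℝ) ≤ (sp 𝒜 q x).ncard + (sp 𝒜 p x).ncard + 1 := by exact_mod_cast hsum
    have hm := mul_le_mul_of_nonneg_right hsum' G.pos.le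
    rw [dist_comm q x, dist_comm q p] at hd
    linarith

theorem self_mem_Dset (x : PSL2) (o : ℍ) : x ∈ Dset x {o} := by
  obtain ⟨X, rfl⟩ := exists_lift x
  rw [mem_Dset_mk]
  refine ⟨vec o, subset_closure ⟨o, rfl, 1, by simp⟩, ?_, 1, by simp, by simp⟩
  intro h
  have := congrArg Prod.snd h
  simp [vec] at this

theorem Gd.far_bound (G : Gd 𝒜 g K) {o : ℍ} (ho : o ∈ Oc 𝒜) {α : Set ℍ} (hα : α ∈ 𝒜) {x : PSL2}
    (hx : x ∈ Dh (g α) α o) {M : ℝ} (hM0 : 0 ≤ M)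
    (hM : ∀ β ∈ A0 𝒜 o, dist o (bp β) + dist (pslSMul (g β) (bp β)) o + dist (pslSMul x o) o ≤ M) :
    (sp 𝒜 o (bp α)).ncard * K ≤ M := by
  have H := G.arr
  have hK := G.pos
  by_contra hlt
  push Not at hlt
  have hne : (sp 𝒜 o (bp α)).Nonempty := by
    rw [← Set.ncard_pos (sp_finite H _ _)]
    by_contra h0
    have : (sp 𝒜 o (bp α)).ncard = 0 := by omega
    rw [this] at hlt
    push_cast at hlt
    linarith
  obtain ⟨β, hβ, hβs⟩ := first_line H ho hne
  have hβα : β ≠ α := by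
    rintro rfl
    have := hβs.2
    rw [sg_bp H hα] at this
    simp at this
  refine Dset_disjoint (k := (sp 𝒜 o (bp α)).ncard * K - M) (by linarith) ?_
    (br_ne_point (P := Far α o) (o := o)) hx (self_mem_Dset x o)
  intro p hp p' hp'
  rw [Set.mem_singleton_iff] at hp'
  subst hp'
  obtain ⟨p1, hp1, d1⟩ := cross1 (H.geo α hα) (mem_Far.mp hp)
  have hb1 : sg β p1 * sg β p' < 0 := by
    have := H.const hα hβ.1 hβα.symm (bp_mem (H.geo α hα)) hp1
    exact nsym (nt hβs.2 this)
  obtain ⟨q, hq, d2⟩ := cross1 (H.geo β hβ.1) hb1.le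
  have hsub : sp 𝒜 p' (bp α) \ {β} ⊆ sp 𝒜 q p1 := by
    rintro δ ⟨hδ, hδβ⟩
    have hδα : δ ≠ α := by
      rintro rfl
      have := hδ.2
      rw [sg_bp H hα] at this
      simp at this
    have e1 := H.const hα hδ.1 hδα.symm (bp_mem (H.geo α hα)) hp1
    have e2 := A0_pos H hβ hδ.1 hδβ hq
    exact ⟨hδ.1, tn (psym e2) (nt hδ.2 e1)⟩
  have hc := Set.ncard_le_ncard hsub (sp_finite H _ _)
  rw [Set.ncard_diff_singleton_of_mem hβs] at hc
  have hc' : (sp 𝒜 p' (bp α)).ncard ≤ (sp 𝒜 q p1).ncard + 1 := by omega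
  have hc'' : ((sp 𝒜 p' (bp α)).ncard : ℝ) ≤ (sp 𝒜 q p1).ncard + 1 := by exact_mod_cast hc'
  have hm := mul_le_mul_of_nonneg_right hc'' hK.le
  have c6 := G.C6 _ hα hβ.1 hβα.symm hp1 hq rfl
  have m1 := hM β hβ
  have e1 := pslSMul_dist (g α) p p1
  have e2 := pslSMul_dist (g β) q (bp β)
  have t1 := dist_triangle4 (pslSMul (g α) p) (pslSMul (g α) p1) (pslSMul (g β) q) (pslSMul (g β) (bp β))
  have t2 := dist_triangle4 (pslSMul (g α) p) (pslSMul (g β) (bp β)) p' (pslSMul x p')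
  have t3 := dist_triangle q p' (bp β)
  rw [dist_comm p' (pslSMul x p')] at t2
  linarith

end

section

/-- all hypotheses -/
structure Gp (r : ℕ) (j ρ : FreeGroup (Fin r) →* PSL2) (𝒜 : Set (Set ℍ)) (g : Set ℍ → PSL2) (K : ℝ) : Prop where
  gd : Gd 𝒜 g K
  inv : ∀ γ, ∀ α ∈ 𝒜, pslImg (j γ) α ∈ 𝒜
  trans : ∀ U V, IsCC (⋃ α ∈ 𝒜, α)ᶜ U → IsCC (⋃ α ∈ 𝒜, α)ᶜ V → ∃! γ, pslImg (j γ) U = V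
  equiv : ∀ γ, ∀ α ∈ 𝒜, g (pslImg (j γ) α) = ρ γ * g α * (j γ)⁻¹

variable {r : ℕ} {j ρ : FreeGroup (Fin r) →* PSL2} {𝒜 : Set (Set ℍ)} {g : Set ℍ → PSL2} {K : ℝ}

theorem sg_neg {α : Set ℍ} (h : IsGeodesicLine α) (a : PSL2) (z w : ℍ) :
    sg (pslImg a α) (pslSMul a z) * sg (pslImg a α) (pslSMul a w) < 0 ↔ sg α z * sg α w < 0 := by
  obtain ⟨k, hk, e⟩ := sg_equiv h a z w
  rw [e]
  constructor
  · intro h; by_contra hn; push Not at hn; have := mul_nonneg hk.le hn; linarith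
  · intro h; exact mul_neg_of_pos_of_neg hk h

theorem pslImg_inv_img (a : PSL2) (s : Set ℍ) : pslImg a (pslImg a⁻¹ s) = s := by
  rw [← pslImg_mul, mul_inv_cancel, pslImg_one]

theorem pslImg_inv_img' (a : PSL2) (s : Set ℍ) : pslImg a⁻¹ (pslImg a s) = s := by
  rw [← pslImg_mul, inv_mul_cancel, pslImg_one]

theorem pslSMul_mem_img (a : PSL2) {s : Set ℍ} {z : ℍ} (h : z ∈ s) : pslSMul a z ∈ pslImg a s := by
  rw [mem_pslImg, pslSMul_inv]; exact h

theorem Gp.sp_img (G : Gp r j ρ 𝒜 g K) (γ : FreeGroup (Fin r)) (u v : ℍ) {δ : Set ℍ} :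
    δ ∈ sp 𝒜 u v ↔ pslImg (j γ) δ ∈ sp 𝒜 (pslSMul (j γ) u) (pslSMul (j γ) v) := by
  have H := G.gd.arr
  constructor
  · rintro ⟨h1, h2⟩
    exact ⟨G.inv γ δ h1, (sg_neg (H.geo δ h1) _ _ _).mpr h2⟩
  · rintro ⟨h1, h2⟩
    have h3 : δ ∈ 𝒜 := by
      have := G.inv γ⁻¹ _ h1
      rwa [map_inv, pslImg_inv_img'] at this
    exact ⟨h3, (sg_neg (H.geo δ h3) _ _ _).mp h2⟩

theorem Gp.sp_img' (G : Gp r j ρ 𝒜 g K) (γ : FreeGroup (Fin r)) (u v : ℍ) {δ : Set ℍ} :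
    δ ∈ sp 𝒜 (pslSMul (j γ) u) (pslSMul (j γ) v) ↔ pslImg (j γ)⁻¹ δ ∈ sp 𝒜 u v := by
  rw [G.sp_img γ u v, pslImg_inv_img]

theorem Gp.sp_empty (G : Gp r j ρ 𝒜 g K) (γ : FreeGroup (Fin r)) (u v : ℍ) :
    sp 𝒜 (pslSMul (j γ) u) (pslSMul (j γ) v) = ∅ ↔ sp 𝒜 u v = ∅ := by
  simp only [Set.eq_empty_iff_forall_notMem]
  constructor
  · intro h δ hδ; exact h _ ((G.sp_img γ u v).mp hδ)
  · intro h δ hδ; exact h _ ((G.sp_img' γ u v).mp hδ)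

theorem Gp.Oc_inv (G : Gp r j ρ 𝒜 g K) (γ : FreeGroup (Fin r)) {u : ℍ} (hu : u ∈ Oc 𝒜) : pslSMul (j γ) u ∈ Oc 𝒜 := by
  unfold Oc at *
  simp only [Set.mem_compl_iff, Set.mem_iUnion, not_exists] at *
  intro α hα h
  refine hu (pslImg (j γ⁻¹) α) (G.inv _ α hα) ?_
  have := pslSMul_mem_img (j γ⁻¹) h
  rwa [map_inv, pslSMul_inv, ← map_inv] at this

theorem Gp.T1 (G : Gp r j ρ 𝒜 g K) {u v : ℍ} (hu : u ∈ Oc 𝒜) (hv : v ∈ Oc 𝒜) :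
    ∃ γ, sp 𝒜 (pslSMul (j γ) u) v = ∅ := by
  have H := G.gd.arr
  obtain ⟨γ, h, -⟩ := G.trans _ _ ⟨u, hu, rfl⟩ ⟨v, hv, rfl⟩
  refine ⟨γ, ?_⟩
  have h1 : pslSMul (j γ) u ∈ connectedComponentIn (⋃ α ∈ 𝒜, α)ᶜ v := by
    rw [← h]; exact pslSMul_mem_img _ (mem_connectedComponentIn hu)
  exact (cc_iff H (G.Oc_inv γ hu) hv).mp (connectedComponentIn_eq h1).symm

theorem Gp.T2 (G : Gp r j ρ 𝒜 g K) {u : ℍ} (hu : u ∈ Oc 𝒜) {γ : FreeGroup (Fin r)}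
    (h : sp 𝒜 (pslSMul (j γ) u) u = ∅) : γ = 1 := by
  have H := G.gd.arr
  have himg : ∀ γ : FreeGroup (Fin r), sp 𝒜 (pslSMul (j γ) u) u = ∅ →
      pslImg (j γ) (connectedComponentIn (Oc 𝒜) u) ⊆ connectedComponentIn (Oc 𝒜) u := by
    intro γ h
    refine Set.Subset.trans ?_ ((cc_iff H (G.Oc_inv γ hu) hu).mpr h).subset
    have e : pslImg (j γ) (connectedComponentIn (Oc 𝒜) u) = (fun z => pslSMul (j γ) z) '' connectedComponentIn (Oc 𝒜) u := by
      ext z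
      rw [mem_pslImg]
      constructor
      · intro hz; exact ⟨_, hz, pslSMul_inv' _ _⟩
      · rintro ⟨w, hw, rfl⟩
        simp only [pslSMul_inv]; exact hw
    refine IsPreconnected.subset_connectedComponentIn ?_ (pslSMul_mem_img _ (mem_connectedComponentIn hu)) ?_
    · rw [e]
      exact isPreconnected_connectedComponentIn.image _ (pslSMul_continuous _).continuousOn
    · rw [e]
      rintro _ ⟨w, hw, rfl⟩
      exact G.Oc_inv γ (connectedComponentIn_subset _ _ hw)
  have h' : sp 𝒜 (pslSMul (j γ⁻¹) u) u = ∅ := by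
    have := (G.sp_empty γ⁻¹ (pslSMul (j γ) u) u).mpr h
    rw [map_inv, pslSMul_inv] at this
    rw [map_inv, sp_comm]; exact this
  have heq : pslImg (j γ) (connectedComponentIn (Oc 𝒜) u) = connectedComponentIn (Oc 𝒜) u := by
    refine (himg γ h).antisymm fun z hz => ?_
    rw [mem_pslImg]
    have := himg _ h' (pslSMul_mem_img (j γ⁻¹) hz)
    rwa [map_inv] at this
  obtain ⟨γ0, _, huniq⟩ := G.trans (connectedComponentIn (Oc 𝒜) u) (connectedComponentIn (Oc 𝒜) u) ⟨u, hu, rfl⟩ ⟨u, hu, rfl⟩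
  rw [huniq γ heq, huniq 1 (by simp only [map_one, pslImg_one])]

theorem sp_tri (H : Arr 𝒜) {u v w : ℍ} (hv : v ∈ Oc 𝒜) {δ : Set ℍ} (h : δ ∈ sp 𝒜 u w) :
    δ ∈ sp 𝒜 u v ∨ δ ∈ sp 𝒜 v w := by
  have h0 := (mem_Oc H).mp hv δ h.1
  by_cases hn : sg δ u * sg δ v < 0
  · exact Or.inl ⟨h.1, hn⟩
  · exact Or.inr ⟨h.1, tn (psym (pos_of_not (ne_left' h.2) h0 hn)) h.2⟩

theorem Gp.C1 (G : Gp r j ρ 𝒜 g K) : ∃ F : Set (Set ℍ), F.Finite ∧ F ⊆ 𝒜 ∧ ∀ α ∈ 𝒜, ∃ γ, ∃ f ∈ F, pslImg (j γ) f = α := by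
  have H := G.gd.arr
  obtain ⟨o, ho⟩ := Oc_nonempty H
  refine ⟨⋃ i, sp 𝒜 o (pslSMul (j (FreeGroup.of i)) o), Set.finite_iUnion fun i => sp_finite H _ _,
    Set.iUnion_subset fun i δ hδ => hδ.1, ?_⟩
  set F := ⋃ i, sp 𝒜 o (pslSMul (j (FreeGroup.of i)) o) with hF
  have hinv : ∀ (γ : FreeGroup (Fin r)) (δ : Set ℍ), (∃ γ', ∃ f ∈ F, pslImg (j γ') f = pslImg (j γ)⁻¹ δ) →
      ∃ γ', ∃ f ∈ F, pslImg (j γ') f = δ := by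
    rintro γ δ ⟨γ', f, hf, e⟩
    refine ⟨γ * γ', f, hf, ?_⟩
    rw [map_mul, pslImg_mul, e, pslImg_inv_img]
  have key : ∀ γ : FreeGroup (Fin r), ∀ δ ∈ sp 𝒜 o (pslSMul (j γ) o), ∃ γ', ∃ f ∈ F, pslImg (j γ') f = δ := by
    intro γ
    induction γ using FreeGroup.induction_on with
    | C1 => intro δ hδ; rw [map_one, pslSMul_one, sp_self] at hδ; exact hδ.elim
    | of i => intro δ hδ; exact ⟨1, δ, Set.mem_iUnion.mpr ⟨i, hδ⟩, by rw [map_one, pslImg_one]⟩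
    | inv_of i _ =>
      intro δ hδ
      refine hinv (FreeGroup.of i)⁻¹ δ ?_
      refine ⟨1, _, Set.mem_iUnion.mpr ⟨i, ?_⟩, by rw [map_one, pslImg_one]⟩
      rw [sp_comm, ← G.sp_img' (FreeGroup.of i)⁻¹, map_inv, pslSMul_inv]
      rwa [map_inv] at hδ
    | mul a b ha hb =>
      intro δ hδ
      rcases sp_tri H (G.Oc_inv a ho) hδ with h | h
      · exact ha δ h
      · rw [map_mul, pslSMul_mul, G.sp_img' a] at h
        exact hinv a δ (hb _ h)
  intro α hα
  obtain ⟨u, hu, h1, -⟩ := near_pt H hα one_ne_zero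
  obtain ⟨v, hv, h2, -⟩ := near_pt H hα (neg_ne_zero.mpr (one_ne_zero (α := ℝ)))
  obtain ⟨a, ha⟩ := G.T1 ho hu
  obtain ⟨b, hb⟩ := G.T1 ho hv
  have e1 := not_sp H (G.Oc_inv a ho) hu hα (by rw [ha]; exact fun h => h)
  have e2 := not_sp H (G.Oc_inv b ho) hv hα (by rw [hb]; exact fun h => h)
  have e3 : sg α u * sg α v < 0 := mul_neg_of_pos_of_neg (by linarith) (by linarith)
  have e4 : α ∈ sp 𝒜 (pslSMul (j a) o) (pslSMul (j (a * (a⁻¹ * b))) o) := by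
    rw [mul_inv_cancel_left]
    exact ⟨hα, nt (tn e1 e3) (psym e2)⟩
  rw [map_mul, pslSMul_mul, G.sp_img' a] at e4
  exact hinv a α (key _ _ e4)

theorem A0_iff' (H : Arr 𝒜) {u : ℍ} (hu : u ∈ Oc 𝒜) {α : Set ℍ} (hα : α ∈ 𝒜) {p : ℍ} (hp : p ∈ α) :
    α ∈ A0 𝒜 u ↔ sp 𝒜 u p = ∅ := by
  rw [A0_iff H hu hα]
  have : sp 𝒜 u p = sp 𝒜 u (bp α) := by
    ext δ
    by_cases hne : δ = α
    · rw [mem_sp, mem_sp, hne, sg_bp H hα, (mem_iff_sg (H.geo α hα)).mp hp]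
    · rw [mem_sp, mem_sp]
      refine and_congr_right fun hδ => ?_
      have := H.const hα hδ (Ne.symm hne) (bp_mem (H.geo α hα)) hp
      exact ⟨fun h => nt h (psym this), fun h => nt h this⟩
  rw [this]

theorem Gp.A0_img (G : Gp r j ρ 𝒜 g K) (γ : FreeGroup (Fin r)) {u : ℍ} (hu : u ∈ Oc 𝒜) {α : Set ℍ} (hα : α ∈ 𝒜) :
    pslImg (j γ) α ∈ A0 𝒜 (pslSMul (j γ) u) ↔ α ∈ A0 𝒜 u := by
  have H := G.gd.arr
  rw [A0_iff' H (G.Oc_inv γ hu) (G.inv γ α hα) (pslSMul_mem_img (j γ) (bp_mem (H.geo α hα))), G.sp_empty, A0_iff H hu hα]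

theorem Gp.C2 (G : Gp r j ρ 𝒜 g K) {u : ℍ} (hu : u ∈ Oc 𝒜) : (A0 𝒜 u).Finite := by
  have H := G.gd.arr
  obtain ⟨F, hF, hF𝒜, hcov⟩ := G.C1
  have hcov' : ∀ α : Set ℍ, ∃ q : FreeGroup (Fin r) × Set ℍ, α ∈ 𝒜 → q.2 ∈ F ∧ pslImg (j q.1) q.2 = α := by
    intro α
    by_cases hα : α ∈ 𝒜
    · obtain ⟨γ, f, hf, e⟩ := hcov α hα
      exact ⟨(γ, f), fun _ => ⟨hf, e⟩⟩
    · exact ⟨(1, α), fun h => absurd h hα⟩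
  choose q hq using hcov'
  let φ : Set ℍ → Set ℍ × Prop := fun α => ((q α).2, 0 < sg (q α).2 (pslSMul (j (q α).1⁻¹) u))
  have hmaps : ∀ α ∈ A0 𝒜 u, φ α ∈ F ×ˢ (Set.univ : Set Prop) := fun α hα => ⟨(hq α hα.1).1, trivial⟩
  refine Set.Finite.of_finite_image ((hF.prod Set.finite_univ).subset (Set.image_subset_iff.mpr hmaps)) ?_
  intro α hα β hβ he
  obtain ⟨hf, e1⟩ := hq α hα.1
  obtain ⟨hf', e2⟩ := hq β hβ.1
  obtain ⟨h1, h2⟩ := Prod.ext_iff.mp he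
  simp only [φ] at h1 h2
  rw [← h1] at e2 h2
  set f := (q α).2
  set a := (q α).1
  set b := (q β).1
  have ra : pslSMul (j a) (pslSMul (j a⁻¹) u) = u := by rw [map_inv, pslSMul_inv']
  have rb : pslSMul (j b) (pslSMul (j b⁻¹) u) = u := by rw [map_inv, pslSMul_inv']
  have hva := G.Oc_inv a⁻¹ hu
  have hvb := G.Oc_inv b⁻¹ hu
  have A1 : f ∈ A0 𝒜 (pslSMul (j a⁻¹) u) := by
    rw [← G.A0_img a hva (hF𝒜 hf), ra, e1]; exact hα
  have B1 : f ∈ A0 𝒜 (pslSMul (j b⁻¹) u) := by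
    rw [← G.A0_img b hvb (hF𝒜 hf), rb, e2]; exact hβ
  have hsp : sp 𝒜 (pslSMul (j a⁻¹) u) (pslSMul (j b⁻¹) u) = ∅ := by
    rw [Set.eq_empty_iff_forall_notMem]
    rintro δ ⟨hδ, hn⟩
    by_cases hne : δ = f
    · rw [hne] at hn
      have z1 := (mem_Oc H).mp hva f (hF𝒜 hf)
      have z2 := (mem_Oc H).mp hvb f (hF𝒜 hf)
      rcases mul_neg_iff.mp hn with ⟨n1, n2⟩ | ⟨n1, n2⟩
      · have := (iff_of_eq h2).mp n1; linarith
      · have := (iff_of_eq h2).mpr n2; linarith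
    · have := pt (A1.2 δ hδ hne) (psym (B1.2 δ hδ hne))
      linarith
  have hab : a * b⁻¹ = 1 := by
    apply G.T2 hu
    rw [← G.sp_empty a, ra, sp_comm, ← pslSMul_mul, ← map_mul] at hsp
    exact hsp
  have : a = b := by rwa [mul_inv_eq_one] at hab
  rw [← e1, ← e2, this]

theorem Gp.C3 (G : Gp r j ρ 𝒜 g K) (n : ℕ) : ∀ {o : ℍ}, o ∈ Oc 𝒜 → {α | α ∈ 𝒜 ∧ (sp 𝒜 o (bp α)).ncard ≤ n}.Finite := by
  have H := G.gd.arr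
  induction n with
  | zero =>
    intro o ho
    refine (G.C2 ho).subset ?_
    rintro α ⟨hα, h⟩
    rw [A0_iff H ho hα]
    exact (Set.ncard_eq_zero (sp_finite H _ _)).mp (by omega)
  | succ n ih =>
    intro o ho
    have hcr : ∀ β : Set ℍ, ∃ v, β ∈ A0 𝒜 o → v ∈ Oc 𝒜 ∧ sg β o * sg β v < 0 ∧ ∀ δ ∈ 𝒜, δ ≠ β → 0 < sg δ o * sg δ v := by
      intro β
      by_cases hβ : β ∈ A0 𝒜 o
      · obtain ⟨v, h1, h2, -, h3⟩ := crossing H ho hβ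
        exact ⟨v, fun _ => ⟨h1, h2, h3⟩⟩
      · exact ⟨o, fun h => absurd h hβ⟩
    choose v hv using hcr
    refine ((G.C2 ho).union ((G.C2 ho).biUnion (t := fun β => {α | α ∈ 𝒜 ∧ (sp 𝒜 (v β) (bp α)).ncard ≤ n})
      fun β hβ => ih (hv β hβ).1)).subset ?_
    rintro α ⟨hα, hn⟩
    by_cases hemp : (sp 𝒜 o (bp α)).Nonempty
    · right
      obtain ⟨β, hβ, hβs⟩ := first_line H ho hemp
      refine Set.mem_iUnion₂.mpr ⟨β, hβ, hα, ?_⟩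
      obtain ⟨h1, h2, h3⟩ := hv β hβ
      have hnot : β ∉ sp 𝒜 (v β) (bp α) := fun h => by
        have := nn (nsym h2) hβs.2
        have := h.2
        linarith
      have hss : sp 𝒜 (v β) (bp α) ⊂ sp 𝒜 o (bp α) := by
        refine ⟨fun δ hδ => ?_, fun hs => hnot (hs hβs)⟩
        have hne : δ ≠ β := fun h => hnot (h ▸ hδ)
        exact ⟨hδ.1, tn (h3 δ hδ.1 hne) hδ.2⟩
      have := Set.ncard_lt_ncard hss (sp_finite H _ _)
      omega
    · left
      rw [A0_iff H ho hα]
      exact Set.not_nonempty_iff_eq_empty.mp hemp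

theorem Gp.C4 (G : Gp r j ρ 𝒜 g K) {o : ℍ} (ho : o ∈ Oc 𝒜) (M0 : ℝ) :
    {α | α ∈ 𝒜 ∧ ∃ x, dist (pslSMul x o) o ≤ M0 ∧ x ∈ Dh (g α) α o}.Finite := by
  have hK := G.gd.pos
  obtain ⟨M1, hM1⟩ := ((G.C2 ho).image fun β => dist o (bp β) + dist (pslSMul (g β) (bp β)) o).bddAbove
  obtain ⟨n, hn⟩ := exists_nat_gt ((|M1| + |M0|) / K)
  refine (G.C3 n ho).subset ?_
  rintro α ⟨hα, x, hx, hxD⟩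
  refine ⟨hα, ?_⟩
  have hb := G.gd.far_bound ho hα hxD (M := |M1| + |M0|) (by positivity) (by
    intro β hβ
    have h1 := hM1 ⟨β, hβ, rfl⟩
    simp only at h1
    have := le_abs_self M1
    have := le_abs_self M0
    linarith)
  rw [div_lt_iff₀ hK] at hn
  have : ((sp 𝒜 o (bp α)).ncard : ℝ) < n := lt_of_mul_lt_mul_right (by linarith) hK.le
  exact_mod_cast this.le

end

section

/-- region of `PSL2` associated with a point off the lines -/
def Rg (𝒜 : Set (Set ℍ)) (g : Set ℍ → PSL2) (u : ℍ) : Set PSL2 := {x | ∀ α ∈ 𝒜, x ∉ Dh (g α) α u}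

/-- union of the crooked planes -/
def CS (𝒜 : Set (Set ℍ)) (g : Set ℍ → PSL2) : Set PSL2 := ⋃ α ∈ 𝒜, (g α * ·) '' rightCrooked α

variable {r : ℕ} {j ρ : FreeGroup (Fin r) →* PSL2} {𝒜 : Set (Set ℍ)} {g : Set ℍ → PSL2} {K : ℝ}

theorem Gd.adj_in (G : Gd 𝒜 g K) {u : ℍ} (hu : u ∈ Oc 𝒜) {x : PSL2} {α : Set ℍ} (hα : α ∈ 𝒜)
    (hx : x ∈ Dh (g α) α u) : ∃ β ∈ A0 𝒜 u, x ∈ Dh (g β) β u := by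
  by_cases h : (sp 𝒜 u (bp α)).Nonempty
  · obtain ⟨β, hβ, hs⟩ := first_line G.arr hu h
    exact ⟨β, hβ, G.N2 hα hβ hs hx⟩
  · exact ⟨α, (A0_iff G.arr hu hα).mpr (Set.not_nonempty_iff_eq_empty.mp h), hx⟩

theorem Gd.Rg_iff (G : Gd 𝒜 g K) {u : ℍ} (hu : u ∈ Oc 𝒜) {x : PSL2} :
    x ∈ Rg 𝒜 g u ↔ ∀ α ∈ A0 𝒜 u, x ∉ Dh (g α) α u := by
  constructor
  · intro h α hα; exact h α hα.1
  · intro h α hα hx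
    obtain ⟨β, hβ, hb⟩ := G.adj_in hu hα hx
    exact h β hβ hb

theorem Gd.Rg_congr (G : Gd 𝒜 g K) {u v : ℍ} (hu : u ∈ Oc 𝒜) (hv : v ∈ Oc 𝒜) (h : sp 𝒜 u v = ∅) :
    Rg 𝒜 g u = Rg 𝒜 g v := by
  ext x
  refine forall₂_congr fun α hα => ?_
  rw [Dh_congr (not_sp G.arr hu hv hα (by rw [h]; exact fun h => h))]

theorem Gd.Rg_inj (G : Gd 𝒜 g K) {u v : ℍ} {x : PSL2} (h1 : x ∈ Rg 𝒜 g u) (h2 : x ∈ Rg 𝒜 g v) : sp 𝒜 u v = ∅ := by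
  rw [Set.eq_empty_iff_forall_notMem]
  rintro α ⟨hα, hn⟩
  have := Set.mem_univ x
  rw [← Dh_union (G.arr.geo α hα) hn (g α)] at this
  rcases this with h | h
  · exact h1 α hα h
  · exact h2 α hα h

theorem Gp.Rg_img (G : Gp r j ρ 𝒜 g K) (γ : FreeGroup (Fin r)) {u : ℍ} {x : PSL2} :
    ρ γ * x * (j γ)⁻¹ ∈ Rg 𝒜 g (pslSMul (j γ) u) ↔ x ∈ Rg 𝒜 g u := by
  have H := G.gd.arr
  constructor
  · intro h α hα hx
    refine h _ (G.inv γ α hα) ?_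
    rw [G.equiv γ α hα]
    exact (Dh_equiv (H.geo α hα) _ _ _ _ _).mpr hx
  · intro h α hα hx
    have h1 := G.inv γ⁻¹ α hα
    refine h _ h1 ?_
    have e : pslImg (j γ) (pslImg (j γ⁻¹) α) = α := by rw [map_inv, pslImg_inv_img]
    rw [← Dh_equiv (H.geo _ h1) (j γ) (ρ γ), ← G.equiv γ _ h1, e]
    exact hx

theorem Gd.Rg_sub (G : Gd 𝒜 g K) {u : ℍ} (hu : u ∈ Oc 𝒜) : Rg 𝒜 g u ⊆ (CS 𝒜 g)ᶜ := by
  intro x hx hC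
  obtain ⟨α, hα, h⟩ := Set.mem_iUnion₂.mp hC
  exact hx α hα (crook_sub (G.arr.geo α hα) ((mem_Oc G.arr).mp hu α hα) _ h)

theorem Gp.part_open (G : Gp r j ρ 𝒜 g K) {u : ℍ} (hu : u ∈ Oc 𝒜) {S : Set (Set ℍ)} (hS : S ⊆ A0 𝒜 u) :
    IsOpen {x | ∀ α ∈ S, x ∉ Dh (g α) α u} := by
  have H := G.gd.arr
  have : {x | ∀ α ∈ S, x ∉ Dh (g α) α u} = ⋂ α ∈ S, (Dh (g α) α u)ᶜ := by
    ext x; simp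
  rw [this]
  exact ((G.C2 hu).subset hS).isOpen_biInter fun α hα =>
    (Dh_closed (H.geo α (hS hα).1) ((mem_Oc H).mp hu α (hS hα).1) _).isOpen_compl

theorem Gp.part_preconn (G : Gp r j ρ 𝒜 g K) {u : ℍ} (hu : u ∈ Oc 𝒜) :
    IsPreconnected {x | ∀ α ∈ A0 𝒜 u, x ∉ Dh (g α) α u} := by
  have H := G.gd.arr
  refine Set.Finite.induction_on_subset (motive := fun S _ => IsPreconnected {x | ∀ α ∈ S, x ∉ Dh (g α) α u})
    (A0 𝒜 u) (G.C2 hu) ?_ ?_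
  · simpa using psl_preconn
  · intro α S hα hS hαS ih
    have e : {x | ∀ β ∈ insert α S, x ∉ Dh (g β) β u} = {x | ∀ β ∈ S, x ∉ Dh (g β) β u} \ Dh (g α) α u := by
      ext x
      constructor
      · intro h; exact ⟨fun β hβ => h β (Or.inr hβ), h α (Or.inl rfl)⟩
      · rintro ⟨h1, h2⟩ β (rfl | hβ)
        · exact h2
        · exact h1 β hβ
    rw [e]
    refine Dh_step (H.geo α hα.1) ((mem_Oc H).mp hu α hα.1) (g α) (G.part_open hu hS) ih ?_
    intro x hx β hβ hxβ
    exact G.gd.N3 hα (hS hβ) (fun h => hαS (h ▸ hβ)) hx hxβ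

theorem Gp.Rg_eq (G : Gp r j ρ 𝒜 g K) {u : ℍ} (hu : u ∈ Oc 𝒜) :
    Rg 𝒜 g u = {x | ∀ α ∈ A0 𝒜 u, x ∉ Dh (g α) α u} := Set.ext fun _ => G.gd.Rg_iff hu

theorem Gp.Rg_open (G : Gp r j ρ 𝒜 g K) {u : ℍ} (hu : u ∈ Oc 𝒜) : IsOpen (Rg 𝒜 g u) := by
  rw [G.Rg_eq hu]; exact G.part_open hu subset_rfl

theorem Gp.Rg_preconn (G : Gp r j ρ 𝒜 g K) {u : ℍ} (hu : u ∈ Oc 𝒜) : IsPreconnected (Rg 𝒜 g u) := by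
  rw [G.Rg_eq hu]; exact G.part_preconn hu

theorem Gp.adj (G : Gp r j ρ 𝒜 g K) {u : ℍ} (hu : u ∈ Oc 𝒜) {α : Set ℍ} (hα : α ∈ A0 𝒜 u) {c : PSL2}
    (hc : c ∈ (g α * ·) '' rightCrooked α) : c ∈ closure (Rg 𝒜 g u) := by
  have H := G.gd.arr
  have hne := (mem_Oc H).mp hu α hα.1
  rw [mem_closure_iff_nhds]
  intro N hN
  have hW : {x | ∀ β ∈ A0 𝒜 u \ {α}, x ∉ Dh (g β) β u} ∈ 𝓝 c := by
    refine (G.part_open hu Set.sdiff_subset).mem_nhds ?_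
    intro β hβ h
    exact G.gd.N3 hα hβ.1 (fun h => hβ.2 h.symm) (crook_sub (H.geo α hα.1) hne _ hc) h
  obtain ⟨y, ⟨hyN, hyW⟩, hy⟩ := Dh_near (H.geo α hα.1) hne (g α) hc (Filter.inter_mem hN hW)
  refine ⟨y, hyN, (G.gd.Rg_iff hu).mpr fun β hβ => ?_⟩
  by_cases hb : β = α
  · rw [hb]; exact hy
  · exact hyW β ⟨hβ, hb⟩

theorem Gp.Rg_cover (G : Gp r j ρ 𝒜 g K) {x : PSL2} (hx : x ∉ CS 𝒜 g) (n : ℕ) : ∀ {u : ℍ}, u ∈ Oc 𝒜 →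
    {α | α ∈ 𝒜 ∧ x ∈ Dh (g α) α u}.ncard = n → ∃ v ∈ Oc 𝒜, x ∈ Rg 𝒜 g v := by
  have H := G.gd.arr
  induction n using Nat.strong_induction_on with
  | _ n ih =>
  intro u hu hn
  by_cases hR : x ∈ Rg 𝒜 g u
  · exact ⟨u, hu, hR⟩
  · unfold Rg at hR
    rw [Set.mem_ofPred_eq] at hR
    push Not at hR
    obtain ⟨α, hα, hxα⟩ := hR
    obtain ⟨β, hβ, hxβ⟩ := G.gd.adj_in hu hα hxα
    obtain ⟨v, hv, h1, -, h3⟩ := crossing H hu hβ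
    have hnot : x ∉ Dh (g β) β v := fun h => by
      refine hx (Set.mem_iUnion₂.mpr ⟨β, hβ.1, ?_⟩)
      rw [← Dh_inter (H.geo β hβ.1) h1 (g β)]
      exact ⟨hxβ, h⟩
    have hss : {α | α ∈ 𝒜 ∧ x ∈ Dh (g α) α v} ⊂ {α | α ∈ 𝒜 ∧ x ∈ Dh (g α) α u} := by
      refine ⟨?_, fun hs => hnot (hs ⟨hβ.1, hxβ⟩).2⟩
      rintro δ ⟨hδ, h⟩
      have hne : δ ≠ β := by rintro rfl; exact hnot h
      exact ⟨hδ, by rw [Dh_congr (h3 δ hδ hne)]; exact h⟩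
    have hfin : {α | α ∈ 𝒜 ∧ x ∈ Dh (g α) α u}.Finite :=
      (G.C4 hu (dist (pslSMul x u) u)).subset fun δ hδ => ⟨hδ.1, x, le_rfl, hδ.2⟩
    have := Set.ncard_lt_ncard hss hfin
    exact ih _ (by omega) hv rfl

theorem Gp.cl_cover (G : Gp r j ρ 𝒜 g K) {o : ℍ} (ho : o ∈ Oc 𝒜) (x : PSL2) :
    ∃ γ, x ∈ closure (Rg 𝒜 g (pslSMul (j γ) o)) := by
  have H := G.gd.arr
  obtain ⟨u, hu, h⟩ : ∃ u ∈ Oc 𝒜, x ∈ closure (Rg 𝒜 g u) := by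
    by_cases hx : x ∈ CS 𝒜 g
    · obtain ⟨α, hα, h⟩ := Set.mem_iUnion₂.mp hx
      obtain ⟨u, hu, -, h2⟩ := near_pt H hα one_ne_zero
      exact ⟨u, hu, G.adj hu ⟨hα, h2⟩ h⟩
    · obtain ⟨u, hu, h⟩ := G.Rg_cover hx _ ho rfl
      exact ⟨u, hu, subset_closure h⟩
  obtain ⟨γ, hγ⟩ := G.T1 ho hu
  exact ⟨γ, by rw [G.gd.Rg_congr (G.Oc_inv γ ho) hu hγ]; exact h⟩

theorem Gp.Rg_nonempty (G : Gp r j ρ 𝒜 g K) {o : ℍ} (ho : o ∈ Oc 𝒜) : (Rg 𝒜 g o).Nonempty := by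
  by_cases h : (A0 𝒜 o).Nonempty
  · obtain ⟨α, hα⟩ := h
    rw [← closure_nonempty_iff]
    exact ⟨g α, G.adj ho hα (crook_nonempty (G.gd.arr.geo α hα.1) _)⟩
  · refine ⟨1, (G.gd.Rg_iff ho).mpr fun α hα => (h ⟨α, hα⟩).elim⟩

theorem Gp.Rg_cc (G : Gp r j ρ 𝒜 g K) {o : ℍ} (ho : o ∈ Oc 𝒜) {x : PSL2} (hx : x ∈ Rg 𝒜 g o) :
    connectedComponentIn (CS 𝒜 g)ᶜ x = Rg 𝒜 g o := by
  have H := G.gd.arr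
  refine Set.Subset.antisymm ?_ ((G.Rg_preconn ho).subset_connectedComponentIn hx (G.gd.Rg_sub ho))
  intro y hy α hα hyD
  have hne := (mem_Oc H).mp ho α hα
  obtain ⟨v, hv⟩ := exists_opp hne
  have hxv : x ∈ Dh (g α) α v := by
    have := Set.mem_univ x
    rw [← Dh_union (H.geo α hα) hv (g α)] at this
    exact this.resolve_left (hx α hα)
  have hp : IsPreconnected (connectedComponentIn (CS 𝒜 g)ᶜ x) := isPreconnected_connectedComponentIn
  rw [isPreconnected_closed_iff] at hp
  obtain ⟨z, hz, hzc⟩ := hp _ _ (Dh_closed (H.geo α hα) hne (g α)) (Dh_closed (H.geo α hα) (ne_right' hv) (g α))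
    (by rw [Dh_union (H.geo α hα) hv (g α)]; exact Set.subset_univ _) ⟨y, hy, hyD⟩
    ⟨x, mem_connectedComponentIn (G.gd.Rg_sub ho hx), hxv⟩
  rw [Dh_inter (H.geo α hα) hv (g α)] at hzc
  exact connectedComponentIn_subset _ _ hz (Set.mem_iUnion₂.mpr ⟨α, hα, hzc⟩)

/-- the action as a homeomorphism -/
def actH (a b : PSL2) : PSL2 ≃ₜ PSL2 := (Homeomorph.mulLeft b).trans (Homeomorph.mulRight a⁻¹)

theorem Gp.actImg_cl (G : Gp r j ρ 𝒜 g K) (γ : FreeGroup (Fin r)) (o : ℍ) :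
    actImg j ρ γ (closure (Rg 𝒜 g o)) = closure (Rg 𝒜 g (pslSMul (j γ) o)) := by
  change actH (j γ) (ρ γ) '' closure (Rg 𝒜 g o) = _
  rw [(actH (j γ) (ρ γ)).image_closure]
  congr 1
  ext y
  constructor
  · rintro ⟨x, hx, rfl⟩
    exact (G.Rg_img γ).mpr hx
  · intro hy
    refine ⟨(ρ γ)⁻¹ * y * j γ, ?_, ?_⟩
    · rw [← G.Rg_img γ]
      convert hy using 1
      group
    · change ρ γ * ((ρ γ)⁻¹ * y * j γ) * (j γ)⁻¹ = y
      group

theorem Gp.same (G : Gp r j ρ 𝒜 g K) {o : ℍ} (ho : o ∈ Oc 𝒜) {a b : FreeGroup (Fin r)}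
    (h : sp 𝒜 (pslSMul (j a) o) (pslSMul (j b) o) = ∅) : a = b := by
  have : b⁻¹ * a = 1 := by
    apply G.T2 ho
    rw [← G.sp_empty b⁻¹, ← pslSMul_mul, ← pslSMul_mul, ← map_mul, ← map_mul, inv_mul_cancel, map_one, pslSMul_one] at h
    exact h
  exact (inv_mul_eq_one.mp this).symm

theorem Gp.fund (G : Gp r j ρ 𝒜 g K) {o : ℍ} (ho : o ∈ Oc 𝒜) : IsFundDom j ρ (closure (Rg 𝒜 g o)) := by
  refine ⟨isClosed_closure, ?_, ?_⟩
  · rw [Set.eq_univ_iff_forall]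
    intro x
    obtain ⟨γ, h⟩ := G.cl_cover ho x
    refine Set.mem_iUnion.mpr ⟨γ, ?_⟩
    rw [G.actImg_cl]; exact h
  · intro a b hab
    rw [G.actImg_cl, G.actImg_cl]
    by_contra hn
    rw [Set.not_disjoint_iff] at hn
    obtain ⟨x, h1, h2⟩ := hn
    obtain ⟨y, ⟨hy1, hy2⟩, hya⟩ := mem_closure_iff.mp (interior_subset h1) _
      (isOpen_interior.inter isOpen_interior) ⟨h1, h2⟩
    obtain ⟨z, hza, hzb⟩ := mem_closure_iff.mp (interior_subset hy2) _ (G.Rg_open (G.Oc_inv a ho)) hya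
    exact hab (G.same ho (G.gd.Rg_inj hza hzb))

theorem Gp.pd (G : Gp r j ρ 𝒜 g K) : ProperlyDisc j ρ := by
  have H := G.gd.arr
  obtain ⟨o, ho⟩ := Oc_nonempty H
  intro Q hQ
  have hc : Continuous fun x : PSL2 => dist (pslSMul x o) o := (continuous_orbit o).dist continuous_const
  obtain ⟨M0, hM0⟩ := (hQ.image hc).bddAbove
  have hE := G.C4 ho M0
  set E := {α | α ∈ 𝒜 ∧ ∃ x, dist (pslSMul x o) o ≤ M0 ∧ x ∈ Dh (g α) α o} with hEdef
  have hΔ : {δ | (Q ∩ closure (Rg 𝒜 g (pslSMul (j δ) o))).Nonempty}.Finite := by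
    refine Set.Finite.of_finite_image (f := fun δ => sp 𝒜 o (pslSMul (j δ) o)) (hE.finite_subsets.subset ?_) ?_
    · rintro _ ⟨δ, ⟨x, hxQ, hx⟩, rfl⟩
      rintro α ⟨hα, hn⟩
      refine ⟨hα, x, hM0 ⟨x, hxQ, rfl⟩, ?_⟩
      have hsub : Rg 𝒜 g (pslSMul (j δ) o) ⊆ Dh (g α) α o := by
        intro y hy
        have := Set.mem_univ y
        rw [← Dh_union (H.geo α hα) hn (g α)] at this
        exact this.resolve_right (hy α hα)
      exact closure_minimal hsub (Dh_closed (H.geo α hα) ((mem_Oc H).mp ho α hα) _) hx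
    · intro a _ b _ hab
      simp only at hab
      apply G.same ho
      rw [Set.eq_empty_iff_forall_notMem]
      intro δ hδ
      by_cases h : δ ∈ sp 𝒜 o (pslSMul (j a) o)
      · have h' := h
        rw [hab] at h'
        have := nn (nsym h.2) h'.2
        have := hδ.2
        linarith
      · rcases sp_tri H ho hδ with h1 | h1
        · exact h (sp_comm 𝒜 _ _ ▸ h1)
        · exact h (hab ▸ h1)
  refine (hΔ.image2 (fun a b => a * b⁻¹) hΔ).subset ?_
  rintro γ ⟨y, ⟨x, hx, rfl⟩, hy⟩
  obtain ⟨δ, hδ⟩ := G.cl_cover ho x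
  refine ⟨γ * δ, ⟨_, hy, ?_⟩, δ, ⟨x, hx, hδ⟩, by simp⟩
  rw [map_mul, pslSMul_mul, ← G.actImg_cl]
  exact ⟨x, hδ, rfl⟩

end

theorem stmt8 (r : ℕ) (j ρ : FreeGroup (Fin r) →* PSL2)
    (𝒜 : Set (Set ℍ))
    (hgeo : ∀ α ∈ 𝒜, IsGeodesicLine α)
    (hinv : ∀ (γ : FreeGroup (Fin r)), ∀ α ∈ 𝒜, pslImg (j γ) α ∈ 𝒜)
    (hdisj : ∀ α ∈ 𝒜, ∀ α' ∈ 𝒜, α ≠ α' →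
      α ∩ α' = ∅ ∧ ∀ ξ : OnePoint ℝ, IsEndpoint α ξ → ¬ IsEndpoint α' ξ)
    (hlf : ∀ K : Set ℍ, IsCompact K → {α ∈ 𝒜 | (α ∩ K).Nonempty}.Finite)
    (htrans : ∀ U V : Set ℍ, IsCC (⋃ α ∈ 𝒜, α)ᶜ U → IsCC (⋃ α ∈ 𝒜, α)ᶜ V →
      ∃! γ : FreeGroup (Fin r), pslImg (j γ) U = V)
    (g : Set ℍ → PSL2)
    (hequiv : ∀ (γ : FreeGroup (Fin r)), ∀ α ∈ 𝒜,
      g (pslImg (j γ) α) = ρ γ * g α * (j γ)⁻¹)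
    (K : ℝ) (hK : 0 < K)
    (hcontr : ∀ α ∈ 𝒜, ∀ α' ∈ 𝒜, α ≠ α' → ∀ x ∈ α, ∀ x' ∈ α',
      dist (pslSMul (g α) x) (pslSMul (g α') x') ≤ dist x x' - K) :
    ProperlyDisc j ρ ∧
      (∀ α ∈ 𝒜, ∀ α' ∈ 𝒜, α ≠ α' →
        Disjoint ((g α * ·) '' rightCrooked α) ((g α' * ·) '' rightCrooked α')) ∧
      ∃ x ∈ (⋃ α ∈ 𝒜, (g α * ·) '' rightCrooked α)ᶜ,
        IsFundDom j ρ
          (closure (connectedComponentIn (⋃ α ∈ 𝒜, (g α * ·) '' rightCrooked α)ᶜ x)) := by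
  have H : Arr 𝒜 := ⟨hgeo, fun α hα β hβ h => (hdisj α hα β hβ h).1, hlf⟩
  have G : Gp r j ρ 𝒜 g K := ⟨⟨H, hK, hcontr⟩, hinv, htrans, hequiv⟩
  obtain ⟨o, ho⟩ := Oc_nonempty H
  obtain ⟨x, hx⟩ := G.Rg_nonempty ho
  refine ⟨G.pd, fun α hα β hβ hne => G.gd.crook_disj hα hβ hne, x, G.gd.Rg_sub ho hx, ?_⟩
  have e := G.Rg_cc ho hx
  unfold CS at e
  rw [e]
  exact G.fund ho

end
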